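/- Let 865/886 < γ < 1, a ∈ ℤ \ {0}, 1 < c < 3 with c ≠ 2, and A > 0 be fixed, and let ε > 0 be sufficiently small. Set θ = (443/55)γ − 173/22 − ε and D = X^θ. Then for all sufficiently large X and all real t with |t| < X^(1/4 − c), one has Σ_{d ≤ D, gcd(d,a)=1} | Σ_{p ≤ X, p ≡ a (mod d)} p^{1−γ} (ψ(−(p+1)^γ) − ψ(−p^γ)) e(t p^c) log p | ≪ X / (log X)^A. -/

import Mathlib

/-- `e(t) = exp(2πit)`. -/
noncomputable def e (t : ℝ) : ℂ := Complex.exp (2 * Real.pi * Complex.I * t)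

/-- The sawtooth function `ψ(t) = {t} - 1/2`. -/
noncomputable def saw (t : ℝ) : ℝ := Int.fract t - 1 / 2

namespace BVP

lemma e_add (x y : ℝ) : e (x + y) = e x * e y := by
  unfold e; rw [← Complex.exp_add]; congr 1; push_cast; ring

lemma e_zero : e 0 = 1 := by simp [e]

lemma e_eq (x : ℝ) : e x = Complex.exp (((2 * Real.pi * x : ℝ) : ℂ) * Complex.I) := by
  unfold e; congr 1; push_cast; ring

lemma norm_e (x : ℝ) : ‖e x‖ = 1 := by
  rw [e_eq, Complex.norm_exp_ofReal_mul_I]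

lemma e_neg (x : ℝ) : e (-x) = (starRingEnd ℂ) (e x) := by
  rw [e_eq, e_eq, ← Complex.exp_conj]; congr 1
  rw [map_mul, Complex.conj_ofReal, Complex.conj_I]; push_cast; ring

lemma e_sub (x y : ℝ) : e (x - y) = e x * (starRingEnd ℂ) (e y) := by
  rw [sub_eq_add_neg, e_add, e_neg]

lemma e_int (k : ℤ) : e (k : ℝ) = 1 := by
  unfold e
  rw [show (2 * (Real.pi : ℂ) * Complex.I * ((k : ℝ) : ℂ)) = k * (2 * Real.pi * Complex.I) by
    push_cast; ring]
  exact Complex.exp_int_mul_two_pi_mul_I k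

lemma norm_e_sub_one_le (x : ℝ) : ‖e x - 1‖ ≤ 2 * Real.pi * |x| := by
  rw [e_eq, mul_comm]
  have := Real.norm_exp_I_mul_ofReal_sub_one_le (x := 2 * Real.pi * x)
  refine this.trans ?_
  rw [Real.norm_eq_abs, abs_mul, abs_of_pos Real.two_pi_pos]

lemma norm_e_sub_le (x y : ℝ) : ‖e x - e y‖ ≤ 2 * Real.pi * |x - y| := by
  have : e x - e y = e y * (e (x - y) - 1) := by
    rw [mul_sub, ← e_add]; simp
  rw [this, norm_mul, norm_e, one_mul]
  exact norm_e_sub_one_le _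

lemma e_mul_conj (x : ℝ) : e x * (starRingEnd ℂ) (e x) = 1 := by
  rw [← e_sub, sub_self, e_zero]

lemma e_re (x : ℝ) : (e x).re = Real.cos (2 * Real.pi * x) := by
  rw [e_eq, Complex.exp_ofReal_mul_I_re]

lemma e_im (x : ℝ) : (e x).im = Real.sin (2 * Real.pi * x) := by
  rw [e_eq, Complex.exp_ofReal_mul_I_im]

end BVP

namespace BVP
open Finset

/-- normalized cotangent -/
noncomputable def ct (x : ℝ) : ℝ := Real.cos (Real.pi * x) / Real.sin (Real.pi * x)

lemma sin_lower {x Δ : ℝ} (hΔ : 0 < Δ) (h1 : Δ ≤ x) (h2 : x ≤ 1 - Δ) :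
    2 * Δ ≤ Real.sin (Real.pi * x) := by
  have hpi := Real.pi_pos
  rcases le_total x (1/2) with h | h
  · have := Real.mul_le_sin (x := Real.pi * x) (by nlinarith) (by nlinarith)
    have h3 : 2 / Real.pi * (Real.pi * x) = 2 * x := by field_simp
    linarith
  · have := Real.mul_le_sin (x := Real.pi * (1 - x)) (by nlinarith) (by nlinarith)
    have h3 : 2 / Real.pi * (Real.pi * (1 - x)) = 2 * (1 - x) := by field_simp
    have h4 : Real.sin (Real.pi * (1 - x)) = Real.sin (Real.pi * x) := by
      rw [mul_sub, mul_one, Real.sin_pi_sub]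
    linarith

lemma ct_mul {x : ℝ} (hs : Real.sin (Real.pi * x) ≠ 0) :
    ((1 + Complex.I * (ct x : ℂ)) / 2) * (1 - e x) = 1 := by
  have h1 : e x = ((Real.cos (2 * (Real.pi * x)) : ℝ) : ℂ)
      + ((Real.sin (2 * (Real.pi * x)) : ℝ) : ℂ) * Complex.I := by
    rw [e_eq, Complex.exp_mul_I, ← Complex.ofReal_cos, ← Complex.ofReal_sin, mul_assoc]
  rw [h1, Real.cos_two_mul, Real.sin_two_mul]
  unfold ct
  set s := Real.sin (Real.pi * x)
  set k := Real.cos (Real.pi * x)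
  have hsk : (s : ℂ) ^ 2 + (k : ℂ) ^ 2 = 1 := by
    have := Real.sin_sq_add_cos_sq (Real.pi * x)
    exact_mod_cast this
  have hs' : (s : ℂ) ≠ 0 := by exact_mod_cast hs
  push_cast
  field_simp
  have hI := Complex.I_sq
  linear_combination (-2 * (s:ℂ) * (k:ℂ)^2) * hI + (- 2 * Complex.I * k) * hsk

lemma ct_anti {x y : ℝ} (hx : 0 < x) (hxy : x ≤ y) (hy : y < 1) : ct y ≤ ct x := by
  have hpi := Real.pi_pos
  have h1 : 0 < Real.sin (Real.pi * x) := Real.sin_pos_of_pos_of_lt_pi (by positivity) (by nlinarith)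
  have h2 : 0 < Real.sin (Real.pi * y) :=
    Real.sin_pos_of_pos_of_lt_pi (mul_pos hpi (by linarith)) (by nlinarith)
  have h3 : 0 ≤ Real.sin (Real.pi * y - Real.pi * x) :=
    Real.sin_nonneg_of_nonneg_of_le_pi (by nlinarith) (by nlinarith)
  rw [Real.sin_sub] at h3
  unfold ct
  rw [div_le_div_iff₀ h2 h1]
  linarith

lemma ct_abs {x Δ : ℝ} (hΔ : 0 < Δ) (h1 : Δ ≤ x) (h2 : x ≤ 1 - Δ) : |ct x| ≤ 1 / (2 * Δ) := by
  have h := sin_lower hΔ h1 h2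
  unfold ct
  rw [abs_div, abs_of_pos (by linarith : 0 < Real.sin (Real.pi * x))]
  exact div_le_div₀ (by norm_num) (Real.abs_cos_le_one _) (by linarith) h

lemma c_norm {x Δ : ℝ} (hΔ : 0 < Δ) (h1 : Δ ≤ x) (h2 : x ≤ 1 - Δ) :
    ‖(1 + Complex.I * (ct x : ℂ)) / 2‖ ≤ 1 / (4 * Δ) := by
  have h := sin_lower hΔ h1 h2
  have hs : 0 < Real.sin (Real.pi * x) := by linarith
  have e1 : (1 + Complex.I * (ct x : ℂ)) / 2 =
      ((1 / (2 * Real.sin (Real.pi * x)) : ℝ) : ℂ) *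
        ((Real.sin (Real.pi * x) : ℂ) + Complex.I * (Real.cos (Real.pi * x) : ℂ)) := by
    unfold ct
    have hs' : ((Real.sin (Real.pi * x) : ℝ) : ℂ) ≠ 0 := by exact_mod_cast hs.ne'
    push_cast at hs' ⊢
    field_simp
  have e2 : ‖((Real.sin (Real.pi * x) : ℂ) + Complex.I * (Real.cos (Real.pi * x) : ℂ))‖ = 1 := by
    rw [Complex.norm_def, Complex.normSq_apply]
    simp only [Complex.add_re, Complex.ofReal_re, Complex.mul_re, Complex.I_re, Complex.I_im,
      Complex.ofReal_im, Complex.add_im, Complex.mul_im]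
    rw [show (Real.sin (Real.pi * x) + (0 * Real.cos (Real.pi * x) - 1 * 0)) *
      (Real.sin (Real.pi * x) + (0 * Real.cos (Real.pi * x) - 1 * 0)) +
      (0 + (0 * 0 + 1 * Real.cos (Real.pi * x))) * (0 + (0 * 0 + 1 * Real.cos (Real.pi * x)))
      = Real.sin (Real.pi * x) ^ 2 + Real.cos (Real.pi * x) ^ 2 by ring]
    rw [Real.sin_sq_add_cos_sq, Real.sqrt_one]
  rw [e1, norm_mul, e2, mul_one, Complex.norm_real, Real.norm_eq_abs, abs_of_pos (by positivity)]
  exact one_div_le_one_div_of_le (by linarith) (by linarith)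

lemma abel_kl (c E : ℕ → ℂ) (m : ℕ) :
    ∑ n ∈ range (m + 1), c n * (E n - E (n + 1)) =
      c 0 * E 0 - c m * E (m + 1) + ∑ i ∈ range m, (c (i + 1) - c i) * E (i + 1) := by
  induction m with
  | zero => simp; ring
  | succ m ih => rw [sum_range_succ, ih, sum_range_succ _ m]; ring

/-- Kusmin–Landau. -/
lemma kl0 (f : ℕ → ℝ) (L : ℕ) (j : ℤ) (Δ : ℝ) (hΔ : 0 < Δ)
    (hmono : ∀ n, n + 1 < L → f (n + 1) - f n ≤ f (n + 2) - f (n + 1))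
    (hr : ∀ n, n < L → j + Δ ≤ f (n + 1) - f n ∧ f (n + 1) - f n ≤ j + 1 - Δ) :
    ‖∑ n ∈ range L, e (f n)‖ ≤ 1 / Δ := by
  rcases L with _ | m
  · simp; positivity
  set x : ℕ → ℝ := fun n => f (n + 1) - f n - j with hx
  set c : ℕ → ℂ := fun n => (1 + Complex.I * (ct (x n) : ℂ)) / 2 with hc
  have hx1 : ∀ n, n < m + 1 → Δ ≤ x n ∧ x n ≤ 1 - Δ := fun n hn => by
    have := hr n hn; simp only [hx]; constructor <;> linarith
  have key : ∀ n, n < m + 1 → e (f n) = c n * (e (f n) - e (f (n + 1))) := by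
    intro n hn
    have h1 := hx1 n hn
    have h2 := sin_lower hΔ h1.1 h1.2
    have h3 : e (f (n + 1)) = e (f n) * e (x n) := by
      rw [← e_add]
      have : f (n + 1) = f n + x n + j := by simp only [hx]; ring
      rw [this, e_add _ (j : ℝ), e_int, mul_one]
    have h4 := ct_mul (x := x n) (by linarith)
    rw [h3]
    calc e (f n) = e (f n) * (((1 + Complex.I * (ct (x n) : ℂ)) / 2) * (1 - e (x n))) := by
          rw [h4, mul_one]
      _ = _ := by simp only [hc]; ring
  rw [sum_congr rfl (fun n hn => key n (mem_range.1 hn)), abel_kl c (fun n => e (f n)) m]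
  have b1 : ‖c 0 * e (f 0)‖ ≤ 1 / (4 * Δ) := by
    rw [norm_mul, norm_e, mul_one]; exact c_norm hΔ (hx1 0 (by omega)).1 (hx1 0 (by omega)).2
  have b2 : ‖c m * e (f (m + 1))‖ ≤ 1 / (4 * Δ) := by
    rw [norm_mul, norm_e, mul_one]; exact c_norm hΔ (hx1 m (by omega)).1 (hx1 m (by omega)).2
  have b3 : ‖∑ i ∈ range m, (c (i + 1) - c i) * e (f (i + 1))‖ ≤ (ct (x 0) - ct (x m)) / 2 := by
    calc _ ≤ ∑ i ∈ range m, (ct (x i) - ct (x (i + 1))) / 2 := by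
          refine norm_sum_le_of_le _ fun i hi => ?_
          have hi' := mem_range.1 hi
          rw [norm_mul, norm_e, mul_one]
          have : c (i + 1) - c i = Complex.I * (((ct (x (i + 1)) - ct (x i)) / 2 : ℝ) : ℂ) := by
            simp only [hc]; push_cast; ring
          rw [this, norm_mul, Complex.norm_I, one_mul, Complex.norm_real, Real.norm_eq_abs]
          have h1 := hx1 i (by omega)
          have h2 := hx1 (i + 1) (by omega)
          have h3 : x i ≤ x (i + 1) := by
            have := hmono i (by omega); simp only [hx]; linarith
          have := ct_anti (by linarith) h3 (by linarith)
          rw [abs_of_nonpos (by linarith)]; linarith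
      _ = _ := by
          rw [← sum_div, sum_range_sub' (fun i => ct (x i))]
  have b4 := abs_le.1 (ct_abs hΔ (hx1 0 (by omega)).1 (hx1 0 (by omega)).2)
  have b5 := abs_le.1 (ct_abs hΔ (hx1 m (by omega)).1 (hx1 m (by omega)).2)
  have e1 : 1 / (4 * Δ) = (1 / Δ) / 4 := by field_simp
  have e2 : 1 / (2 * Δ) = (1 / Δ) / 2 := by field_simp
  calc _ ≤ ‖c 0 * e (f 0)‖ + ‖c m * e (f (m + 1))‖ + _ :=
        (norm_add_le _ _).trans (add_le_add_left (norm_sub_le _ _) _)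
    _ ≤ 1 / Δ := by rw [e1] at b1 b2; rw [e2] at b4 b5; linarith

lemma kl (f : ℕ → ℝ) (a b : ℕ) (j : ℤ) (Δ : ℝ) (hΔ : 0 < Δ)
    (hmono : ∀ n, a ≤ n → n + 1 < b → f (n + 1) - f n ≤ f (n + 2) - f (n + 1))
    (hr : ∀ n, a ≤ n → n < b → j + Δ ≤ f (n + 1) - f n ∧ f (n + 1) - f n ≤ j + 1 - Δ) :
    ‖∑ n ∈ Ico a b, e (f n)‖ ≤ 1 / Δ := by
  rw [sum_Ico_eq_sum_range]
  refine kl0 (fun n => f (a + n)) (b - a) j Δ hΔ ?_ ?_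
  · intro n hn; exact hmono (a + n) (by omega) (by omega)
  · intro n hn; exact hr (a + n) (by omega) (by omega)

end BVP

namespace BVP
open Finset

/-- forward difference -/
def dif (f : ℕ → ℝ) : ℕ → ℝ := fun n => f (n + 1) - f n

lemma filter_interval (g : ℕ → ℝ) (L : ℕ) (hg : ∀ i j, i ≤ j → j < L → g i ≤ g j) (y y' : ℝ) :
    ∃ p q, q ≤ L ∧ (range L).filter (fun n => y ≤ g n ∧ g n < y') = Ico p q := by
  have key : ∀ y : ℝ, ∃ p, p ≤ L ∧ ∀ n < L, g n < y ↔ n < p := by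
    intro y
    refine ⟨#((range L).filter (fun n => g n < y)), ?_, ?_⟩
    · exact (card_filter_le _ _).trans (by simp)
    · intro n hn
      constructor
      · intro h
        have : range (n + 1) ⊆ (range L).filter (fun n => g n < y) := by
          intro i hi
          have hi' := mem_range.1 hi
          exact mem_filter.2 ⟨mem_range.2 (by omega), (hg i n (by omega) hn).trans_lt h⟩
        have := card_le_card this
        simp at this; omega
      · intro h
        by_contra hcon
        push Not at hcon
        have : (range L).filter (fun n => g n < y) ⊆ range n := by
          intro i hi
          have hi' := mem_filter.1 hi
          rw [mem_range]
          by_contra h3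
          have := hg n i (by omega) (mem_range.1 hi'.1)
          linarith [hi'.2]
        have := card_le_card this
        simp only [card_range] at this; omega
  obtain ⟨p, hp, hp'⟩ := key y
  obtain ⟨q, hq, hq'⟩ := key y'
  refine ⟨p, q, hq, ?_⟩
  ext n
  simp only [mem_filter, mem_range, mem_Ico]
  constructor
  · rintro ⟨h1, h2, h3⟩
    exact ⟨by by_contra h; exact absurd ((hp' n h1).2 (by omega)) (by linarith), (hq' n h1).1 h3⟩
  · rintro ⟨h1, h2⟩
    have hn : n < L := by omega
    refine ⟨hn, ?_, (hq' n hn).2 h2⟩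
    by_contra h; push Not at h
    have := (hp' n hn).1 h; omega

lemma sd_aux (f : ℕ → ℝ) (L : ℕ) (lam C : ℝ) (hl : 0 < lam) (hC : 1 ≤ C)
    (_hl1 : lam ≤ 1)
    (h : ∀ n, n + 1 < L → lam ≤ dif (dif f) n ∧ dif (dif f) n ≤ C * lam) :
    ‖∑ n ∈ range L, e (f n)‖ ≤ (C * lam * L + 2) * (3 / Real.sqrt lam + 1) := by
  set g := dif f with hgdef
  set Δ := Real.sqrt lam with hΔdef
  have hΔ : 0 < Δ := Real.sqrt_pos.2 hl
  have hΔ2 : Δ * Δ = lam := Real.mul_self_sqrt hl.le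
  have hinc : ∀ m i, i + m < L → g i + m * lam ≤ g (i + m) ∧ g (i + m) ≤ g i + m * (C * lam) := by
    intro m
    induction m with
    | zero => intro i _; simp
    | succ m ih =>
      intro i hi
      have h1 := ih i (by omega)
      have h2 := h (i + m) (by omega)
      simp only [dif] at h2
      rw [← add_assoc]
      push_cast
      constructor <;> linarith [h2.1, h2.2, h1.1, h1.2]
  have hmono : ∀ i j, i ≤ j → j < L → g i ≤ g j := by
    intro i j hij hj
    obtain ⟨m, rfl⟩ := Nat.exists_eq_add_of_le hij
    have := (hinc m i hj).1
    nlinarith [(Nat.cast_nonneg m : (0:ℝ) ≤ m)]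
  rcases Nat.eq_zero_or_pos L with rfl | hL
  · simp; positivity
  have hmem : ∀ n ∈ range L, ⌊g n + Δ⌋ ∈ Icc ⌊g 0 + Δ⌋ ⌊g (L - 1) + Δ⌋ := by
    intro n hn
    have hn' := mem_range.1 hn
    rw [mem_Icc]
    exact ⟨Int.floor_le_floor (by linarith [hmono 0 n (by omega) hn']),
      Int.floor_le_floor (by linarith [hmono n (L-1) (by omega) (by omega)])⟩
  rw [← sum_fiberwise_of_maps_to hmem]
  have hper : ∀ j : ℤ, ‖∑ n ∈ range L with ⌊g n + Δ⌋ = j, e (f n)‖ ≤ 3 / Δ + 1 := by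
    intro j
    rw [← sum_filter_add_sum_filter_not _ (fun n => g n < j + Δ)]
    rw [filter_filter, filter_filter]
    obtain ⟨p, q, hq, hpq⟩ := filter_interval g L hmono (j - Δ) (min (j + Δ) (j + 1 - Δ))
    obtain ⟨p', q', hq', hpq'⟩ := filter_interval g L hmono (max (j - Δ) (j + Δ)) (j + 1 - Δ)
    have e1 : (range L).filter (fun n => ⌊g n + Δ⌋ = j ∧ g n < j + Δ) = Ico p q := by
      rw [← hpq]
      apply filter_congr; intro n _
      rw [Int.floor_eq_iff, lt_min_iff]
      constructor
      · rintro ⟨⟨h1, h2⟩, h3⟩; exact ⟨by linarith, h3, by linarith⟩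
      · rintro ⟨h1, h2, h3⟩; exact ⟨⟨by linarith, by linarith⟩, h2⟩
    have e2 : (range L).filter (fun n => ⌊g n + Δ⌋ = j ∧ ¬ g n < j + Δ) = Ico p' q' := by
      rw [← hpq']
      apply filter_congr; intro n _
      rw [Int.floor_eq_iff, max_le_iff, not_lt]
      constructor
      · rintro ⟨⟨h1, h2⟩, h3⟩; exact ⟨⟨by linarith, h3⟩, by linarith⟩
      · rintro ⟨⟨h1, h2⟩, h3⟩; exact ⟨⟨by linarith, by linarith⟩, h2⟩
    rw [e1, e2]
    have b2 : ‖∑ n ∈ Ico p' q', e (f n)‖ ≤ 1 / Δ := by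
      refine kl f p' q' j Δ hΔ ?_ ?_
      · intro n h1 h2
        exact hmono n (n+1) (by omega) (by omega)
      · intro n h1 h2
        have : n ∈ Ico p' q' := mem_Ico.2 ⟨h1, h2⟩
        rw [← hpq', mem_filter] at this
        have h3 := this.2
        rw [max_le_iff] at h3
        exact ⟨h3.1.2, h3.2.le⟩
    have b1 : ‖∑ n ∈ Ico p q, e (f n)‖ ≤ 2 / Δ + 1 := by
      have : ‖∑ n ∈ Ico p q, e (f n)‖ ≤ ((q - p : ℕ) : ℝ) := by
        refine (norm_sum_le _ _).trans ?_
        simp [norm_e]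
      refine this.trans ?_
      rcases Nat.lt_or_ge p q with hlt | hge
      · obtain ⟨m, rfl⟩ := Nat.exists_eq_add_of_le (Nat.succ_le_of_lt hlt)
        have m1 : p ∈ Ico p (p.succ + m) := mem_Ico.2 ⟨le_rfl, by omega⟩
        have m2 : p + m ∈ Ico p (p.succ + m) := mem_Ico.2 ⟨by omega, by omega⟩
        rw [← hpq, mem_filter] at m1 m2
        have h5 := (lt_min_iff.1 m2.2.2).1
        have h6 := (hinc m p (by omega)).1
        have h7 : (m : ℝ) * (Δ * Δ) ≤ 2 * Δ := by rw [hΔ2]; linarith [m1.2.1]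
        have h8 : (m : ℝ) ≤ 2 / Δ := by
          rw [le_div_iff₀ hΔ]; nlinarith
        rw [show p.succ + m - p = m + 1 by omega]; push_cast; linarith
      · rw [Nat.sub_eq_zero_of_le hge]; simp; positivity
    refine (norm_add_le _ _).trans ?_
    have : 3 / Δ = 2 / Δ + 1 / Δ := by ring
    linarith
  refine (norm_sum_le_of_le _ (fun j _ => hper j)).trans ?_
  rw [sum_const, nsmul_eq_mul]
  refine mul_le_mul_of_nonneg_right ?_ (by positivity)
  rw [Int.card_Icc]
  have h1 := (hinc (L - 1) 0 (by omega)).2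
  rw [zero_add] at h1
  have h2 : ⌊g 0 + Δ⌋ ≤ ⌊g (L - 1) + Δ⌋ := Int.floor_le_floor (by linarith [hmono 0 (L-1) (by omega) (by omega)])
  have h3 : (((⌊g (L - 1) + Δ⌋ + 1 - ⌊g 0 + Δ⌋).toNat : ℕ) : ℝ) =
      ((⌊g (L - 1) + Δ⌋ + 1 - ⌊g 0 + Δ⌋ : ℤ) : ℝ) := by
    have : ((⌊g (L - 1) + Δ⌋ + 1 - ⌊g 0 + Δ⌋).toNat : ℤ) = (⌊g (L - 1) + Δ⌋ + 1 - ⌊g 0 + Δ⌋ : ℤ) :=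
      Int.toNat_of_nonneg (by omega)
    exact_mod_cast this
  rw [h3]; push_cast
  have h4 := Int.floor_le (g (L - 1) + Δ)
  have h5 := Int.lt_floor_add_one (g 0 + Δ)
  have h6 : ((L - 1 : ℕ) : ℝ) ≤ L := by exact_mod_cast Nat.sub_le _ _
  have h7 : 0 < C * lam := by positivity
  nlinarith

/-- the k-th derivative test property -/
def DT (k : ℕ) (α b : ℝ) : Prop :=
  ∀ C : ℝ, 1 ≤ C → ∃ K : ℝ, 0 < K ∧ ∀ (f : ℕ → ℝ) (L : ℕ) (lam : ℝ), 0 < lam →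
    (∀ n, n + k < L → lam ≤ dif^[k] f n ∧ dif^[k] f n ≤ C * lam) →
    ‖∑ n ∈ range L, e (f n)‖ ≤ K * (L * lam ^ α + (L : ℝ) ^ (1 - b) * lam ^ (-α))

lemma norm_sum_e_le (f : ℕ → ℝ) (s : Finset ℕ) : ‖∑ n ∈ s, e (f n)‖ ≤ #s := by
  refine (norm_sum_le _ _).trans ?_
  simp [norm_e]

lemma DT2 : DT 2 (1/2) 1 := by
  intro C hC
  refine ⟨10 * C, by linarith, ?_⟩
  intro f L lam hl h
  have hs : lam ^ (1/2 : ℝ) = Real.sqrt lam := by rw [Real.sqrt_eq_rpow]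
  have hs' : lam ^ (-(1/2) : ℝ) = 1 / Real.sqrt lam := by
    rw [Real.rpow_neg hl.le, hs, one_div]
  rw [hs, hs', sub_self, Real.rpow_zero, one_mul]
  have hsp : 0 < Real.sqrt lam := Real.sqrt_pos.2 hl
  have hsq : Real.sqrt lam * Real.sqrt lam = lam := Real.mul_self_sqrt hl.le
  have hL0 : (0:ℝ) ≤ L := Nat.cast_nonneg L
  set s := Real.sqrt lam
  have hi : 0 < 1 / s := by positivity
  have hsi : s * (1 / s) = 1 := by field_simp
  rcases lt_or_ge 1 lam with h1 | h1
  · have h2 : 1 ≤ s := by nlinarith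
    have := norm_sum_e_le f (range L)
    rw [card_range] at this
    have h3 : (L:ℝ) ≤ L * s := le_mul_of_one_le_right hL0 h2
    nlinarith [mul_nonneg hL0 hsp.le]
  · have hs1 : s ≤ 1 := by nlinarith
    have h1i : 1 ≤ 1 / s := by rw [le_div_iff₀ hsp]; linarith
    rcases L with _ | m
    · simp; positivity
    · rw [sum_range_succ]
      refine (norm_add_le _ _).trans ?_
      rw [norm_e]
      have := sd_aux f m lam C hl hC h1 (fun n hn => by
        have := h n (by omega); simpa [Function.iterate_succ] using this)
      have h3 : 3 / s = 3 * (1 / s) := by ring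
      rw [h3] at this
      push_cast
      have hm0 : (0:ℝ) ≤ m := Nat.cast_nonneg m
      have h4 : (C * lam * m + 2) * (3 * (1 / s) + 1) ≤ (C * lam * m + 2) * (4 * (1/s)) := by
        apply mul_le_mul_of_nonneg_left (by linarith) (by positivity)
      have h5 : (C * lam * m + 2) * (4 * (1/s)) = 4 * C * m * s + 8 * (1/s) := by
        rw [← hsq]; field_simp; ring
      have h6 : 1 * (1/s) ≤ C * (1 / s) := mul_le_mul_of_nonneg_right hC hi.le
      have h7 : 0 ≤ C * (m * s) := by positivity
      have h8 : 0 ≤ C * s := by positivity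
      nlinarith
end BVP

namespace BVP
open Finset

lemma shift_sum (F : ℕ → ℂ) (Q K R q : ℕ) (hF : ∀ y, ¬ (Q ≤ y ∧ y < Q + K) → F y = 0)
    (hq : q ≤ Q) (hR : Q + K ≤ R + q) :
    ∑ m ∈ range R, F (m + q) = ∑ n ∈ range K, F (n + Q) := by
  have h1 : ∑ m ∈ range R, F (m + q) = ∑ y ∈ Ico q (R + q), F y := by
    rw [sum_Ico_eq_sum_range]; simp [add_comm]
  have h2 : ∑ m ∈ range K, F (m + Q) = ∑ y ∈ Ico Q (Q + K), F y := by
    rw [sum_Ico_eq_sum_range]; simp [add_comm]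
  rw [h1, h2]
  symm
  apply sum_subset
  · intro y hy; rw [mem_Ico] at hy ⊢; omega
  · intro y _ hy; rw [mem_Ico] at hy; exact hF y hy

lemma vdc (z : ℕ → ℂ) (hz : ∀ n, ‖z n‖ ≤ 1) (L Q : ℕ) (hQ : 1 ≤ Q) (hQL : Q ≤ L) :
    ‖∑ n ∈ range L, z n‖ ^ 2 ≤ (2 * L / Q) * (L + 2 * ∑ j ∈ range (Q - 1),
      ‖∑ n ∈ range (L - (j + 1)), z (n + (j + 1)) * (starRingEnd ℂ) (z n)‖) := by
  set S := ∑ n ∈ range L, z n with hS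
  set c : ℕ → ℝ := fun r => ‖∑ n ∈ range (L - r), z (n + r) * (starRingEnd ℂ) (z n)‖ with hc
  set w : ℕ → ℂ := fun m => if Q ≤ m ∧ m < Q + L then z (m - Q) else 0 with hw
  have hw1 : ∀ n, n < L → w (n + Q) = z n := by
    intro n hn; simp only [hw]; rw [if_pos (by omega)]; simp
  have hw0 : ∀ y, ¬ (Q ≤ y ∧ y < Q + L) → w y = 0 := by
    intro y hy; simp only [hw]; rw [if_neg hy]
  have hs1 : ∀ q < Q, ∑ m ∈ range (L + Q), w (m + q) = S := by
    intro q hq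
    rw [shift_sum w Q L (L + Q) q hw0 (by omega) (by omega), hS]
    exact sum_congr rfl fun n hn => hw1 n (mem_range.1 hn)
  have hcor : ∀ q r, q < Q → ‖∑ m ∈ range (L + Q), w (m + q + r) * (starRingEnd ℂ) (w (m + q))‖ = c r := by
    intro q r hq
    simp only [hc]
    rcases le_or_gt r L with hr | hr
    · rw [shift_sum (fun y => w (y + r) * (starRingEnd ℂ) (w y)) Q (L - r) (L + Q) q ?_ (by omega) (by omega)]
      · congr 1
        refine sum_congr rfl fun n hn => ?_
        have hn' := mem_range.1 hn
        rw [show n + Q + r = (n + r) + Q by ring, hw1 _ (by omega), hw1 _ (by omega)]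
      · intro y hy
        by_cases h : Q ≤ y ∧ y < Q + L
        · rw [hw0 (y + r) (by omega)]; simp
        · rw [hw0 y h]; simp
    · rw [Nat.sub_eq_zero_of_le hr.le]
      simp only [range_zero, sum_empty, norm_zero]
      rw [norm_eq_zero]
      refine sum_eq_zero fun m _ => ?_
      by_cases h : Q ≤ m + q ∧ m + q < Q + L
      · rw [hw0 (m + q + r) (by omega)]; simp
      · rw [hw0 _ h]; simp
  have hcor' : ∀ q1 q2, q1 < Q → q2 < Q →
      ‖∑ m ∈ range (L + Q), w (m + q1) * (starRingEnd ℂ) (w (m + q2))‖ =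
        if q2 ≤ q1 then c (q1 - q2) else c (q2 - q1) := by
    intro q1 q2 h1 h2
    split_ifs with h
    · rw [← hcor q2 (q1 - q2) h2]
      congr 1
      refine sum_congr rfl fun m _ => ?_
      rw [show m + q2 + (q1 - q2) = m + q1 by omega]
    · rw [← hcor q1 (q2 - q1) h1, ← Complex.norm_conj, map_sum]
      congr 1
      refine sum_congr rfl fun m _ => ?_
      rw [show m + q1 + (q2 - q1) = m + q2 by omega, map_mul, Complex.conj_conj, mul_comm]
  have hQS : (Q : ℂ) * S = ∑ m ∈ range (L + Q), ∑ q ∈ range Q, w (m + q) := by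
    rw [sum_comm, sum_congr rfl fun q hq => hs1 q (mem_range.1 hq)]
    simp
  have hcs : ‖(Q : ℂ) * S‖ ^ 2 ≤ ((L + Q : ℕ) : ℝ) * ∑ m ∈ range (L + Q), ‖∑ q ∈ range Q, w (m + q)‖ ^ 2 := by
    rw [hQS]
    refine (pow_le_pow_left₀ (norm_nonneg _) (norm_sum_le _ _) 2).trans ?_
    have := sq_sum_le_card_mul_sum_sq (s := range (L + Q)) (f := fun m => ‖∑ q ∈ range Q, w (m + q)‖)
    simpa using this
  have hexp : ∑ m ∈ range (L + Q), ‖∑ q ∈ range Q, w (m + q)‖ ^ 2 ≤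
      ∑ q1 ∈ range Q, ∑ q2 ∈ range Q, (if q2 ≤ q1 then c (q1 - q2) else c (q2 - q1)) := by
    have h1 : ((∑ m ∈ range (L + Q), ‖∑ q ∈ range Q, w (m + q)‖ ^ 2 : ℝ) : ℂ) =
        ∑ q1 ∈ range Q, ∑ q2 ∈ range Q, ∑ m ∈ range (L + Q), w (m + q1) * (starRingEnd ℂ) (w (m + q2)) := by
      push_cast
      rw [sum_congr rfl fun m _ => (Complex.mul_conj' (∑ q ∈ range Q, w (m + q))).symm]
      simp_rw [map_sum, sum_mul_sum]
      rw [sum_comm]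
      exact sum_congr rfl fun q1 _ => sum_comm
    have h2 : (∑ m ∈ range (L + Q), ‖∑ q ∈ range Q, w (m + q)‖ ^ 2 : ℝ) =
        ‖((∑ m ∈ range (L + Q), ‖∑ q ∈ range Q, w (m + q)‖ ^ 2 : ℝ) : ℂ)‖ := by
      rw [Complex.norm_real, Real.norm_eq_abs, abs_of_nonneg (by positivity)]
    rw [h2, h1]
    refine norm_sum_le_of_le _ fun q1 h1 => norm_sum_le_of_le _ fun q2 h2 => ?_
    exact (hcor' q1 q2 (mem_range.1 h1) (mem_range.1 h2)).le
  have hc0 : ∀ r, 0 ≤ c r := fun r => norm_nonneg _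
  have hc00 : c 0 ≤ L := by
    simp only [hc]
    refine (norm_sum_le _ _).trans ?_
    have : ∀ n ∈ range (L - 0), ‖z (n + 0) * (starRingEnd ℂ) (z n)‖ ≤ 1 := by
      intro n _
      rw [norm_mul, Complex.norm_conj]
      exact mul_le_one₀ (hz _) (norm_nonneg _) (hz _)
    refine (sum_le_sum this).trans ?_
    simp
  have hrow : ∀ q1 ∈ range Q, ∑ q2 ∈ range Q, (if q2 ≤ q1 then c (q1 - q2) else c (q2 - q1)) ≤
      L + 2 * ∑ j ∈ range (Q - 1), c (j + 1) := by
    intro q1 hq1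
    have hq1' := mem_range.1 hq1
    rw [range_eq_Ico, ← sum_Ico_consecutive _ (Nat.zero_le (q1 + 1)) (by omega : q1 + 1 ≤ Q),
      sum_Ico_succ_top (Nat.zero_le _)]
    have a1 : ∑ q2 ∈ Ico 0 q1, (if q2 ≤ q1 then c (q1 - q2) else c (q2 - q1)) ≤
        ∑ j ∈ range (Q - 1), c (j + 1) := by
      have : ∑ q2 ∈ Ico 0 q1, (if q2 ≤ q1 then c (q1 - q2) else c (q2 - q1)) =
          ∑ j ∈ range q1, c (j + 1) := by
        rw [← sum_range_reflect, ← range_eq_Ico]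
        refine sum_congr rfl fun j hj => ?_
        have := mem_range.1 hj
        rw [if_pos (by omega), show q1 - 1 - j + 1 = q1 - j by omega]
      rw [this]
      refine sum_le_sum_of_subset_of_nonneg (range_subset_range.2 (by omega)) fun _ _ _ => hc0 _
    have a2 : ∑ q2 ∈ Ico (q1 + 1) Q, (if q2 ≤ q1 then c (q1 - q2) else c (q2 - q1)) ≤
        ∑ j ∈ range (Q - 1), c (j + 1) := by
      rw [sum_Ico_eq_sum_range]
      have : ∀ j ∈ range (Q - (q1 + 1)), (if q1 + 1 + j ≤ q1 then c (q1 - (q1 + 1 + j))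
          else c (q1 + 1 + j - q1)) = c (j + 1) := by
        intro j _
        rw [if_neg (by omega), show q1 + 1 + j - q1 = j + 1 by omega]
      rw [sum_congr rfl this]
      refine sum_le_sum_of_subset_of_nonneg (range_subset_range.2 (by omega)) fun _ _ _ => hc0 _
    have a3 : (if q1 ≤ q1 then c (q1 - q1) else c (q1 - q1)) ≤ L := by simpa using hc00
    rw [← range_eq_Ico] at *
    linarith
  have htot := hexp.trans (sum_le_sum hrow)
  rw [sum_const, card_range, nsmul_eq_mul] at htot
  set B := (L : ℝ) + 2 * ∑ j ∈ range (Q - 1), c (j + 1) with hB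
  have hB0 : 0 ≤ B := by
    have : 0 ≤ ∑ j ∈ range (Q - 1), c (j + 1) := sum_nonneg fun _ _ => hc0 _
    positivity
  rw [norm_mul, Complex.norm_natCast, mul_pow] at hcs
  have hQp : (0:ℝ) < Q := by exact_mod_cast hQ
  have hQL' : (Q:ℝ) ≤ L := by exact_mod_cast hQL
  have h9 : (Q:ℝ)^2 * ‖S‖^2 ≤ (2 * L) * (Q * B) := by
    refine hcs.trans ?_
    refine mul_le_mul ?_ htot (by positivity) (by positivity)
    push_cast; linarith
  rw [div_mul_eq_mul_div, le_div_iff₀ hQp]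
  nlinarith

lemma dif_iter_sub (f : ℕ → ℝ) (r k : ℕ) (n : ℕ) :
    dif^[k] (fun n => f (n + r) - f n) n = dif^[k] f (n + r) - dif^[k] f n := by
  induction k generalizing n with
  | zero => rfl
  | succ k ih =>
    rw [Function.iterate_succ_apply', Function.iterate_succ_apply']
    simp only [dif]
    rw [ih, ih, show n + 1 + r = n + r + 1 by ring]; ring

lemma tele (g : ℕ → ℝ) (n r : ℕ) : g (n + r) - g n = ∑ j ∈ range r, dif g (n + j) := by
  induction r with
  | zero => simp
  | succ r ih => rw [sum_range_succ, ← ih]; simp only [dif]; rw [← add_assoc]; ring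

lemma sum_rpow_neg (α : ℝ) (h0 : 0 < α) (h1 : α ≤ 1/2) (m : ℕ) :
    ∑ j ∈ range m, ((j + 1 : ℕ) : ℝ) ^ (-α) ≤ 2 * (m : ℝ) ^ (1 - α) := by
  induction m with
  | zero => simp; positivity
  | succ m ih =>
    rw [sum_range_succ]
    have hm : (0:ℝ) < ((m + 1 : ℕ) : ℝ) := by positivity
    have hb := rpow_one_add_le_one_add_mul_self (s := -(1 / ((m + 1 : ℕ) : ℝ))) (p := 1 - α)
      (by
        have : 1 / ((m + 1 : ℕ) : ℝ) ≤ 1 := by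
          rw [div_le_one hm]; push_cast; linarith [(Nat.cast_nonneg m : (0:ℝ) ≤ m)]
        linarith) (by linarith) (by linarith)
    have e1 : (1 + -(1 / ((m + 1 : ℕ) : ℝ))) = m / ((m + 1 : ℕ) : ℝ) := by
      field_simp; push_cast; ring
    rw [e1, Real.div_rpow (by positivity) hm.le, div_le_iff₀ (by positivity)] at hb
    have e2 : ((m + 1 : ℕ) : ℝ) ^ (-α) = ((m + 1 : ℕ) : ℝ) ^ (1 - α) / ((m + 1 : ℕ) : ℝ) := by
      rw [show -α = (1 - α) - 1 by ring, Real.rpow_sub_one hm.ne']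
    rw [e2]
    set A := ((m + 1 : ℕ) : ℝ) ^ (1 - α) with hA
    have hA0 : 0 ≤ A / ((m + 1 : ℕ) : ℝ) := by positivity
    have : (1 + (1 - α) * -(1 / ((m + 1 : ℕ) : ℝ))) * A = A - (1 - α) * (A / ((m + 1 : ℕ) : ℝ)) := by
      field_simp; ring
    rw [this] at hb
    nlinarith

set_option maxHeartbeats 1000000 in
lemma DT_step (k : ℕ) (α b : ℝ) (hα0 : 0 < α) (hα : α ≤ 1/2) (hb0 : 0 ≤ b) (hb : b ≤ 1)
    (h : DT k α b) : DT (k + 1) (α / (2 * (1 + α))) (b / 2) := by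
  intro C hC
  obtain ⟨K, hK, hKf⟩ := h C hC
  refine ⟨2 + 8 * K, by linarith, ?_⟩
  intro f L lam hl hf
  set β := α / (2 * (1 + α)) with hβ
  have hβ0 : 0 < β := by positivity
  have hβeq : 2 * β * (1 + α) = α := by rw [hβ]; field_simp
  rcases Nat.eq_zero_or_pos L with rfl | hL
  · simp; positivity
  have hL1 : (1:ℝ) ≤ L := by exact_mod_cast hL
  have hL0 : (0:ℝ) < L := by linarith
  have hP : 0 < lam ^ β := by positivity
  have hN : 0 < lam ^ (-β) := by positivity
  have hLb : 0 < (L:ℝ) ^ (1 - b/2) := by positivity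
  have triv := norm_sum_e_le f (range L)
  rw [card_range] at triv
  rcases le_or_gt 1 lam with h1 | h1
  · have : 1 ≤ lam ^ β := Real.one_le_rpow h1 hβ0.le
    have h3 : (L:ℝ) ≤ L * lam ^ β := le_mul_of_one_le_right hL0.le this
    nlinarith [mul_pos hLb hN, mul_pos hL0 hP, mul_pos hK (mul_pos hLb hN), mul_pos hK (mul_pos hL0 hP)]
  set x := lam ^ (-(2 * β)) with hx
  have hx1 : 1 ≤ x := by
    rw [hx, Real.rpow_neg hl.le]
    exact (one_le_inv₀ (by positivity)).2 (Real.rpow_le_one hl.le h1.le (by positivity))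
  have hxsq : x = (lam ^ (-β)) ^ 2 := by
    rw [hx, ← Real.rpow_natCast, ← Real.rpow_mul hl.le]; congr 1; push_cast; ring
  set Q := ⌈x⌉₊ with hQ
  have hQ1 : 1 ≤ Q := Nat.one_le_iff_ne_zero.2 (by
    have : 0 < Q := Nat.ceil_pos.2 (by linarith)
    omega)
  have hxQ : x ≤ Q := Nat.le_ceil x
  have hQx : (Q:ℝ) ≤ 2 * x := by
    have := Nat.ceil_lt_add_one (by linarith : 0 ≤ x)
    linarith
  rcases lt_or_ge L Q with hQL | hQL
  · have h2 : (L:ℝ) < x := Nat.lt_ceil.1 hQL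
    have h3 : (L:ℝ) ^ (1/2 : ℝ) ≤ lam ^ (-β) := by
      rw [← Real.sqrt_eq_rpow]
      apply Real.sqrt_le_iff.2 ⟨hN.le, by rw [← hxsq]; exact h2.le⟩
    have h4 : (L:ℝ) ≤ (L:ℝ) ^ (1 - b/2) * lam ^ (-β) := by
      calc (L:ℝ) = (L:ℝ) ^ (1:ℝ) := (Real.rpow_one _).symm
        _ ≤ (L:ℝ) ^ ((1 - b/2) + 1/2) := Real.rpow_le_rpow_of_exponent_le hL1 (by linarith)
        _ = (L:ℝ) ^ (1 - b/2) * (L:ℝ) ^ (1/2:ℝ) := Real.rpow_add hL0 _ _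
        _ ≤ _ := mul_le_mul_of_nonneg_left h3 hLb.le
    nlinarith [mul_pos hLb hN, mul_pos hL0 hP, mul_pos hK (mul_pos hLb hN), mul_pos hK (mul_pos hL0 hP)]
  -- main case
  have hv := vdc (fun n => e (f n)) (fun n => (norm_e _).le) L Q hQ1 hQL
  have hQ0 : (0:ℝ) < Q := by exact_mod_cast hQ1
  have hcorr : ∀ j ∈ range (Q - 1),
      ‖∑ n ∈ range (L - (j + 1)), e (f (n + (j + 1))) * (starRingEnd ℂ) (e (f n))‖ ≤
      K * (L * (Q * lam) ^ α + (L:ℝ) ^ (1 - b) * (lam ^ (-α) * ((j + 1 : ℕ) : ℝ) ^ (-α))) := by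
    intro j hj
    have hj' := mem_range.1 hj
    have hr0 : (0:ℝ) < ((j + 1 : ℕ) : ℝ) := by positivity
    have hrl : 0 < ((j + 1 : ℕ) : ℝ) * lam := by positivity
    have := hKf (fun n => f (n + (j + 1)) - f n) (L - (j + 1)) (((j + 1 : ℕ) : ℝ) * lam) hrl (by
      intro n hn
      rw [dif_iter_sub, tele]
      have hb : ∀ i ∈ range (j + 1), lam ≤ dif (dif^[k] f) (n + i) ∧ dif (dif^[k] f) (n + i) ≤ C * lam := by
        intro i hi
        have hi' := mem_range.1 hi
        have := hf (n + i) (by omega)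
        rwa [Function.iterate_succ_apply'] at this
      constructor
      · calc ((j + 1 : ℕ) : ℝ) * lam = ∑ i ∈ range (j + 1), lam := by simp
          _ ≤ _ := sum_le_sum fun i hi => (hb i hi).1
      · calc _ ≤ ∑ i ∈ range (j + 1), C * lam := sum_le_sum fun i hi => (hb i hi).2
          _ = _ := by simp; ring)
    have e0 : ∀ n, e (f (n + (j + 1))) * (starRingEnd ℂ) (e (f n)) = e (f (n + (j + 1)) - f n) :=
      fun n => (e_sub _ _).symm
    simp_rw [e0]
    refine this.trans ?_
    refine mul_le_mul_of_nonneg_left ?_ hK.le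
    have hLr : ((L - (j + 1) : ℕ) : ℝ) ≤ L := by exact_mod_cast Nat.sub_le _ _
    have hrQ : ((j + 1 : ℕ) : ℝ) ≤ Q := by exact_mod_cast (by omega : j + 1 ≤ Q)
    refine add_le_add ?_ ?_
    · refine mul_le_mul hLr ?_ (by positivity) hL0.le
      exact Real.rpow_le_rpow hrl.le (mul_le_mul_of_nonneg_right hrQ hl.le) hα0.le
    · rw [Real.mul_rpow hr0.le hl.le, mul_comm (lam ^ (-α))]
      refine mul_le_mul_of_nonneg_right ?_ (by positivity)
      exact Real.rpow_le_rpow (by positivity) hLr (by linarith)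
  have hsum := sum_le_sum hcorr
  rw [← mul_sum, sum_add_distrib, sum_const, card_range, ← mul_sum, ← mul_sum, nsmul_eq_mul] at hsum
  have hsr := sum_rpow_neg α hα0 hα (Q - 1)
  have hQm : ((Q - 1 : ℕ) : ℝ) ≤ Q := by exact_mod_cast Nat.sub_le _ _
  have hsr2 : ∑ j ∈ range (Q - 1), ((j + 1 : ℕ) : ℝ) ^ (-α) ≤ 2 * (Q:ℝ) ^ (1 - α) :=
    hsr.trans (mul_le_mul_of_nonneg_left (Real.rpow_le_rpow (by positivity) hQm (by linarith)) (by norm_num))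
  have hA1 : (Q * lam) ^ α ≤ 2 * (lam ^ β) ^ 2 := by
    calc (Q * lam) ^ α ≤ (2 * (x * lam)) ^ α :=
          Real.rpow_le_rpow (by positivity) (by nlinarith) hα0.le
      _ = 2 ^ α * (x * lam) ^ α := Real.mul_rpow (by norm_num) (by positivity)
      _ ≤ 2 * (x * lam) ^ α := by
          refine mul_le_mul_of_nonneg_right ?_ (by positivity)
          calc (2:ℝ) ^ α ≤ 2 ^ (1:ℝ) := Real.rpow_le_rpow_of_exponent_le (by norm_num) (by linarith)
            _ = 2 := Real.rpow_one 2
      _ = 2 * (lam ^ β) ^ 2 := by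
          congr 1
          rw [hx, ← Real.rpow_add_one hl.ne', ← Real.rpow_mul hl.le, ← Real.rpow_natCast,
            ← Real.rpow_mul hl.le]
          congr 1; push_cast; linarith
  have hA2 : lam ^ (-α) * (Q:ℝ) ^ (1 - α) ≤ Q * (lam ^ (-β)) ^ 2 := by
    have e1 : (Q:ℝ) ^ (1 - α) = Q * (Q:ℝ) ^ (-α) := by
      rw [show (1 - α) = 1 + (-α) by ring, Real.rpow_add hQ0, Real.rpow_one]
    have e2 : (Q:ℝ) ^ (-α) ≤ x ^ (-α) := Real.rpow_le_rpow_of_nonpos (by linarith) hxQ (by linarith)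
    calc lam ^ (-α) * (Q:ℝ) ^ (1 - α) = Q * (lam ^ (-α) * (Q:ℝ) ^ (-α)) := by rw [e1]; ring
      _ ≤ Q * (lam ^ (-α) * x ^ (-α)) := by gcongr
      _ = _ := by
          congr 1
          rw [hx, ← Real.rpow_mul hl.le, ← Real.rpow_add hl, ← Real.rpow_natCast,
            ← Real.rpow_mul hl.le]
          congr 1; push_cast; linarith
  have hLb2 : (L:ℝ) * (L:ℝ) ^ (1 - b) = ((L:ℝ) ^ (1 - b/2)) ^ 2 := by
    rw [← Real.rpow_one_add' hL0.le (by linarith), ← Real.rpow_natCast, ← Real.rpow_mul hL0.le]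
    congr 1; push_cast; ring
  have hLb0 : 0 ≤ (L:ℝ) ^ (1 - b) := by positivity
  set T := ∑ j ∈ range (Q - 1), ‖∑ n ∈ range (L - (j + 1)), e (f (n + (j + 1))) * (starRingEnd ℂ) (e (f n))‖
  have hT : T ≤ K * Q * (2 * L * (lam ^ β) ^ 2 + 2 * (L:ℝ) ^ (1 - b) * (lam ^ (-β)) ^ 2) := by
    refine hsum.trans ?_
    rw [mul_assoc]
    refine mul_le_mul_of_nonneg_left ?_ hK.le
    have t1 : ((Q - 1 : ℕ) : ℝ) * (L * (Q * lam) ^ α) ≤ Q * (L * (2 * (lam ^ β) ^ 2)) := by gcongr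
    have t2 : (L:ℝ) ^ (1 - b) * (lam ^ (-α) * ∑ j ∈ range (Q - 1), ((j + 1 : ℕ) : ℝ) ^ (-α)) ≤
        (L:ℝ) ^ (1 - b) * (2 * (Q * (lam ^ (-β)) ^ 2)) := by
      refine mul_le_mul_of_nonneg_left ?_ hLb0
      calc _ ≤ lam ^ (-α) * (2 * (Q:ℝ) ^ (1 - α)) := by gcongr
        _ = 2 * (lam ^ (-α) * (Q:ℝ) ^ (1 - α)) := by ring
        _ ≤ _ := by linarith
    nlinarith
  set P := lam ^ β
  set N := lam ^ (-β)
  set G := (L:ℝ) ^ (1 - b/2)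
  have hQinv : (1:ℝ) / Q ≤ P ^ 2 := by
    have : 1 / x = P ^ 2 := by
      rw [hxsq]
      have hPN : P * N = 1 := by
        simp only [P, N]; rw [← Real.rpow_add hl]; simp
      rw [div_eq_iff (by positivity), ← mul_pow, hPN, one_pow]
    rw [← this]
    exact one_div_le_one_div_of_le (by linarith) hxQ
  have hfin : ‖∑ n ∈ range L, e (f n)‖ ^ 2 ≤ (2 + 8 * K) * ((L * P) ^ 2 + (G * N) ^ 2) := by
    refine hv.trans ?_
    calc (2 * L / Q) * (L + 2 * T) ≤ (2 * L / Q) * (L + 2 * (K * Q * (2 * L * P ^ 2 + 2 * (L:ℝ) ^ (1 - b) * N ^ 2))) := by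
          gcongr
      _ = 2 * L^2 * (1 / Q) + 8 * K * (L^2 * P^2 + (L * (L:ℝ) ^ (1 - b)) * N^2) := by
          field_simp
          ring
      _ ≤ 2 * L^2 * P^2 + 8 * K * (L^2 * P^2 + G^2 * N^2) := by
          rw [hLb2]; gcongr
      _ ≤ _ := by nlinarith [sq_nonneg (G * N)]
  have hK2 : (1:ℝ) ≤ 2 + 8 * K := by linarith
  have hLP : 0 ≤ (L:ℝ) * P := by positivity
  have hGN : 0 ≤ G * N := by positivity
  refine (pow_le_pow_iff_left₀ (norm_nonneg _) (by positivity) two_ne_zero).1 ?_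
  refine hfin.trans ?_
  rw [mul_pow (2 + 8 * K)]
  have : (L * P) ^ 2 + (G * N) ^ 2 ≤ (L * P + G * N) ^ 2 := by nlinarith
  exact mul_le_mul (by nlinarith) this (by positivity) (by positivity)

lemma DT3 : DT 3 (1/6) (1/2) := by
  have := DT_step 2 (1/2) 1 (by norm_num) (by norm_num) (by norm_num) (by norm_num) DT2
  norm_num at this ⊢; exact this

lemma DT4 : DT 4 (1/14) (1/4) := by
  have := DT_step 3 (1/6) (1/2) (by norm_num) (by norm_num) (by norm_num) (by norm_num) DT3
  norm_num at this ⊢; exact this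

end BVP

namespace BVP
open Finset

lemma dif_fam (k : ℕ) : ∀ (F : ℕ → ℝ → ℝ) (lo hi lam Lam : ℝ)
    (_ : ∀ i < k, ∀ x, lo ≤ x → x ≤ hi → HasDerivAt (F i) (F (i + 1) x) x)
    (_ : ∀ x, lo ≤ x → x ≤ hi → lam ≤ F k x ∧ F k x ≤ Lam) (n : ℕ) (_ : lo ≤ n) (_ : (n:ℝ) + k ≤ hi),
    lam ≤ dif^[k] (fun n : ℕ => F 0 n) n ∧ dif^[k] (fun n : ℕ => F 0 n) n ≤ Lam := by
  induction k with
  | zero =>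
    intro F lo hi lam Lam _ hb n h1 h2
    simpa using hb n h1 (by simpa using h2)
  | succ k ih =>
    intro F lo hi lam Lam hd hb n h1 h2
    push_cast at h2
    rw [Function.iterate_succ_apply]
    have e1 : dif (fun n : ℕ => F 0 n) = fun n : ℕ => (fun i x => F i (x + 1) - F i x) 0 (n:ℝ) := by
      funext m; simp [dif]
    rw [e1]
    refine ih (fun i x => F i (x + 1) - F i x) lo (hi - 1) lam Lam ?_ ?_ n h1 (by linarith)
    · intro i hi' x hx1 hx2
      have a1 := hd i (by omega) (x + 1) (by linarith) (by linarith)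
      have a2 := hd i (by omega) x hx1 (by linarith)
      exact (a1.comp_add_const x 1).sub a2
    · intro x hx1 hx2
      have hder : ∀ y ∈ Set.Ioo x (x + 1), HasDerivAt (F k) (F (k + 1) y) y := fun y hy =>
        hd k (by omega) y (by linarith [hy.1]) (by linarith [hy.2])
      have hcont : ContinuousOn (F k) (Set.Icc x (x + 1)) := fun y hy =>
        (hd k (by omega) y (by linarith [hy.1]) (by linarith [hy.2])).continuousAt.continuousWithinAt
      obtain ⟨ξ, hξ, hξ'⟩ := exists_hasDerivAt_eq_slope (F k) (F (k + 1)) (by linarith) hcont hder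
      have : F k (x + 1) - F k x = F (k + 1) ξ := by rw [hξ']; simp
      simp only [this]
      exact hb ξ (by linarith [hξ.1]) (by linarith [hξ.2])

/-- falling factorial -/
noncomputable def dp (s : ℝ) (i : ℕ) : ℝ := ∏ j ∈ range i, (s - j)

lemma dp_succ (s : ℝ) (i : ℕ) : dp s (i + 1) = dp s i * (s - i) := by
  unfold dp; rw [prod_range_succ]

lemma dp_ne_zero {s : ℝ} (h0 : 0 < s) (h1 : s < 1) (i : ℕ) : dp s i ≠ 0 := by
  unfold dp
  rw [prod_ne_zero_iff]
  intro j _ hj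
  rcases j with _ | j
  · simp at hj; linarith
  · push_cast at hj; linarith [(Nat.cast_nonneg j : (0:ℝ) ≤ j)]

/-- derivative family of a power of an affine function -/
noncomputable def pf (b d s : ℝ) (i : ℕ) (x : ℝ) : ℝ := dp s i * d ^ i * (b + d * x) ^ (s - i)

lemma pf_deriv (b d s : ℝ) (i : ℕ) (x : ℝ) (h : 0 < b + d * x) :
    HasDerivAt (pf b d s i) (pf b d s (i + 1) x) x := by
  have h1 : HasDerivAt (fun x => b + d * x) d x := by
    simpa using ((hasDerivAt_id x).const_mul d).const_add b
  have h2 := (h1.rpow_const (p := s - i) (Or.inl h.ne')).const_mul (dp s i * d ^ i)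
  have h3 : pf b d s (i + 1) x = dp s i * d ^ i * (d * (s - i) * (b + d * x) ^ (s - i - 1)) := by
    unfold pf
    rw [dp_succ]; push_cast
    rw [show s - ((i:ℝ) + 1) = s - i - 1 by ring]; ring
  rw [h3]; exact h2

lemma norm_sum_e_neg (f : ℕ → ℝ) (s : Finset ℕ) : ‖∑ n ∈ s, e (-f n)‖ = ‖∑ n ∈ s, e (f n)‖ := by
  rw [← Complex.norm_conj, map_sum]
  congr 1
  refine sum_congr rfl fun n _ => ?_
  rw [e_neg, Complex.conj_conj]

set_option maxHeartbeats 2000000 in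
lemma power_phase (γ c : ℝ) (hγ0 : 0 < γ) (hγ1 : γ < 1) (hc : 0 < c) (k : ℕ) (hk : 1 ≤ k) (α b : ℝ)
    (hα : 0 < α) (hDT : DT k α b) :
    ∃ ρ K : ℝ, 0 < ρ ∧ 0 < K ∧ ∀ (κ₁ κ₂ M d b0 : ℝ) (L : ℕ), 0 < M → 0 < d → κ₁ ≠ 0 →
      (∀ n < L, M ≤ b0 + d * n ∧ b0 + d * n ≤ 2 * M) → |κ₂| * M ^ c ≤ ρ * (|κ₁| * M ^ γ) →
      ‖∑ n ∈ range L, e (κ₁ * (b0 + d * n) ^ γ + κ₂ * (b0 + d * n) ^ c)‖ ≤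
        K * (L * ((|κ₁| * M ^ γ) * (d / M) ^ k) ^ α +
          (L:ℝ) ^ (1 - b) * ((|κ₁| * M ^ γ) * (d / M) ^ k) ^ (-α)) := by
  set P := |dp γ k| with hP
  have hP0 : 0 < P := abs_pos.2 (dp_ne_zero hγ0 hγ1 k)
  set R := |dp c k| with hR
  have hR0 : 0 ≤ R := abs_nonneg _
  set p := P * 2 ^ (γ - k) with hp
  have hp0 : 0 < p := by positivity
  have h2c : (0:ℝ) < 2 ^ c := by positivity
  obtain ⟨K, hK, hKf⟩ := hDT ((P + p / 2) / (p / 2)) (by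
    rw [le_div_iff₀ (by positivity)]; linarith)
  refine ⟨p / (2 * ((R + 1) * 2 ^ c)), K * ((p/2) ^ α + (p/2) ^ (-α)), by positivity, by positivity, ?_⟩
  intro κ₁ κ₂ M d b0 L hM hd hκ hrange hκ₂
  set T := |κ₁| * M ^ γ with hT
  have hT0 : 0 < T := by have := abs_pos.2 hκ; positivity
  set lam := T * (d / M) ^ k with hlam
  have hlam0 : 0 < lam := by positivity
  set F : ℕ → ℝ → ℝ := fun i x => κ₁ * pf b0 d γ i x + κ₂ * pf b0 d c i x with hF
  -- bounds
  have hkr : (1:ℝ) ≤ k := by exact_mod_cast hk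
  have hFk : ∀ x : ℝ, M ≤ b0 + d * x → b0 + d * x ≤ 2 * M →
      |κ₂ * pf b0 d c k x| ≤ p / 2 * lam ∧ p * lam ≤ |κ₁ * pf b0 d γ k x| ∧ |κ₁ * pf b0 d γ k x| ≤ P * lam := by
    intro x h1 h2
    set y := b0 + d * x with hy
    have hy0 : 0 < y := by linarith
    have hdk : d ^ k * M ^ (-(k:ℝ)) = (d / M) ^ k := by
      rw [Real.rpow_neg hM.le, Real.rpow_natCast, div_pow, div_eq_mul_inv]
    refine ⟨?_, ?_, ?_⟩
    · have y1 : y ^ (c - k) ≤ 2 ^ c * M ^ c * M ^ (-(k:ℝ)) := by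
        rw [sub_eq_add_neg, Real.rpow_add hy0, ← Real.mul_rpow (by norm_num) hM.le]
        refine mul_le_mul (Real.rpow_le_rpow hy0.le h2 hc.le) ?_ (by positivity) (by positivity)
        exact Real.rpow_le_rpow_of_nonpos hM h1 (by linarith)
      have e1 : |κ₂ * pf b0 d c k x| = |κ₂| * (R * d ^ k * y ^ (c - k)) := by
        unfold pf
        rw [abs_mul, abs_mul, abs_mul, abs_of_pos (pow_pos hd k), abs_of_pos (Real.rpow_pos_of_pos hy0 _)]
      rw [e1]
      calc |κ₂| * (R * d ^ k * y ^ (c - k)) ≤ |κ₂| * (R * d ^ k * (2 ^ c * M ^ c * M ^ (-(k:ℝ)))) := by gcongr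
        _ = (R * 2 ^ c) * (|κ₂| * M ^ c) * (d ^ k * M ^ (-(k:ℝ))) := by ring
        _ ≤ (R * 2 ^ c) * (p / (2 * ((R + 1) * 2 ^ c)) * T) * (d ^ k * M ^ (-(k:ℝ))) := by gcongr
        _ = (R / (R + 1)) * (p / 2 * lam) := by rw [hdk, hlam]; field_simp
        _ ≤ 1 * (p / 2 * lam) := by
            refine mul_le_mul_of_nonneg_right ?_ (by positivity)
            rw [div_le_one (by linarith)]; linarith
        _ = _ := one_mul _
    · have y1 : 2 ^ (γ - k) * (M ^ γ * M ^ (-(k:ℝ))) ≤ y ^ (γ - k) := by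
        rw [← Real.rpow_add hM, ← sub_eq_add_neg, ← Real.mul_rpow (by norm_num) hM.le]
        exact Real.rpow_le_rpow_of_nonpos hy0 h2 (by linarith)
      have e1 : |κ₁ * pf b0 d γ k x| = |κ₁| * (P * d ^ k * y ^ (γ - k)) := by
        unfold pf
        rw [abs_mul, abs_mul, abs_mul, abs_of_pos (pow_pos hd k), abs_of_pos (Real.rpow_pos_of_pos hy0 _)]
      rw [e1]
      calc p * lam = |κ₁| * (P * d ^ k * (2 ^ (γ - k) * (M ^ γ * M ^ (-(k:ℝ))))) := by
            rw [hlam, ← hdk, hp, hT]; ring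
        _ ≤ _ := by gcongr
    · have y1 : y ^ (γ - k) ≤ M ^ γ * M ^ (-(k:ℝ)) := by
        rw [← Real.rpow_add hM, ← sub_eq_add_neg]
        exact Real.rpow_le_rpow_of_nonpos hM h1 (by linarith)
      have e1 : |κ₁ * pf b0 d γ k x| = |κ₁| * (P * d ^ k * y ^ (γ - k)) := by
        unfold pf
        rw [abs_mul, abs_mul, abs_mul, abs_of_pos (pow_pos hd k), abs_of_pos (Real.rpow_pos_of_pos hy0 _)]
      rw [e1]
      calc _ ≤ |κ₁| * (P * d ^ k * (M ^ γ * M ^ (-(k:ℝ)))) := by gcongr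
        _ = P * lam := by rw [hlam, ← hdk, hT]; ring
  have hF0 : ∀ n : ℕ, F 0 n = κ₁ * (b0 + d * n) ^ γ + κ₂ * (b0 + d * n) ^ c := by
    intro n; simp [hF, pf, dp]
  -- sign
  have hsgn : ∃ s : ℝ, (s = 1 ∨ s = -1) ∧ ∀ x : ℝ, M ≤ b0 + d * x → b0 + d * x ≤ 2 * M →
      s * (κ₁ * pf b0 d γ k x) = |κ₁ * pf b0 d γ k x| := by
    rcases le_total 0 (κ₁ * dp γ k) with h | h
    · refine ⟨1, Or.inl rfl, fun x h1 h2 => ?_⟩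
      rw [one_mul, abs_of_nonneg]
      have : κ₁ * pf b0 d γ k x = (κ₁ * dp γ k) * (d ^ k * (b0 + d * x) ^ (γ - k)) := by unfold pf; ring
      rw [this]
      have : 0 < b0 + d * x := by linarith
      positivity
    · refine ⟨-1, Or.inr rfl, fun x h1 h2 => ?_⟩
      rw [neg_one_mul, abs_of_nonpos]
      have : κ₁ * pf b0 d γ k x = (κ₁ * dp γ k) * (d ^ k * (b0 + d * x) ^ (γ - k)) := by unfold pf; ring
      rw [this]
      have : 0 < b0 + d * x := by linarith
      exact mul_nonpos_of_nonpos_of_nonneg h (by positivity)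
  obtain ⟨s, hs, hsF⟩ := hsgn
  have hnorm : ‖∑ n ∈ range L, e (κ₁ * (b0 + d * n) ^ γ + κ₂ * (b0 + d * n) ^ c)‖ =
      ‖∑ n ∈ range L, e (s * F 0 n)‖ := by
    rcases hs with rfl | rfl
    · simp_rw [one_mul, hF0]
    · simp_rw [neg_one_mul]
      rw [norm_sum_e_neg (fun n : ℕ => F 0 n)]
      simp_rw [hF0]
  rw [hnorm]
  have hpl : 0 < p / 2 * lam := by positivity
  have hmain := hKf (fun n => s * F 0 n) L (p / 2 * lam) hpl (by
    intro n hn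
    have hx : ∀ x : ℝ, 0 ≤ x → x ≤ (L:ℝ) - 1 → M ≤ b0 + d * x ∧ b0 + d * x ≤ 2 * M := by
      intro x h0 h1
      have hL : 0 < L := by omega
      have r1 := hrange 0 hL
      have r2 := hrange (L - 1) (by omega)
      rw [Nat.cast_sub hL] at r2
      push_cast at r1 r2
      constructor
      · nlinarith
      · nlinarith
    have := dif_fam k (fun i x => s * F i x) 0 ((L:ℝ) - 1) (p / 2 * lam) ((P + p / 2) / (p / 2) * (p / 2 * lam))
      (by
        intro i _ x h0 h1
        have hx' := hx x h0 h1
        exact (((pf_deriv b0 d γ i x (by linarith)).const_mul κ₁).add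
          ((pf_deriv b0 d c i x (by linarith)).const_mul κ₂)).const_mul s)
      (by
        intro x h0 h1
        have hx' := hx x h0 h1
        obtain ⟨b1, b2, b3⟩ := hFk x hx'.1 hx'.2
        have b4 := hsF x hx'.1 hx'.2
        have e1 : s * F k x = |κ₁ * pf b0 d γ k x| + s * (κ₂ * pf b0 d c k x) := by
          rw [← b4]; simp only [hF]; ring
        have b5 : |s * (κ₂ * pf b0 d c k x)| ≤ p / 2 * lam := by
          rw [abs_mul]
          have : |s| = 1 := by rcases hs with rfl | rfl <;> simp
          rw [this, one_mul]; exact b1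
        have b6 := abs_le.1 b5
        have e2 : (P + p / 2) / (p / 2) * (p / 2 * lam) = (P + p / 2) * lam := by field_simp
        simp only [e1]; rw [e2]
        constructor
        · nlinarith
        · nlinarith)
      n (Nat.cast_nonneg n) (by
        have : ((n + k : ℕ) : ℝ) + 1 ≤ L := by exact_mod_cast hn
        push_cast at this; linarith)
    exact this)
  refine hmain.trans ?_
  rw [Real.mul_rpow (by positivity) hlam0.le, Real.mul_rpow (by positivity) hlam0.le, mul_assoc]
  refine mul_le_mul_of_nonneg_left ?_ hK.le
  have q1 : 0 < (p/2) ^ α := by positivity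
  have q2 : 0 < (p/2) ^ (-α) := by positivity
  have q3 : 0 ≤ L * lam ^ α := by positivity
  have q4 : 0 ≤ (L:ℝ) ^ (1 - b) * lam ^ (-α) := by positivity
  nlinarith [mul_nonneg q1.le q3, mul_nonneg q1.le q4, mul_nonneg q2.le q3, mul_nonneg q2.le q4]

/-- a finite arithmetic progression with difference `d` -/
def IsAP (d : ℕ) (s : Finset ℕ) : Prop := ∃ b0 L : ℕ, s = (range L).image (fun n => b0 + d * n)

lemma isAP_filter (d : ℕ) (hd : 0 < d) (A B : ℕ) (p : ℕ → Prop) [DecidablePred p]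
    (hp : ∀ m m', A ≤ m → m ≤ B → A ≤ m' → m' ≤ B → p m → (p m' ↔ m' ≡ m [MOD d])) :
    IsAP d ((Icc A B).filter p) := by
  by_cases hne : ((Icc A B).filter p).Nonempty
  · set s := (Icc A B).filter p with hs
    set b0 := s.min' hne with hb0
    set t := s.max' hne with ht
    have hb : b0 ∈ s := min'_mem _ _
    have htm : t ∈ s := max'_mem _ _
    have hb' := hb; have htm' := htm
    rw [hs, mem_filter, mem_Icc] at hb' htm'
    refine ⟨b0, (t - b0) / d + 1, ?_⟩
    ext m
    simp only [mem_image, mem_range]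
    constructor
    · intro hm
      have h1 : b0 ≤ m := min'_le _ _ hm
      have h2 : m ≤ t := le_max' _ _ hm
      have hm' := hm
      rw [hs, mem_filter, mem_Icc] at hm'
      have h3 := (hp b0 m hb'.1.1 hb'.1.2 hm'.1.1 hm'.1.2 hb'.2).1 hm'.2
      have h4 : d ∣ m - b0 := (Nat.modEq_iff_dvd' h1).1 h3.symm
      obtain ⟨n, hn⟩ := h4
      refine ⟨n, ?_, by omega⟩
      have : n ≤ (t - b0) / d := by
        rw [Nat.le_div_iff_mul_le hd, mul_comm, ← hn]; omega
      omega
    · rintro ⟨n, hn, rfl⟩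
      have h1 : n * d ≤ t - b0 := (Nat.le_div_iff_mul_le hd).1 (by omega)
      have hbt : b0 ≤ t := min'_le _ _ htm
      have h2 : b0 + d * n ≤ t := by rw [mul_comm]; omega
      rw [hs, mem_filter, mem_Icc]
      refine ⟨⟨by omega, by omega⟩, ?_⟩
      refine (hp b0 (b0 + d * n) hb'.1.1 hb'.1.2 (by omega) (by omega) hb'.2).2 ?_
      simp [Nat.ModEq]
  · rw [not_nonempty_iff_eq_empty] at hne
    exact ⟨0, 0, by simp [hne]⟩

lemma isAP_card (d : ℕ) (hd : 0 < d) (M : ℝ) (s : Finset ℕ) (hs : IsAP d s) (hM : (d:ℝ) ≤ M)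
    (b : ℝ) (hsM : ∀ m ∈ s, b ≤ (m:ℝ) ∧ (m:ℝ) ≤ b + M) : (#s : ℝ) ≤ 2 * (M / d) := by
  obtain ⟨b0, L, rfl⟩ := hs
  have hd' : (0:ℝ) < d := by exact_mod_cast hd
  have h1 : 1 ≤ M / d := by rw [le_div_iff₀ hd']; linarith
  have : (#((range L).image (fun n => b0 + d * n)) : ℝ) ≤ L := by
    exact_mod_cast (card_image_le.trans (by simp))
  refine this.trans ?_
  rcases L with _ | m
  · simp; linarith
  · have a1 := hsM (b0 + d * 0) (mem_image.2 ⟨0, by simp, rfl⟩)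
    have a2 := hsM (b0 + d * m) (mem_image.2 ⟨m, by simp, rfl⟩)
    push_cast at a1 a2 ⊢
    have : (m:ℝ) ≤ M / d := by rw [le_div_iff₀ hd']; nlinarith
    linarith

lemma ap_sum (γ c : ℝ) (hγ0 : 0 < γ) (hγ1 : γ < 1) (hc : 0 < c) (k : ℕ) (hk : 1 ≤ k) (α b : ℝ)
    (hα : 0 < α) (hb0 : 0 ≤ b) (hb : b ≤ 1) (hDT : DT k α b) :
    ∃ ρ K : ℝ, 0 < ρ ∧ 0 < K ∧ ∀ (κ₁ κ₂ M : ℝ) (d : ℕ) (s : Finset ℕ), 0 < d → (d:ℝ) ≤ M → κ₁ ≠ 0 →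
      IsAP d s → (∀ m ∈ s, M ≤ (m:ℝ) ∧ (m:ℝ) ≤ 2 * M) → |κ₂| * M ^ c ≤ ρ * (|κ₁| * M ^ γ) →
      ‖∑ m ∈ s, e (κ₁ * (m:ℝ) ^ γ + κ₂ * (m:ℝ) ^ c)‖ ≤
        K * ((M / d) * ((|κ₁| * M ^ γ) / (M / d) ^ k) ^ α +
          (M / d) ^ (1 - b) * ((|κ₁| * M ^ γ) / (M / d) ^ k) ^ (-α)) := by
  obtain ⟨ρ, K, hρ, hK, h⟩ := power_phase γ c hγ0 hγ1 hc k hk α b hα hDT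
  refine ⟨ρ, 2 * K, hρ, by positivity, ?_⟩
  intro κ₁ κ₂ M d s hd hdM hκ hs hsM hκ₂
  have hcard := isAP_card d hd M s hs hdM M (fun m hm => ⟨(hsM m hm).1, by linarith [(hsM m hm).2]⟩)
  obtain ⟨b0, L, rfl⟩ := hs
  have hd' : (0:ℝ) < d := by exact_mod_cast hd
  have hM : 0 < M := by linarith
  have hinj : Set.InjOn (fun n => b0 + d * n) (range L : Finset ℕ) := by
    intro x _ y _ hxy
    simp only [add_right_inj] at hxy
    exact Nat.eq_of_mul_eq_mul_left hd hxy
  rw [card_image_of_injOn hinj, card_range] at hcard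
  rw [sum_image hinj]
  have := h κ₁ κ₂ M d b0 L hM hd' hκ (by
    intro n hn
    have := hsM (b0 + d * n) (mem_image.2 ⟨n, mem_range.2 hn, rfl⟩)
    push_cast at this; exact this) hκ₂
  push_cast
  refine this.trans ?_
  have e1 : (d / M : ℝ) ^ k = ((M / d) ^ k)⁻¹ := by rw [← inv_pow, inv_div]
  rw [e1, ← div_eq_mul_inv]
  set lam := |κ₁| * M ^ γ / (M / d) ^ k
  have hlam : 0 ≤ lam := by positivity
  have h1 : (L:ℝ) ^ (1 - b) ≤ 2 * (M / d) ^ (1 - b) := by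
    calc (L:ℝ) ^ (1 - b) ≤ (2 * (M / d)) ^ (1 - b) := Real.rpow_le_rpow (by positivity) hcard (by linarith)
      _ = 2 ^ (1 - b) * (M / d) ^ (1 - b) := Real.mul_rpow (by norm_num) (by positivity)
      _ ≤ 2 ^ (1:ℝ) * (M / d) ^ (1 - b) := by
          refine mul_le_mul_of_nonneg_right ?_ (by positivity)
          exact Real.rpow_le_rpow_of_exponent_le (by norm_num) (by linarith)
      _ = _ := by rw [Real.rpow_one]
  calc K * (L * lam ^ α + (L:ℝ) ^ (1 - b) * lam ^ (-α)) ≤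
      K * (2 * (M / d) * lam ^ α + 2 * (M / d) ^ (1 - b) * lam ^ (-α)) := by gcongr
    _ = _ := by ring

/-- combined form of the third and fourth derivative estimates. -/
lemma ap_sum34 (γ c : ℝ) (hγ0 : 0 < γ) (hγ1 : γ < 1) (hc : 0 < c) :
    ∃ ρ K : ℝ, 0 < ρ ∧ 0 < K ∧ ∀ (κ₁ κ₂ M : ℝ) (d : ℕ) (s : Finset ℕ), 0 < d → (d:ℝ) ≤ M → κ₁ ≠ 0 →
      IsAP d s → (∀ m ∈ s, M ≤ (m:ℝ) ∧ (m:ℝ) ≤ 2 * M) → |κ₂| * M ^ c ≤ ρ * (|κ₁| * M ^ γ) →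
      ‖∑ m ∈ s, e (κ₁ * (m:ℝ) ^ γ + κ₂ * (m:ℝ) ^ c)‖ ≤
        K * (M / d) * ((|κ₁| * M ^ γ) ^ (1/6 : ℝ) * (M / d) ^ (-(1/2) : ℝ) + (|κ₁| * M ^ γ) ^ (-(1/6) : ℝ)) ∧
      ‖∑ m ∈ s, e (κ₁ * (m:ℝ) ^ γ + κ₂ * (m:ℝ) ^ c)‖ ≤
        K * (M / d) * ((|κ₁| * M ^ γ) ^ (1/14 : ℝ) * (M / d) ^ (-(2/7) : ℝ) +
          (|κ₁| * M ^ γ) ^ (-(1/14) : ℝ) * (M / d) ^ (1/28 : ℝ)) := by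
  obtain ⟨ρ₁, K₁, hρ₁, hK₁, h₁⟩ := ap_sum γ c hγ0 hγ1 hc 3 (by norm_num) _ _ (by norm_num) (by norm_num) (by norm_num) DT3
  obtain ⟨ρ₂, K₂, hρ₂, hK₂, h₂⟩ := ap_sum γ c hγ0 hγ1 hc 4 (by norm_num) _ _ (by norm_num) (by norm_num) (by norm_num) DT4
  refine ⟨min ρ₁ ρ₂, K₁ + K₂, lt_min hρ₁ hρ₂, by positivity, ?_⟩
  intro κ₁ κ₂ M d s hd hdM hκ hs hsM hκ₂
  have hd' : (0:ℝ) < d := by exact_mod_cast hd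
  have hM : 0 < M := by linarith
  have hT0 : 0 < |κ₁| * M ^ γ := by have := abs_pos.2 hκ; positivity
  have a1 := h₁ κ₁ κ₂ M d s hd hdM hκ hs hsM (hκ₂.trans (mul_le_mul_of_nonneg_right (min_le_left _ _) hT0.le))
  have a2 := h₂ κ₁ κ₂ M d s hd hdM hκ hs hsM (hκ₂.trans (mul_le_mul_of_nonneg_right (min_le_right _ _) hT0.le))
  set T := |κ₁| * M ^ γ
  set l := M / d with hl
  have hl0 : 0 < l := by positivity
  have key : ∀ (k : ℕ) (β : ℝ), (T / l ^ k) ^ β = T ^ β * l ^ (-(k * β)) := by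
    intro k β
    rw [Real.div_rpow hT0.le (by positivity), ← Real.rpow_natCast, ← Real.rpow_mul hl0.le,
      div_eq_mul_inv, ← Real.rpow_neg hl0.le]
  constructor
  · refine a1.trans ?_
    rw [key, key]
    have e1 : l * (T ^ (1/6:ℝ) * l ^ (-(((3:ℕ):ℝ) * (1/6)))) = l * (T ^ (1/6:ℝ) * l ^ (-(1/2):ℝ)) := by
      congr 3; norm_num
    have e2 : l ^ (1 - 1/2:ℝ) * (T ^ (-(1/6):ℝ) * l ^ (-(((3:ℕ):ℝ) * (-(1/6))))) = l * T ^ (-(1/6):ℝ) := by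
      have : l = l ^ (1 - 1/2:ℝ) * l ^ (-(((3:ℕ):ℝ) * (-(1/6)))) := by
        rw [← Real.rpow_add hl0]; norm_num
      nth_rewrite 3 [this]; ring
    rw [e1, e2]
    have : 0 ≤ l * (T ^ (1/6:ℝ) * l ^ (-(1/2):ℝ)) + l * T ^ (-(1/6):ℝ) := by positivity
    nlinarith [mul_nonneg hK₂.le this]
  · refine a2.trans ?_
    rw [key, key]
    have e1 : l * (T ^ (1/14:ℝ) * l ^ (-(((4:ℕ):ℝ) * (1/14)))) = l * (T ^ (1/14:ℝ) * l ^ (-(2/7):ℝ)) := by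
      congr 3; norm_num
    have e2 : l ^ (1 - 1/4:ℝ) * (T ^ (-(1/14):ℝ) * l ^ (-(((4:ℕ):ℝ) * (-(1/14))))) =
        l * (T ^ (-(1/14):ℝ) * l ^ (1/28:ℝ)) := by
      have : l ^ (1 - 1/4:ℝ) * l ^ (-(((4:ℕ):ℝ) * (-(1/14)))) = l * l ^ (1/28:ℝ) := by
        rw [← Real.rpow_add hl0]
        nth_rewrite 2 [← Real.rpow_one l]
        rw [← Real.rpow_add hl0]; norm_num
      calc _ = T ^ (-(1/14):ℝ) * (l ^ (1 - 1/4:ℝ) * l ^ (-(((4:ℕ):ℝ) * (-(1/14))))) := by ring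
        _ = _ := by rw [this]; ring
    rw [e1, e2]
    have : 0 ≤ l * (T ^ (1/14:ℝ) * l ^ (-(2/7):ℝ)) + l * (T ^ (-(1/14):ℝ) * l ^ (1/28:ℝ)) := by positivity
    nlinarith [mul_nonneg hK₁.le this]

end BVP

namespace BVP
open Finset

lemma ev_const (C κ : ℝ) (hκ : 0 < κ) : ∃ X₀ : ℝ, 2 ≤ X₀ ∧ ∀ X, X₀ ≤ X → C ≤ X ^ κ := by
  have h := (tendsto_rpow_atTop hκ).eventually_ge_atTop C
  obtain ⟨X₀, hX⟩ := Filter.eventually_atTop.1 h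
  exact ⟨max X₀ 2, le_max_right _ _, fun X h => hX X ((le_max_left _ _).trans h)⟩

lemma ev_log (C κ : ℝ) (k : ℕ) (hκ : 0 < κ) :
    ∃ X₀ : ℝ, 2 ≤ X₀ ∧ ∀ X, X₀ ≤ X → C * (1 + Real.log X) ^ k ≤ X ^ κ := by
  have h0 : (fun X : ℝ => (1 + Real.log X)) =o[Filter.atTop] fun X => X ^ (κ / (k + 1)) := by
    refine Asymptotics.IsLittleO.add ?_ (isLittleO_log_rpow_atTop (by positivity))
    have := (tendsto_rpow_atTop (y := κ / (k+1)) (by positivity))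
    exact (Asymptotics.isLittleO_const_left.2 (Or.inr (Filter.tendsto_abs_atTop_atTop.comp this)))
  obtain ⟨X₀, hX⟩ := Filter.eventually_atTop.1 (h0.bound (c := 1) one_pos)
  obtain ⟨X₁, hX₁, hC⟩ := ev_const C (κ / (k + 1)) (by positivity)
  refine ⟨max X₀ X₁, hX₁.trans (le_max_right _ _), fun X h => ?_⟩
  have hx2 : 2 ≤ X := hX₁.trans ((le_max_right _ _).trans h)
  have h1 := hX X ((le_max_left _ _).trans h)
  have h2 := hC X ((le_max_right _ _).trans h)
  have hl : 0 ≤ Real.log X := Real.log_nonneg (by linarith)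
  rw [one_mul, Real.norm_eq_abs, Real.norm_eq_abs, abs_of_nonneg (a := X ^ _) (by positivity),
    abs_of_nonneg (by linarith)] at h1
  calc C * (1 + Real.log X) ^ k ≤ X ^ (κ / (k + 1)) * (X ^ (κ / (k + 1))) ^ k := by gcongr
    _ = X ^ κ := by
      rw [← Real.rpow_natCast, ← Real.rpow_mul (by linarith), ← Real.rpow_add (by linarith)]
      congr 1; field_simp; ring

lemma isAP_of (d : ℕ) (hd : 0 < d) (S : Finset ℕ) (h1 : ∀ m ∈ S, ∀ m' ∈ S, m' ≡ m [MOD d])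
    (h2 : ∀ m ∈ S, ∀ m'' ∈ S, ∀ m', m ≤ m' → m' ≤ m'' → m' ≡ m [MOD d] → m' ∈ S) : IsAP d S := by
  by_cases hne : S.Nonempty
  · have e1 : S = (Icc (S.min' hne) (S.max' hne)).filter (fun m => m ≡ S.min' hne [MOD d]) := by
      ext m
      rw [mem_filter, mem_Icc]
      constructor
      · intro hm
        exact ⟨⟨min'_le _ _ hm, le_max' _ _ hm⟩, h1 _ (min'_mem _ _) _ hm⟩
      · rintro ⟨⟨a1, a2⟩, a3⟩
        exact h2 _ (min'_mem _ _) _ (max'_mem _ _) _ a1 a2 a3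
    rw [e1]
    refine isAP_filter d hd _ _ _ ?_
    intro m m' _ _ _ _ hm
    exact ⟨fun h => h.trans hm.symm, fun h => h.trans hm⟩
  · rw [not_nonempty_iff_eq_empty] at hne
    exact ⟨0, 0, by simp [hne]⟩

/-- The unified bound for AP sums. -/
lemma base_bound (γ c : ℝ) (hγ0 : 865/886 < γ) (hγ1 : γ < 1) (hc : 0 < c) :
    ∃ X₀ : ℝ, 2 ≤ X₀ ∧ ∀ X, X₀ ≤ X → ∀ (κ₁ κ₂ M : ℝ) (d : ℕ) (s : Finset ℕ), 0 < d →
      X ^ (309/1000 + 755/100 * (1 - γ)) * d ≤ M →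
      X ^ (9/10 : ℝ) ≤ |κ₁| * M ^ γ → |κ₁| * M ^ γ ≤ X ^ (1 + (1 - γ) + 1/20000) →
      IsAP d s → (∀ m ∈ s, M ≤ (m:ℝ) ∧ (m:ℝ) ≤ 2 * M) → |κ₂| * M ^ c ≤ X ^ (3/10 : ℝ) →
      ‖∑ m ∈ s, e (κ₁ * (m:ℝ) ^ γ + κ₂ * (m:ℝ) ^ c)‖ ≤ M / d * X ^ (-(2 * (1 - γ) + 1/5000)) := by
  obtain ⟨ρ, K, hρ, hK, h⟩ := ap_sum34 γ c (by linarith) hγ1 hc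
  obtain ⟨X₁, hX₁, h₁⟩ := ev_const (2 * K) (1/100000) (by norm_num)
  obtain ⟨X₂, hX₂, h₂⟩ := ev_const (1 / ρ) (6/10) (by norm_num)
  refine ⟨max X₁ X₂, hX₁.trans (le_max_left _ _), ?_⟩
  intro X hX κ₁ κ₂ M d s hd hM hT1 hT2 hs hsM hκ₂
  have g1 := h₁ X ((le_max_left _ _).trans hX)
  have g2 := h₂ X ((le_max_right _ _).trans hX)
  have hX1 : 1 ≤ X := by linarith [le_max_left X₁ X₂]
  have hX0 : 0 < X := by linarith
  have hd' : (0:ℝ) < d := by exact_mod_cast hd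
  have hl1 : X ^ (309/1000 + 755/100 * (1 - γ)) ≤ M / d := by rwa [le_div_iff₀ hd']
  have hl2 : 1 ≤ M / d := le_trans (Real.one_le_rpow hX1 (by linarith)) hl1
  have hdM : (d:ℝ) ≤ M := by rw [le_div_iff₀ hd'] at hl2; linarith
  have hκ : κ₁ ≠ 0 := by
    rintro rfl
    have : 0 < X ^ (9/10:ℝ) := by positivity
    simp at hT1; linarith
  have hρ' : |κ₂| * M ^ c ≤ ρ * (|κ₁| * M ^ γ) := by
    refine hκ₂.trans (le_trans ?_ (mul_le_mul_of_nonneg_left hT1 hρ.le))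
    rw [show (9/10:ℝ) = 6/10 + 3/10 by norm_num, Real.rpow_add hX0, ← mul_assoc]
    refine le_mul_of_one_le_left (by positivity) ?_
    rw [div_le_iff₀ hρ] at g2; linarith
  obtain ⟨b3, b4⟩ := h κ₁ κ₂ M d s hd hdM hκ hs hsM hρ'
  set T := |κ₁| * M ^ γ with hT
  set l := M / d with hl
  have hl0 : 0 < l := by linarith
  have hXT : 0 < X ^ (9/10:ℝ) := by positivity
  have hT0 : 0 < T := by linarith
  have fin : ∀ a b : ℝ, a ≤ -(2 * (1 - γ) + 1/5000) - 1/100000 → b ≤ -(2 * (1 - γ) + 1/5000) - 1/100000 →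
      K * l * (X ^ a + X ^ b) ≤ l * X ^ (-(2 * (1 - γ) + 1/5000)) := by
    intro a b ha hb
    have ha' := Real.rpow_le_rpow_of_exponent_le hX1 ha
    have hb' := Real.rpow_le_rpow_of_exponent_le hX1 hb
    set Z := X ^ (-(2 * (1 - γ) + 1/5000) - 1/100000) with hZ
    have hZ0 : 0 < Z := by positivity
    have e1 : X ^ (-(2 * (1 - γ) + 1/5000)) = X ^ (1/100000 : ℝ) * Z := by
      rw [hZ, ← Real.rpow_add hX0]; congr 1; ring
    calc K * l * (X ^ a + X ^ b) ≤ K * l * (Z + Z) := by gcongr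
      _ = l * (2 * K * Z) := by ring
      _ ≤ l * (X ^ (1/100000 : ℝ) * Z) := by gcongr
      _ = _ := by rw [e1]
  rcases le_total (X ^ (44/100 : ℝ)) l with hc1 | hc1
  · refine b3.trans (le_trans ?_ (fin ((1 + (1 - γ) + 1/20000) * (1/6) + (44/100) * (-(1/2))) ((9/10) * (-(1/6)))
      (by linarith) (by linarith)))
    rw [Real.rpow_add hX0, Real.rpow_mul hX0.le, Real.rpow_mul hX0.le, Real.rpow_mul hX0.le]
    have i1 : T ^ (1/6:ℝ) ≤ (X ^ (1 + (1 - γ) + 1/20000)) ^ (1/6:ℝ) := Real.rpow_le_rpow hT0.le hT2 (by norm_num)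
    have i2 : l ^ (-(1/2):ℝ) ≤ (X ^ (44/100:ℝ)) ^ (-(1/2):ℝ) := Real.rpow_le_rpow_of_nonpos (by positivity) hc1 (by norm_num)
    have i3 : T ^ (-(1/6):ℝ) ≤ (X ^ (9/10:ℝ)) ^ (-(1/6):ℝ) := Real.rpow_le_rpow_of_nonpos (by positivity) hT1 (by norm_num)
    gcongr
  · refine b4.trans (le_trans ?_ (fin ((1 + (1 - γ) + 1/20000) * (1/14) + (309/1000 + 755/100 * (1 - γ)) * (-(2/7)))
      ((9/10) * (-(1/14)) + (44/100) * (1/28)) (by linarith) (by linarith)))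
    rw [Real.rpow_add hX0 _ ((309/1000 + 755/100 * (1 - γ)) * (-(2/7))), Real.rpow_mul hX0.le, Real.rpow_mul hX0.le,
      Real.rpow_add hX0 ((9/10) * (-(1/14))), Real.rpow_mul hX0.le, Real.rpow_mul hX0.le]
    have i1 : T ^ (1/14:ℝ) ≤ (X ^ (1 + (1 - γ) + 1/20000)) ^ (1/14:ℝ) := Real.rpow_le_rpow hT0.le hT2 (by norm_num)
    have i2 : l ^ (-(2/7):ℝ) ≤ (X ^ (309/1000 + 755/100 * (1 - γ))) ^ (-(2/7):ℝ) := Real.rpow_le_rpow_of_nonpos (by positivity) hl1 (by norm_num)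
    have i3 : T ^ (-(1/14):ℝ) ≤ (X ^ (9/10:ℝ)) ^ (-(1/14):ℝ) := Real.rpow_le_rpow_of_nonpos (by positivity) hT1 (by norm_num)
    have i4 : l ^ (1/28:ℝ) ≤ (X ^ (44/100:ℝ)) ^ (1/28:ℝ) := Real.rpow_le_rpow hl0.le hc1 (by norm_num)
    gcongr

end BVP

namespace BVP
open Finset

open Classical in
/-- the weight -/
noncomputable def W (γ c : ℝ) (a : ℤ) (d : ℕ) (h t Y x : ℝ) (n : ℕ) : ℂ :=
  if Y < n ∧ (n:ℝ) ≤ x ∧ (d:ℤ) ∣ (n:ℤ) - a then e (h * (n:ℝ) ^ γ + t * (n:ℝ) ^ c) else 0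

structure Par (γ c X : ℝ) (d : ℕ) (h t Y x : ℝ) : Prop where
  hd : 0 < d
  hdX : (d:ℝ) ≤ X ^ (21/110 - 443/55 * (1 - γ))
  h1 : 1 ≤ |h|
  h2 : |h| ≤ X ^ (2 * (1 - γ) + 4/100000)
  ht : |t| ≤ X ^ (1/4 - c)
  hY : Y = X ^ (γ - 2/100000)
  hx : x ≤ X

lemma W_zero_of_lt {γ c : ℝ} {a : ℤ} {d : ℕ} {h t Y x : ℝ} {n : ℕ} (hn : x < n) : W γ c a d h t Y x n = 0 := by
  unfold W; rw [if_neg]; rintro ⟨_, h2, _⟩; linarith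

lemma W_zero_of_le {γ c : ℝ} {a : ℤ} {d : ℕ} {h t Y x : ℝ} {n : ℕ} (hn : (n:ℝ) ≤ Y) : W γ c a d h t Y x n = 0 := by
  unfold W; rw [if_neg]; rintro ⟨h2, _, _⟩; linarith

lemma modEq_of_dvd {d m k k' : ℕ} {a : ℤ} (hmd : Nat.Coprime m d) (h1 : (d:ℤ) ∣ ((m * k : ℕ) : ℤ) - a)
    (h2 : (d:ℤ) ∣ ((m * k' : ℕ) : ℤ) - a) : k' ≡ k [MOD d] := by
  have h3 : (d:ℤ) ∣ ((m * k : ℕ) : ℤ) - ((m * k' : ℕ) : ℤ) := by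
    have := dvd_sub h1 h2; simpa using this
  have h4 : m * k' ≡ m * k [MOD d] := (Nat.modEq_iff_dvd).2 h3
  exact Nat.ModEq.cancel_left_of_coprime (by rw [Nat.gcd_comm]; exact hmd) h4

lemma dvd_of_modEq {d m k k' : ℕ} {a : ℤ} (h1 : (d:ℤ) ∣ ((m * k : ℕ) : ℤ) - a)
    (h2 : k' ≡ k [MOD d]) : (d:ℤ) ∣ ((m * k' : ℕ) : ℤ) - a := by
  have h3 := (Nat.modEq_iff_dvd).1 (h2.mul_left m)
  have := dvd_sub h1 h3; simpa using this

lemma coprime_of_dvd {d m k : ℕ} {a : ℤ} (hda : Int.gcd (d:ℤ) a = 1)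
    (h1 : (d:ℤ) ∣ ((m * k : ℕ) : ℤ) - a) : Nat.Coprime m d := by
  have h2 : ((Nat.gcd m d : ℕ) : ℤ) ∣ a := by
    have h3 : ((Nat.gcd m d : ℕ) : ℤ) ∣ ((m * k : ℕ) : ℤ) := by
      exact_mod_cast (Nat.gcd_dvd_left m d).mul_right k
    have h4 : ((Nat.gcd m d : ℕ) : ℤ) ∣ (d : ℤ) := by exact_mod_cast Nat.gcd_dvd_right m d
    have := dvd_sub h3 (h4.trans h1); simpa using this
  have h4 : ((Nat.gcd m d : ℕ) : ℤ) ∣ (d : ℤ) := by exact_mod_cast Nat.gcd_dvd_right m d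
  have h5 := Int.dvd_coe_gcd h4 h2
  rw [hda] at h5
  have : Nat.gcd m d ∣ 1 := by exact_mod_cast h5
  exact Nat.dvd_one.1 this

lemma typeI_block (γ c : ℝ) (hγ0 : 865/886 < γ) (hγ1 : γ < 1) (hc : 0 < c) :
    ∃ X₀ : ℝ, 2 ≤ X₀ ∧ ∀ X, X₀ ≤ X → ∀ (a : ℤ) (d : ℕ) (h t Y x : ℝ), Par γ c X d h t Y x →
      ∀ m K : ℕ, 1 ≤ m → (m:ℝ) ≤ X ^ (1/4:ℝ) → Nat.Coprime m d →
      ‖∑ k ∈ Ico K (2 * K), W γ c a d h t Y x (m * k)‖ ≤ X ^ (1 - (2 * (1 - γ) + 1/5000)) / (m * d) := by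
  obtain ⟨X₁, hX₁, h₁⟩ := base_bound γ c hγ0 hγ1 hc
  obtain ⟨X₂, hX₂, h₂⟩ := ev_const 2 (1/100000) (by norm_num)
  refine ⟨max X₁ X₂, hX₁.trans (le_max_left _ _), ?_⟩
  intro X hX a d h t Y x P m K hm hmX hmd
  have hb := h₁ X ((le_max_left _ _).trans hX)
  have g2 := h₂ X ((le_max_right _ _).trans hX)
  have hX1 : 1 ≤ X := by linarith [le_max_left X₁ X₂]
  have hX0 : 0 < X := by linarith
  have hd' : (0:ℝ) < d := by exact_mod_cast P.hd
  have hm' : (1:ℝ) ≤ m := by exact_mod_cast hm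
  classical
  set S := (Ico K (2*K)).filter (fun k => Y < ((m * k : ℕ):ℝ) ∧ ((m * k : ℕ):ℝ) ≤ x ∧ (d:ℤ) ∣ ((m * k : ℕ):ℤ) - a) with hS
  have e1 : ∑ k ∈ Ico K (2 * K), W γ c a d h t Y x (m * k) =
      ∑ k ∈ S, e ((h * (m:ℝ) ^ γ) * (k:ℝ) ^ γ + (t * (m:ℝ) ^ c) * (k:ℝ) ^ c) := by
    rw [hS, sum_filter]
    refine sum_congr rfl fun k _ => ?_
    unfold W
    split_ifs with hh
    · push_cast
      rw [Real.mul_rpow (by positivity) (by positivity), Real.mul_rpow (by positivity) (by positivity),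
        mul_assoc, mul_assoc]
    · rfl
  rw [e1]
  by_cases hne : S.Nonempty
  swap
  · rw [not_nonempty_iff_eq_empty] at hne
    rw [hne]; simp; positivity
  obtain ⟨k₀, hk₀⟩ := hne
  rw [hS, mem_filter, mem_Ico] at hk₀
  obtain ⟨⟨q1, q2⟩, q3, q4, q5⟩ := hk₀
  push_cast at q3 q4
  have q1' : (K:ℝ) ≤ k₀ := by exact_mod_cast q1
  have q2' : (k₀:ℝ) < 2 * K := by exact_mod_cast q2
  have hK0 : (0:ℝ) < K := by
    have : 0 < K := by omega
    exact_mod_cast this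
  have hmK : (m:ℝ) * K ≤ X := by nlinarith [P.hx]
  have hmKY : Y < 2 * (m * K) := by nlinarith
  have hhalf : X ^ (γ - 3/100000) ≤ m * K := by
    have : X ^ (1/100000:ℝ) * X ^ (γ - 3/100000) = Y := by
      rw [P.hY, ← Real.rpow_add hX0]; congr 1; ring
    have h3 : 0 < X ^ (γ - 3/100000) := by positivity
    nlinarith
  have hfin := hb (h * (m:ℝ) ^ γ) (t * (m:ℝ) ^ c) K d S P.hd ?_ ?_ ?_ ?_ ?_ ?_
  · refine hfin.trans ?_
    rw [sub_eq_add_neg 1 (2 * (1 - γ) + 1/5000), Real.rpow_add hX0 1, Real.rpow_one]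
    have : (K:ℝ) / d ≤ X / (m * d) := by
      rw [div_le_div_iff₀ hd' (by positivity)]; nlinarith
    calc _ ≤ X / (m * d) * X ^ (-(2 * (1 - γ) + 1/5000)) := by gcongr
      _ = _ := by ring
  · have h3 : X ^ (309/1000 + 755/100 * (1 - γ)) * d ≤
        X ^ (309/1000 + 755/100 * (1 - γ)) * X ^ (21/110 - 443/55 * (1 - γ)) := by
      have := P.hdX; gcongr
    refine h3.trans ?_
    rw [← Real.rpow_add hX0]
    have h4 : X ^ (γ - 3/100000 - 1/4) * X ^ (1/4:ℝ) = X ^ (γ - 3/100000) := by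
      rw [← Real.rpow_add hX0]; congr 1; ring
    have h5 : X ^ (γ - 3/100000 - 1/4) ≤ K := by
      have : X ^ (γ - 3/100000 - 1/4) * X ^ (1/4:ℝ) ≤ K * X ^ (1/4:ℝ) := by
        rw [h4]; nlinarith
      exact le_of_mul_le_mul_right this (by positivity)
    refine le_trans (Real.rpow_le_rpow_of_exponent_le hX1 ?_) h5
    linarith
  · rw [abs_mul, abs_of_nonneg (a := (m:ℝ) ^ γ) (by positivity), mul_assoc, ← Real.mul_rpow (by positivity) (by positivity)]
    calc X ^ (9/10:ℝ) ≤ X ^ ((γ - 3/100000) * γ) := Real.rpow_le_rpow_of_exponent_le hX1 (by nlinarith)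
      _ = (X ^ (γ - 3/100000)) ^ γ := Real.rpow_mul hX0.le _ _
      _ ≤ ((m:ℝ) * K) ^ γ := Real.rpow_le_rpow (by positivity) hhalf (by linarith)
      _ ≤ _ := le_mul_of_one_le_left (by positivity) P.h1
  · rw [abs_mul, abs_of_nonneg (a := (m:ℝ) ^ γ) (by positivity), mul_assoc, ← Real.mul_rpow (by positivity) (by positivity)]
    calc _ ≤ X ^ (2 * (1 - γ) + 4/100000) * X ^ γ :=
          mul_le_mul P.h2 (Real.rpow_le_rpow (by positivity) hmK (by linarith)) (by positivity) (by positivity)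
      _ = X ^ (2 * (1 - γ) + 4/100000 + γ) := by rw [← Real.rpow_add hX0]
      _ ≤ _ := Real.rpow_le_rpow_of_exponent_le hX1 (by linarith)
  · refine isAP_of d P.hd S ?_ ?_
    · intro k hk k' hk'
      rw [hS, mem_filter] at hk hk'
      exact modEq_of_dvd hmd hk.2.2.2 hk'.2.2.2
    · intro k hk k'' hk'' k' l1 l2 l3
      rw [hS, mem_filter, mem_Ico] at hk hk'' ⊢
      refine ⟨⟨by omega, by omega⟩, lt_of_lt_of_le hk.2.1 ?_, le_trans ?_ hk''.2.2.1, dvd_of_modEq hk.2.2.2 l3⟩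
      · exact_mod_cast Nat.mul_le_mul_left m l1
      · exact_mod_cast Nat.mul_le_mul_left m l2
  · intro k hk
    rw [hS, mem_filter, mem_Ico] at hk
    exact ⟨by exact_mod_cast hk.1.1, by exact_mod_cast hk.1.2.le⟩
  · rw [abs_mul, abs_of_nonneg (a := (m:ℝ) ^ c) (by positivity), mul_assoc, ← Real.mul_rpow (by positivity) (by positivity)]
    calc _ ≤ X ^ (1/4 - c) * X ^ c :=
          mul_le_mul P.ht (Real.rpow_le_rpow (by positivity) hmK (by linarith)) (by positivity) (by positivity)
      _ = X ^ (1/4 - c + c) := by rw [← Real.rpow_add hX0]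
      _ ≤ _ := Real.rpow_le_rpow_of_exponent_le hX1 (by linarith)

/-! dyadic decomposition -/

lemma dyadic_sum (f : ℕ → ℂ) (J : ℕ) : ∑ k ∈ Ico 1 (2 ^ J), f k = ∑ j ∈ range J, ∑ k ∈ Ico (2 ^ j) (2 * 2 ^ j), f k := by
  induction J with
  | zero => simp
  | succ J ih =>
    rw [sum_range_succ, ← ih, sum_Ico_consecutive _ Nat.one_le_two_pow (by omega)]
    congr 2; ring

lemma dyadic_bound (X B : ℝ) (hX : 1 ≤ X) (f : ℕ → ℂ) (hf : ∀ k : ℕ, X < k → f k = 0)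
    (hB : ∀ j : ℕ, ‖∑ k ∈ Ico (2 ^ j) (2 * 2 ^ j), f k‖ ≤ B) (N : ℕ) (hN : ⌊X⌋₊ ≤ N) :
    ‖∑ k ∈ Icc 1 N, f k‖ ≤ 2 * (1 + Real.log X) * B := by
  have hB0 : 0 ≤ B := (norm_nonneg _).trans (hB 0)
  have hfl : ⌊X⌋₊ ≠ 0 := (Nat.floor_pos.2 hX).ne'
  have e1 : ∑ k ∈ Icc 1 N, f k = ∑ k ∈ Icc 1 ⌊X⌋₊, f k := by
    symm
    refine sum_subset (Icc_subset_Icc_right hN) ?_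
    intro k hk hk'
    rw [mem_Icc] at hk hk'
    exact hf k ((Nat.floor_lt (by linarith)).1 (by omega))
  set J := Nat.log 2 ⌊X⌋₊ + 1 with hJ
  have hlt : ⌊X⌋₊ < 2 ^ J := Nat.lt_pow_succ_log_self (by norm_num) _
  have e2 : ∑ k ∈ Ico 1 (2 ^ J), f k = ∑ k ∈ Icc 1 ⌊X⌋₊, f k := by
    symm
    refine sum_subset ?_ ?_
    · intro k hk; rw [mem_Icc] at hk; rw [mem_Ico]; omega
    · intro k hk hk'
      rw [mem_Ico] at hk; rw [mem_Icc] at hk'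
      exact hf k ((Nat.floor_lt (by linarith)).1 (by omega))
  rw [e1, ← e2, dyadic_sum]
  refine (norm_sum_le _ _).trans ?_
  refine (sum_le_sum fun j _ => hB j).trans ?_
  rw [sum_const, card_range, nsmul_eq_mul]
  refine mul_le_mul_of_nonneg_right ?_ hB0
  have h1 : (2:ℝ) ^ (Nat.log 2 ⌊X⌋₊) ≤ X := by
    have : 2 ^ (Nat.log 2 ⌊X⌋₊) ≤ ⌊X⌋₊ := Nat.pow_log_le_self 2 hfl
    calc (2:ℝ) ^ (Nat.log 2 ⌊X⌋₊) ≤ (⌊X⌋₊ : ℝ) := by exact_mod_cast this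
      _ ≤ X := Nat.floor_le (by linarith)
  have h2 := Real.log_le_log (by positivity) h1
  rw [Real.log_pow] at h2
  rw [hJ]; push_cast
  have := Real.log_two_gt_d9
  have hn : (0:ℝ) ≤ (Nat.log 2 ⌊X⌋₊ : ℝ) := by positivity
  nlinarith

lemma typeI (γ c : ℝ) (hγ0 : 865/886 < γ) (hγ1 : γ < 1) (hc : 0 < c) :
    ∃ X₀ : ℝ, 2 ≤ X₀ ∧ ∀ X, X₀ ≤ X → ∀ (a : ℤ) (d : ℕ) (h t Y x : ℝ), Par γ c X d h t Y x →
      ∀ m N : ℕ, 1 ≤ m → (m:ℝ) ≤ X ^ (1/4:ℝ) → Nat.Coprime m d →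
      ‖∑ k ∈ Icc 1 N, W γ c a d h t Y x (m * k)‖ ≤
        2 * (1 + Real.log X) * (X ^ (1 - (2 * (1 - γ) + 1/5000)) / (m * d)) := by
  obtain ⟨X₁, hX₁, h₁⟩ := typeI_block γ c hγ0 hγ1 hc
  refine ⟨X₁, hX₁, ?_⟩
  intro X hX a d h t Y x P m N hm hmX hmd
  have hX1 : 1 ≤ X := by linarith
  have hm' : (1:ℝ) ≤ m := by exact_mod_cast hm
  have P' : Par γ c X d h t Y (min x (m * N)) := ⟨P.hd, P.hdX, P.h1, P.h2, P.ht, P.hY, (min_le_left _ _).trans P.hx⟩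
  have e1 : ∑ k ∈ Icc 1 N, W γ c a d h t Y x (m * k) =
      ∑ k ∈ Icc 1 (max N ⌊X⌋₊), W γ c a d h t Y (min x (m * N)) (m * k) := by
    rw [← sum_subset (Icc_subset_Icc_right (le_max_left N ⌊X⌋₊))]
    · refine sum_congr rfl fun k hk => ?_
      rw [mem_Icc] at hk
      unfold W
      congr 1
      have : ((m * k : ℕ):ℝ) ≤ m * N := by exact_mod_cast Nat.mul_le_mul_left m hk.2
      rw [le_min_iff, and_iff_left this]
    · intro k hk hk'
      rw [mem_Icc] at hk hk'
      refine W_zero_of_lt (lt_of_le_of_lt (min_le_right _ _) ?_)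
      have : N < k := by omega
      exact_mod_cast Nat.mul_lt_mul_of_pos_left this (by omega)
  rw [e1]
  refine dyadic_bound X _ hX1 _ ?_ ?_ _ (le_max_right _ _)
  · intro k hk
    refine W_zero_of_lt (lt_of_le_of_lt ((min_le_left _ _).trans P.hx) ?_)
    push_cast; nlinarith
  · intro j
    exact h₁ X hX a d h t Y _ P' m (2 ^ j) hm hmX hmd

end BVP

namespace BVP
open Finset

lemma cauchy_bilin (S T : Finset ℕ) (α β : ℕ → ℂ) (w : ℕ → ℕ → ℂ) (B : ℝ) (hB : 0 ≤ B)
    (hα : ∀ m ∈ S, ‖α m‖ ≤ B) (hβ : ∀ n ∈ T, ‖β n‖ ≤ B) :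
    ‖∑ m ∈ S, ∑ n ∈ T, α m * β n * w m n‖ ^ 2 ≤
      B ^ 4 * #S * ∑ n₁ ∈ T, ∑ n₂ ∈ T, ‖∑ m ∈ S, w m n₁ * (starRingEnd ℂ) (w m n₂)‖ := by
  set u : ℕ → ℂ := fun m => ∑ n ∈ T, β n * w m n with hu
  have e1 : ∑ m ∈ S, ∑ n ∈ T, α m * β n * w m n = ∑ m ∈ S, α m * u m := by
    refine sum_congr rfl fun m _ => ?_
    rw [hu, mul_sum]; refine sum_congr rfl fun n _ => by ring
  have h1 : ‖∑ m ∈ S, α m * u m‖ ≤ B * ∑ m ∈ S, ‖u m‖ := by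
    refine (norm_sum_le _ _).trans ?_
    rw [mul_sum]
    refine sum_le_sum fun m hm => ?_
    rw [norm_mul]
    exact mul_le_mul_of_nonneg_right (hα m hm) (norm_nonneg _)
  have h2 : (∑ m ∈ S, ‖u m‖) ^ 2 ≤ #S * ∑ m ∈ S, ‖u m‖ ^ 2 := sq_sum_le_card_mul_sum_sq
  have h3 : ∑ m ∈ S, ‖u m‖ ^ 2 ≤ B ^ 2 * ∑ n₁ ∈ T, ∑ n₂ ∈ T, ‖∑ m ∈ S, w m n₁ * (starRingEnd ℂ) (w m n₂)‖ := by
    have e2 : ((∑ m ∈ S, ‖u m‖ ^ 2 : ℝ) : ℂ) = ∑ n₁ ∈ T, ∑ n₂ ∈ T,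
        (β n₁ * (starRingEnd ℂ) (β n₂)) * ∑ m ∈ S, w m n₁ * (starRingEnd ℂ) (w m n₂) := by
      push_cast
      have : ∀ m, ((‖u m‖ : ℂ)) ^ 2 = ∑ n₁ ∈ T, ∑ n₂ ∈ T,
          (β n₁ * (starRingEnd ℂ) (β n₂)) * (w m n₁ * (starRingEnd ℂ) (w m n₂)) := by
        intro m
        rw [← Complex.mul_conj', hu]
        simp only [map_sum, map_mul]
        rw [sum_mul_sum]
        refine sum_congr rfl fun n₁ _ => sum_congr rfl fun n₂ _ => by ring
      simp_rw [this, mul_sum]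
      rw [sum_comm]
      refine sum_congr rfl fun n₁ _ => ?_
      rw [sum_comm]
    have h0 : 0 ≤ ∑ m ∈ S, ‖u m‖ ^ 2 := sum_nonneg fun m _ => by positivity
    rw [← abs_of_nonneg h0, ← Real.norm_eq_abs, ← Complex.norm_real, e2]
    refine (norm_sum_le _ _).trans ?_
    rw [mul_sum]
    refine sum_le_sum fun n₁ hn₁ => ?_
    refine (norm_sum_le _ _).trans ?_
    rw [mul_sum]
    refine sum_le_sum fun n₂ hn₂ => ?_
    rw [norm_mul, norm_mul, Complex.norm_conj, pow_two]
    exact mul_le_mul_of_nonneg_right (mul_le_mul (hβ _ hn₁) (hβ _ hn₂) (norm_nonneg _) hB) (norm_nonneg _)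
  rw [e1]
  calc ‖∑ m ∈ S, α m * u m‖ ^ 2 ≤ (B * ∑ m ∈ S, ‖u m‖) ^ 2 := by gcongr
    _ = B ^ 2 * (∑ m ∈ S, ‖u m‖) ^ 2 := by ring
    _ ≤ B ^ 2 * (#S * (B ^ 2 * ∑ n₁ ∈ T, ∑ n₂ ∈ T, ‖∑ m ∈ S, w m n₁ * (starRingEnd ℂ) (w m n₂)‖)) := by
        gcongr
        exact h2.trans (by gcongr)
    _ = _ := by ring

lemma rpow_diff_lower (γ u v : ℝ) (hγ0 : 1/2 ≤ γ) (hγ1 : γ ≤ 1) (hu : 0 < u) (huv : u ≤ v) :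
    v ^ γ * ((v - u) / v) / 2 ≤ v ^ γ - u ^ γ := by
  have hv : 0 < v := by linarith
  have h1 := rpow_one_add_le_one_add_mul_self (s := u / v - 1) (by
    have : 0 ≤ u / v := by positivity
    linarith) (by linarith : 0 ≤ γ) hγ1
  have e1 : 1 + (u / v - 1) = u / v := by ring
  rw [e1, Real.div_rpow hu.le hv.le, div_le_iff₀ (by positivity)] at h1
  have h2 : 0 ≤ (v - u) / v := div_nonneg (by linarith) hv.le
  have e3 : u / v - 1 = - ((v - u) / v) := by field_simp; ring
  rw [e3] at h1
  have hvg : 0 < v ^ γ := by positivity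
  nlinarith [mul_nonneg hvg.le h2, mul_nonneg (mul_nonneg hvg.le h2) (by linarith : 0 ≤ γ - 1/2)]

lemma rpow_diff_lower_abs (γ u v N z : ℝ) (hγ0 : 1/2 ≤ γ) (hγ1 : γ ≤ 1) (hN : 0 < N) (hu : N ≤ u) (hv : N ≤ v)
    (hu2 : u ≤ 2 * N) (hv2 : v ≤ 2 * N) (hz : 0 ≤ z) (huv : N * z ≤ |u - v|) :
    N ^ γ * z / 4 ≤ |u ^ γ - v ^ γ| := by
  wlog h : u ≤ v generalizing u v with H
  · rw [abs_sub_comm]; rw [abs_sub_comm] at huv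
    exact H v u hv hu hv2 hu2 huv (by linarith)
  rw [abs_sub_comm, abs_of_nonneg (by linarith)] at huv
  rw [abs_sub_comm]
  refine le_trans ?_ (le_abs_self _)
  refine le_trans ?_ (rpow_diff_lower γ u v hγ0 hγ1 (by linarith) h)
  have h1 : N ^ γ ≤ v ^ γ := Real.rpow_le_rpow hN.le hv (by linarith)
  have h2 : z / 2 ≤ (v - u) / v := by
    rw [div_le_div_iff₀ (by norm_num) (by linarith)]; nlinarith
  have hv0 : 0 < v := by linarith
  have : N ^ γ * (z / 2) ≤ v ^ γ * ((v - u) / v) :=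
    mul_le_mul h1 h2 (by positivity) (by positivity)
  linarith

lemma abs_sub_le_max' {u v b : ℝ} (hu : 0 ≤ u) (hv : 0 ≤ v) (hu2 : u ≤ b) (hv2 : v ≤ b) : |u - v| ≤ b := by
  rw [abs_le]; constructor <;> linarith

end BVP

namespace BVP
open Finset

open Classical in
/-- the set of common `m` -/
noncomputable def PS (a : ℤ) (d : ℕ) (Y x : ℝ) (M n₁ n₂ : ℕ) : Finset ℕ :=
  (Ico M (2*M)).filter (fun m => (Y < ((m * n₁ : ℕ):ℝ) ∧ ((m * n₁ : ℕ):ℝ) ≤ x ∧ (d:ℤ) ∣ ((m * n₁ : ℕ):ℤ) - a) ∧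
    (Y < ((m * n₂ : ℕ):ℝ) ∧ ((m * n₂ : ℕ):ℝ) ≤ x ∧ (d:ℤ) ∣ ((m * n₂ : ℕ):ℤ) - a))

lemma mem_PS {a : ℤ} {d : ℕ} {Y x : ℝ} {M n₁ n₂ m : ℕ} : m ∈ PS a d Y x M n₁ n₂ ↔
    (M ≤ m ∧ m < 2 * M) ∧ (Y < ((m * n₁ : ℕ):ℝ) ∧ ((m * n₁ : ℕ):ℝ) ≤ x ∧ (d:ℤ) ∣ ((m * n₁ : ℕ):ℤ) - a) ∧
    (Y < ((m * n₂ : ℕ):ℝ) ∧ ((m * n₂ : ℕ):ℝ) ≤ x ∧ (d:ℤ) ∣ ((m * n₂ : ℕ):ℤ) - a) := by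
  unfold PS; rw [mem_filter, mem_Ico]

lemma isAP_PS (a : ℤ) (d : ℕ) (hd : 0 < d) (hda : Int.gcd (d:ℤ) a = 1) (Y x : ℝ) (M n₁ n₂ : ℕ) :
    IsAP d (PS a d Y x M n₁ n₂) := by
  refine isAP_of d hd _ ?_ ?_
  · intro m hm m' hm'
    rw [mem_PS] at hm hm'
    have h1 := hm.2.1.2.2
    have h2 := hm'.2.1.2.2
    rw [mul_comm] at h1 h2
    exact modEq_of_dvd (coprime_of_dvd hda h1) h1 h2
  · intro m hm m'' hm'' m' l1 l2 l3
    rw [mem_PS] at hm hm'' ⊢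
    have h1 := hm.2.1.2.2
    have h2 := hm.2.2.2.2
    rw [mul_comm] at h1 h2
    have h3 := dvd_of_modEq h1 l3
    have h4 := dvd_of_modEq h2 l3
    rw [mul_comm] at h3 h4
    refine ⟨⟨by omega, by omega⟩, ⟨lt_of_lt_of_le hm.2.1.1 ?_, le_trans ?_ hm''.2.1.2.1, h3⟩,
      ⟨lt_of_lt_of_le hm.2.2.1 ?_, le_trans ?_ hm''.2.2.2.1, h4⟩⟩
    · exact_mod_cast Nat.mul_le_mul_right n₁ l1
    · exact_mod_cast Nat.mul_le_mul_right n₁ l2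
    · exact_mod_cast Nat.mul_le_mul_right n₂ l1
    · exact_mod_cast Nat.mul_le_mul_right n₂ l2

lemma PS_empty (a : ℤ) (d : ℕ) (hda : Int.gcd (d:ℤ) a = 1) (Y x : ℝ) (M n₁ n₂ : ℕ)
    (h : ¬ n₂ ≡ n₁ [MOD d]) : PS a d Y x M n₁ n₂ = ∅ := by
  rw [eq_empty_iff_forall_notMem]
  intro m hm
  rw [mem_PS] at hm
  exact h (modEq_of_dvd (coprime_of_dvd hda hm.2.1.2.2) hm.2.1.2.2 hm.2.2.2.2)

lemma W_mul_conj (γ c : ℝ) (a : ℤ) (d : ℕ) (h t Y x : ℝ) (M n₁ n₂ : ℕ) :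
    ∑ m ∈ Ico M (2*M), W γ c a d h t Y x (m * n₁) * (starRingEnd ℂ) (W γ c a d h t Y x (m * n₂)) =
    ∑ m ∈ PS a d Y x M n₁ n₂, e ((h * ((n₁:ℝ) ^ γ - (n₂:ℝ) ^ γ)) * (m:ℝ) ^ γ +
      (t * ((n₁:ℝ) ^ c - (n₂:ℝ) ^ c)) * (m:ℝ) ^ c) := by
  unfold PS
  rw [sum_filter]
  refine sum_congr rfl fun m _ => ?_
  unfold W
  by_cases h1 : Y < ((m * n₁ : ℕ):ℝ) ∧ ((m * n₁ : ℕ):ℝ) ≤ x ∧ (d:ℤ) ∣ ((m * n₁ : ℕ):ℤ) - a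
  · by_cases h2 : Y < ((m * n₂ : ℕ):ℝ) ∧ ((m * n₂ : ℕ):ℝ) ≤ x ∧ (d:ℤ) ∣ ((m * n₂ : ℕ):ℤ) - a
    · rw [if_pos h1, if_pos h2, if_pos ⟨h1, h2⟩, ← e_sub]
      congr 1
      push_cast
      rw [Real.mul_rpow (by positivity) (by positivity), Real.mul_rpow (by positivity) (by positivity),
        Real.mul_rpow (by positivity) (by positivity), Real.mul_rpow (by positivity) (by positivity)]
      ring
    · rw [if_neg h2, map_zero, mul_zero, eq_comm]
      exact if_neg (fun h => h2 h.2)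
  · rw [if_neg h1, zero_mul, eq_comm]
    exact if_neg (fun h => h1 h.1)

lemma pair_far (γ c : ℝ) (hγ0 : 865/886 < γ) (hγ1 : γ < 1) (hc : 0 < c) :
    ∃ X₀ : ℝ, 2 ≤ X₀ ∧ ∀ X, X₀ ≤ X → ∀ (a : ℤ) (d : ℕ) (h t Y x : ℝ), Par γ c X d h t Y x →
      Int.gcd (d:ℤ) a = 1 → ∀ M N n₁ n₂ : ℕ, N ≤ M → N ≤ n₁ → n₁ < 2 * N → N ≤ n₂ → n₂ < 2 * N →
      (N:ℝ) * X ^ (-(2 * (1 - γ) + 1/5000)) ≤ |(n₁:ℝ) - n₂| →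
      ‖∑ m ∈ PS a d Y x M n₁ n₂, e ((h * ((n₁:ℝ) ^ γ - (n₂:ℝ) ^ γ)) * (m:ℝ) ^ γ +
        (t * ((n₁:ℝ) ^ c - (n₂:ℝ) ^ c)) * (m:ℝ) ^ c)‖ ≤ M / d * X ^ (-(2 * (1 - γ) + 1/5000)) := by
  obtain ⟨X₁, hX₁, h₁⟩ := base_bound γ c hγ0 hγ1 hc
  obtain ⟨X₂, hX₂, h₂⟩ := ev_const 16 (1/100000) (by norm_num)
  obtain ⟨X₃, hX₃, h₃⟩ := ev_const (2 ^ c) (1/20) (by norm_num)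
  refine ⟨max X₁ (max X₂ X₃), hX₁.trans (le_max_left _ _), ?_⟩
  intro X hX a d h t Y x P hda M N n₁ n₂ hNM l1 l2 l3 l4 hfar
  have hb := h₁ X ((le_max_left _ _).trans hX)
  have g2 := h₂ X (((le_max_left _ _).trans (le_max_right _ _)).trans hX)
  have g3 := h₃ X (((le_max_right _ _).trans (le_max_right _ _)).trans hX)
  have hX1 : 1 ≤ X := by linarith [le_max_left X₁ (max X₂ X₃)]
  have hX0 : 0 < X := by linarith
  have hd' : (0:ℝ) < d := by exact_mod_cast P.hd
  by_cases hne : (PS a d Y x M n₁ n₂).Nonempty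
  swap
  · rw [not_nonempty_iff_eq_empty] at hne
    rw [hne]; simp; positivity
  obtain ⟨m₀, hm₀⟩ := hne
  rw [mem_PS] at hm₀
  obtain ⟨⟨q1, q2⟩, ⟨q3, q4, q5⟩, _⟩ := hm₀
  push_cast at q3 q4
  have q1' : (M:ℝ) ≤ m₀ := by exact_mod_cast q1
  have q2' : (m₀:ℝ) < 2 * M := by exact_mod_cast q2
  have l1' : (N:ℝ) ≤ n₁ := by exact_mod_cast l1
  have l2' : (n₁:ℝ) < 2 * N := by exact_mod_cast l2
  have l3' : (N:ℝ) ≤ n₂ := by exact_mod_cast l3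
  have l4' : (n₂:ℝ) < 2 * N := by exact_mod_cast l4
  have hN0 : (0:ℝ) < N := by
    have : 0 < N := by omega
    exact_mod_cast this
  have hNM' : (N:ℝ) ≤ M := by exact_mod_cast hNM
  have hM0 : (0:ℝ) < M := by linarith
  have hMN : (M:ℝ) * N ≤ X := by
    have : (M:ℝ) * N ≤ m₀ * n₁ := by gcongr
    linarith [P.hx]
  have hMNY : Y < 4 * (M * N) := by
    have : (m₀:ℝ) * n₁ ≤ (2 * M) * (2 * N) := by gcongr
    linarith
  have hMN1 : X ^ (γ - 3/100000) ≤ M * N := by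
    have : X ^ (1/100000:ℝ) * X ^ (γ - 3/100000) = Y := by
      rw [P.hY, ← Real.rpow_add hX0]; congr 1; ring
    have h3 : 0 < X ^ (γ - 3/100000) := by positivity
    nlinarith
  have hM1 : X ^ ((γ - 3/100000) / 2) ≤ M := by
    refine (pow_le_pow_iff_left₀ (by positivity) hM0.le two_ne_zero).1 ?_
    rw [← Real.rpow_natCast, ← Real.rpow_mul hX0.le]
    calc _ = X ^ (γ - 3/100000) := by congr 1; push_cast; ring
      _ ≤ M * N := hMN1
      _ ≤ (M:ℝ) ^ 2 := by nlinarith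
  set z := X ^ (-(2 * (1 - γ) + 1/5000)) with hz
  have hz0 : 0 < z := by positivity
  refine hb _ _ M d _ P.hd ?_ ?_ ?_ (isAP_PS a d P.hd hda Y x M n₁ n₂) ?_ ?_
  · have h3 : X ^ (309/1000 + 755/100 * (1 - γ)) * d ≤
        X ^ (309/1000 + 755/100 * (1 - γ)) * X ^ (21/110 - 443/55 * (1 - γ)) := by
      have := P.hdX; gcongr
    refine h3.trans ?_
    rw [← Real.rpow_add hX0]
    refine le_trans (Real.rpow_le_rpow_of_exponent_le hX1 ?_) hM1
    linarith
  · rw [abs_mul]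
    have r1 := rpow_diff_lower_abs γ n₁ n₂ N z (by linarith) hγ1.le hN0 l1' l3' l2'.le l4'.le hz0.le hfar
    have r2 : X ^ ((γ - 3/100000) * γ) ≤ (M * N:ℝ) ^ γ := by
      rw [Real.rpow_mul hX0.le]; exact Real.rpow_le_rpow (by positivity) hMN1 (by linarith)
    calc X ^ (9/10:ℝ) ≤ X ^ ((γ - 3/100000) * γ + -(2 * (1 - γ) + 1/5000) - 1/100000) :=
          Real.rpow_le_rpow_of_exponent_le hX1 (by nlinarith)
      _ = X ^ ((γ - 3/100000) * γ) * z * (X ^ (1/100000:ℝ))⁻¹ := by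
          rw [sub_eq_add_neg _ (1/100000:ℝ), Real.rpow_add hX0 _ (-(1/100000)), Real.rpow_add hX0 ((γ - 3/100000) * γ),
            Real.rpow_neg hX0.le (1/100000)]
      _ ≤ (M * N:ℝ) ^ γ * z * (4:ℝ)⁻¹ := by
          have : (X ^ (1/100000:ℝ))⁻¹ ≤ (4:ℝ)⁻¹ := inv_anti₀ (by norm_num) (by linarith)
          gcongr
      _ = 1 * (N ^ γ * z / 4) * M ^ γ := by rw [Real.mul_rpow hM0.le hN0.le]; ring
      _ ≤ _ := by
          have := P.h1
          gcongr
  · rw [abs_mul]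
    have r1 : |(n₁:ℝ) ^ γ - (n₂:ℝ) ^ γ| ≤ (2 * N:ℝ) ^ γ :=
      abs_sub_le_max' (by positivity) (by positivity) (Real.rpow_le_rpow (by positivity) l2'.le (by linarith))
        (Real.rpow_le_rpow (by positivity) l4'.le (by linarith))
    have r2 : (2:ℝ) ^ γ ≤ 2 := by
      calc (2:ℝ) ^ γ ≤ 2 ^ (1:ℝ) := Real.rpow_le_rpow_of_exponent_le (by norm_num) hγ1.le
        _ = 2 := Real.rpow_one _
    calc _ ≤ X ^ (2 * (1 - γ) + 4/100000) * (2 * N:ℝ) ^ γ * M ^ γ := by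
          have := P.h2; gcongr
      _ = X ^ (2 * (1 - γ) + 4/100000) * (2 ^ γ * (M * N) ^ γ) := by
          rw [Real.mul_rpow (by norm_num) hN0.le, Real.mul_rpow hM0.le hN0.le]; ring
      _ ≤ X ^ (2 * (1 - γ) + 4/100000) * (X ^ (1/100000:ℝ) * X ^ γ) := by
          have r3 : (M * N:ℝ) ^ γ ≤ X ^ γ := Real.rpow_le_rpow (by positivity) hMN (by linarith)
          have r4 : (2:ℝ) ^ γ ≤ X ^ (1/100000:ℝ) := by linarith
          gcongr
      _ = _ := by
          rw [← Real.rpow_add hX0, ← Real.rpow_add hX0]; congr 1; ring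
  · intro m hm
    rw [mem_PS] at hm
    exact ⟨by exact_mod_cast hm.1.1, by exact_mod_cast hm.1.2.le⟩
  · rw [abs_mul]
    have r1 : |(n₁:ℝ) ^ c - (n₂:ℝ) ^ c| ≤ (2 * N:ℝ) ^ c :=
      abs_sub_le_max' (by positivity) (by positivity) (Real.rpow_le_rpow (by positivity) l2'.le (by linarith))
        (Real.rpow_le_rpow (by positivity) l4'.le (by linarith))
    calc _ ≤ X ^ (1/4 - c) * (2 * N:ℝ) ^ c * M ^ c := by
          have := P.ht; gcongr
      _ = X ^ (1/4 - c) * (2 ^ c * (M * N) ^ c) := by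
          rw [Real.mul_rpow (by norm_num) hN0.le, Real.mul_rpow hM0.le hN0.le]; ring
      _ ≤ X ^ (1/4 - c) * (X ^ (1/20:ℝ) * X ^ c) := by
          have r3 : (M * N:ℝ) ^ c ≤ X ^ c := Real.rpow_le_rpow (by positivity) hMN (by linarith)
          gcongr
      _ = _ := by
          rw [← Real.rpow_add hX0, ← Real.rpow_add hX0]; congr 1; ring

end BVP

namespace BVP
open Finset

lemma card_cong (d : ℕ) (hd : 0 < d) (S : Finset ℕ) (h1 : ∀ m ∈ S, ∀ m' ∈ S, m' ≡ m [MOD d]) (b L : ℝ)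
    (hL : (d:ℝ) ≤ L) (hS : ∀ m ∈ S, b ≤ (m:ℝ) ∧ (m:ℝ) ≤ b + L) : (#S : ℝ) ≤ 2 * (L / d) := by
  have hd' : (0:ℝ) < d := by exact_mod_cast hd
  by_cases hne : S.Nonempty
  · set A := S.min' hne with hA
    set B := S.max' hne with hB
    have hAm : A ∈ S := min'_mem _ _
    have hBm : B ∈ S := max'_mem _ _
    have sub : S ⊆ (Icc A B).filter (fun m => m ≡ A [MOD d]) := by
      intro m hm
      rw [mem_filter, mem_Icc]
      exact ⟨⟨min'_le _ _ hm, le_max' _ _ hm⟩, h1 _ hAm _ hm⟩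
    have hap : IsAP d ((Icc A B).filter (fun m => m ≡ A [MOD d])) := by
      refine isAP_filter d hd _ _ _ ?_
      intro m m' _ _ _ _ hm
      exact ⟨fun h => h.trans hm.symm, fun h => h.trans hm⟩
    have h2 := isAP_card d hd L _ hap hL b (by
      intro m hm
      rw [mem_filter, mem_Icc] at hm
      have a1 : (A:ℝ) ≤ m := by exact_mod_cast hm.1.1
      have a2 : (m:ℝ) ≤ B := by exact_mod_cast hm.1.2
      exact ⟨by linarith [(hS A hAm).1], by linarith [(hS B hBm).2]⟩)
    refine le_trans ?_ h2
    exact_mod_cast card_le_card sub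
  · rw [not_nonempty_iff_eq_empty] at hne
    rw [hne, card_empty]; have : 0 < L := by linarith
    push_cast; positivity

lemma typeII_row (γ c : ℝ) (hγ0 : 865/886 < γ) (hγ1 : γ < 1) (hc : 0 < c) :
    ∃ X₀ : ℝ, 2 ≤ X₀ ∧ ∀ X, X₀ ≤ X → ∀ (a : ℤ) (d : ℕ) (h t Y x : ℝ), Par γ c X d h t Y x →
      Int.gcd (d:ℤ) a = 1 → ∀ M N n₁ : ℕ, N ≤ M → X ^ (1/4:ℝ) ≤ 2 * N → n₁ ∈ Ico N (2 * N) →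
      ∑ n₂ ∈ Ico N (2 * N), ‖∑ m ∈ Ico M (2*M), W γ c a d h t Y x (m * n₁) * (starRingEnd ℂ) (W γ c a d h t Y x (m * n₂))‖
        ≤ 10 * (M * N / d ^ 2) * X ^ (-(2 * (1 - γ) + 1/5000)) := by
  obtain ⟨X₁, hX₁, h₁⟩ := pair_far γ c hγ0 hγ1 hc
  obtain ⟨X₂, hX₂, h₂⟩ := ev_const 2 (1/100000) (by norm_num)
  refine ⟨max X₁ X₂, hX₁.trans (le_max_left _ _), ?_⟩
  intro X hX a d h t Y x P hda M N n₁ hNM hNX hn₁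
  have hb := h₁ X ((le_max_left _ _).trans hX) a d h t Y x P hda M N n₁
  have g2 := h₂ X ((le_max_right _ _).trans hX)
  have hX1 : 1 ≤ X := by linarith [le_max_left X₁ X₂]
  have hX0 : 0 < X := by linarith
  have hd' : (0:ℝ) < d := by exact_mod_cast P.hd
  simp_rw [W_mul_conj]
  set z := X ^ (-(2 * (1 - γ) + 1/5000)) with hz
  have hz0 : 0 < z := by positivity
  have hz1 : z ≤ 1 := Real.rpow_le_one_of_one_le_of_nonpos hX1 (by linarith)
  have hdz : (d:ℝ) ≤ N * z := by
    have hN2 : X ^ (1/4 - 1/100000 : ℝ) ≤ N := by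
      have : X ^ (1/100000:ℝ) * X ^ (1/4 - 1/100000 : ℝ) = X ^ (1/4:ℝ) := by
        rw [← Real.rpow_add hX0]; congr 1; ring
      have h3 : 0 < X ^ (1/4 - 1/100000 : ℝ) := by positivity
      nlinarith
    calc (d:ℝ) ≤ _ := P.hdX
      _ ≤ X ^ (1/4 - 1/100000 + -(2 * (1 - γ) + 1/5000)) := Real.rpow_le_rpow_of_exponent_le hX1 (by linarith)
      _ = X ^ (1/4 - 1/100000 : ℝ) * z := by rw [Real.rpow_add hX0]
      _ ≤ N * z := by gcongr
  have hN0 : (0:ℝ) ≤ N := by positivity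
  have hNM' : (N:ℝ) ≤ M := by exact_mod_cast hNM
  have hdN : (d:ℝ) ≤ N := hdz.trans (mul_le_of_le_one_right hN0 hz1)
  have hdM : (d:ℝ) ≤ M := by linarith
  classical
  set T := (Ico N (2*N)).filter (fun n₂ => n₂ ≡ n₁ [MOD d]) with hT
  have hres : ∀ n₂ ∈ T, N ≤ n₂ ∧ n₂ < 2 * N ∧ n₂ ≡ n₁ [MOD d] := by
    intro n₂ hn; rw [hT, mem_filter, mem_Ico] at hn; exact ⟨hn.1.1, hn.1.2, hn.2⟩
  have e1 : ∑ n₂ ∈ Ico N (2 * N), ‖∑ m ∈ PS a d Y x M n₁ n₂, e ((h * ((n₁:ℝ) ^ γ - (n₂:ℝ) ^ γ)) * (m:ℝ) ^ γ +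
        (t * ((n₁:ℝ) ^ c - (n₂:ℝ) ^ c)) * (m:ℝ) ^ c)‖ =
      ∑ n₂ ∈ T, ‖∑ m ∈ PS a d Y x M n₁ n₂, e ((h * ((n₁:ℝ) ^ γ - (n₂:ℝ) ^ γ)) * (m:ℝ) ^ γ +
        (t * ((n₁:ℝ) ^ c - (n₂:ℝ) ^ c)) * (m:ℝ) ^ c)‖ := by
    symm
    refine sum_subset (filter_subset _ _) ?_
    intro n₂ hn hn'
    rw [PS_empty a d hda]
    · simp
    · intro hcon; exact hn' (mem_filter.2 ⟨hn, hcon⟩)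
  rw [e1]
  rw [mem_Ico] at hn₁
  rw [← sum_filter_add_sum_filter_not T (fun n₂ : ℕ => |(n₁:ℝ) - n₂| < N * z)]
  have near : ∀ n₂ ∈ T.filter (fun n₂ : ℕ => |(n₁:ℝ) - n₂| < N * z), ‖∑ m ∈ PS a d Y x M n₁ n₂,
      e ((h * ((n₁:ℝ) ^ γ - (n₂:ℝ) ^ γ)) * (m:ℝ) ^ γ + (t * ((n₁:ℝ) ^ c - (n₂:ℝ) ^ c)) * (m:ℝ) ^ c)‖ ≤ 2 * (M / d) := by
    intro n₂ _
    refine (norm_sum_le _ _).trans ?_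
    simp_rw [norm_e]
    rw [sum_const, nsmul_eq_mul, mul_one]
    refine isAP_card d P.hd M _ (isAP_PS a d P.hd hda Y x M n₁ n₂) hdM M ?_
    intro m hm
    rw [mem_PS] at hm
    have k1 : (M:ℝ) ≤ m := by exact_mod_cast hm.1.1
    have k2 : (m:ℝ) < 2 * M := by exact_mod_cast hm.1.2
    exact ⟨k1, by linarith⟩
  have far : ∀ n₂ ∈ T.filter (fun n₂ : ℕ => ¬ |(n₁:ℝ) - n₂| < N * z), ‖∑ m ∈ PS a d Y x M n₁ n₂,
      e ((h * ((n₁:ℝ) ^ γ - (n₂:ℝ) ^ γ)) * (m:ℝ) ^ γ + (t * ((n₁:ℝ) ^ c - (n₂:ℝ) ^ c)) * (m:ℝ) ^ c)‖ ≤ M / d * z := by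
    intro n₂ hn
    rw [mem_filter] at hn
    have := hres n₂ hn.1
    exact hb n₂ hNM hn₁.1 hn₁.2 this.1 this.2.1 (not_lt.1 hn.2)
  have cn : (#(T.filter (fun n₂ : ℕ => |(n₁:ℝ) - n₂| < N * z)) : ℝ) ≤ 2 * ((2 * (N * z)) / d) := by
    refine card_cong d P.hd _ ?_ (n₁ - N * z) (2 * (N * z)) (by linarith) ?_
    · intro m hm m' hm'
      rw [mem_filter] at hm hm'
      exact (hres m' hm'.1).2.2.trans (hres m hm.1).2.2.symm
    · intro m hm
      rw [mem_filter, abs_lt] at hm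
      exact ⟨by linarith [hm.2.2], by linarith [hm.2.1]⟩
  have cf : (#(T.filter (fun n₂ : ℕ => ¬ |(n₁:ℝ) - n₂| < N * z)) : ℝ) ≤ 2 * (N / d) := by
    refine card_cong d P.hd _ ?_ N N (by linarith) ?_
    · intro m hm m' hm'
      rw [mem_filter] at hm hm'
      exact (hres m' hm'.1).2.2.trans (hres m hm.1).2.2.symm
    · intro m hm
      rw [mem_filter] at hm
      have := hres m hm.1
      have k2 : (m:ℝ) < 2 * N := by exact_mod_cast this.2.1
      exact ⟨by exact_mod_cast this.1, by linarith⟩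
  have s1 := sum_le_card_nsmul _ _ _ near
  have s2 := sum_le_card_nsmul _ _ _ far
  rw [nsmul_eq_mul] at s1 s2
  calc _ ≤ _ + _ := add_le_add s1 s2
    _ ≤ (2 * ((2 * (N * z)) / d)) * (2 * (M / d)) + (2 * (N / d)) * (M / d * z) := by gcongr
    _ = _ := by field_simp; ring

lemma typeII_block (γ c : ℝ) (hγ0 : 865/886 < γ) (hγ1 : γ < 1) (hc : 0 < c) :
    ∃ X₀ : ℝ, 2 ≤ X₀ ∧ ∀ X, X₀ ≤ X → ∀ (a : ℤ) (d : ℕ) (h t Y x : ℝ), Par γ c X d h t Y x →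
      Int.gcd (d:ℤ) a = 1 → ∀ M N : ℕ, N ≤ M → X ^ (1/4:ℝ) ≤ 2 * N → ∀ (α β : ℕ → ℂ) (B : ℝ), 0 ≤ B →
      (∀ m ∈ Ico M (2 * M), (m:ℝ) ≤ X → ‖α m‖ ≤ B) → (∀ n ∈ Ico N (2 * N), (n:ℝ) ≤ X → ‖β n‖ ≤ B) →
      ‖∑ m ∈ Ico M (2 * M), ∑ n ∈ Ico N (2 * N), α m * β n * W γ c a d h t Y x (m * n)‖ ≤
        4 * B ^ 2 * (X ^ (1 - (1 - γ) - 1/10000) / d) := by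
  obtain ⟨X₁, hX₁, h₁⟩ := typeII_row γ c hγ0 hγ1 hc
  refine ⟨X₁, hX₁, ?_⟩
  intro X hX a d h t Y x P hda M N hNM hNX α β B hB hα hβ
  have hX1 : 1 ≤ X := by linarith
  have hX0 : 0 < X := by linarith
  have hd' : (0:ℝ) < d := by exact_mod_cast P.hd
  have hN0 : (0:ℝ) < N := by
    have : 0 < X ^ (1/4:ℝ) := by positivity
    linarith
  have hN1 : (1:ℝ) ≤ N := by exact_mod_cast (by exact_mod_cast hN0 : 0 < N)
  have hNM' : (N:ℝ) ≤ M := by exact_mod_cast hNM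
  by_cases hMN : (M:ℝ) * N ≤ X
  swap
  · have : ∑ m ∈ Ico M (2 * M), ∑ n ∈ Ico N (2 * N), α m * β n * W γ c a d h t Y x (m * n) = 0 := by
      refine sum_eq_zero fun m hm => sum_eq_zero fun n hn => ?_
      rw [mem_Ico] at hm hn
      rw [W_zero_of_lt, mul_zero]
      have a1 : (M:ℝ) ≤ m := by exact_mod_cast hm.1
      have a2 : (N:ℝ) ≤ n := by exact_mod_cast hn.1
      have : (M:ℝ) * N ≤ m * n := by gcongr
      push_cast
      linarith [P.hx]
    rw [this, norm_zero]; positivity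
  -- truncate the coefficients
  set α' : ℕ → ℂ := fun m => if (m:ℝ) ≤ X then α m else 0 with hα'
  set β' : ℕ → ℂ := fun m => if (m:ℝ) ≤ X then β m else 0 with hβ'
  have e1 : ∑ m ∈ Ico M (2 * M), ∑ n ∈ Ico N (2 * N), α m * β n * W γ c a d h t Y x (m * n) =
      ∑ m ∈ Ico M (2 * M), ∑ n ∈ Ico N (2 * N), α' m * β' n * W γ c a d h t Y x (m * n) := by
    refine sum_congr rfl fun m hm => sum_congr rfl fun n hn => ?_
    rw [mem_Ico] at hm hn
    have a1 : (1:ℝ) ≤ m := by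
      have : (M:ℝ) ≤ m := by exact_mod_cast hm.1
      linarith
    have a2 : (1:ℝ) ≤ n := by
      have : (N:ℝ) ≤ n := by exact_mod_cast hn.1
      linarith
    by_cases k1 : (m:ℝ) ≤ X
    · by_cases k2 : (n:ℝ) ≤ X
      · simp only [hα', hβ', if_pos k1, if_pos k2]
      · rw [W_zero_of_lt, mul_zero, mul_zero]
        push_cast; nlinarith [P.hx]
    · rw [W_zero_of_lt, mul_zero, mul_zero]
      push_cast; nlinarith [P.hx]
  rw [e1]
  have hα2 : ∀ m ∈ Ico M (2 * M), ‖α' m‖ ≤ B := by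
    intro m hm; simp only [hα']; split_ifs with k
    · exact hα m hm k
    · simpa using hB
  have hβ2 : ∀ m ∈ Ico N (2 * N), ‖β' m‖ ≤ B := by
    intro m hm; simp only [hβ']; split_ifs with k
    · exact hβ m hm k
    · simpa using hB
  have hC := cauchy_bilin (Ico M (2*M)) (Ico N (2*N)) α' β' (fun m n => W γ c a d h t Y x (m * n)) B hB hα2 hβ2
  have hR := sum_le_card_nsmul _ _ _ (fun n₁ hn₁ => h₁ X hX a d h t Y x P hda M N n₁ hNM hNX hn₁)
  rw [nsmul_eq_mul, Nat.card_Ico] at hR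
  rw [Nat.card_Ico] at hC
  have c1 : ((2 * M - M : ℕ) : ℝ) = M := by congr 1; omega
  have c2 : ((2 * N - N : ℕ) : ℝ) = N := by congr 1; omega
  rw [c1] at hC; rw [c2] at hR
  refine (pow_le_pow_iff_left₀ (norm_nonneg _) (by positivity) two_ne_zero).1 ?_
  refine hC.trans ?_
  set z := X ^ (-(2 * (1 - γ) + 1/5000)) with hz
  have hzz : (X ^ (1 - (1 - γ) - 1/10000)) ^ 2 = X ^ 2 * z := by
    rw [hz, ← Real.rpow_natCast, ← Real.rpow_natCast, ← Real.rpow_mul hX0.le, ← Real.rpow_add hX0]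
    congr 1; push_cast; ring
  have hz0 : 0 < z := by positivity
  calc B ^ 4 * M * _ ≤ B ^ 4 * M * (N * (10 * (M * N / d ^ 2) * z)) := by gcongr
    _ = 10 * B ^ 4 * ((M * N) ^ 2 * z / d ^ 2) := by ring
    _ ≤ 16 * B ^ 4 * (X ^ 2 * z / d ^ 2) := by gcongr; norm_num
    _ = (4 * B ^ 2 * (X ^ (1 - (1 - γ) - 1/10000) / d)) ^ 2 := by
        rw [← hzz]; ring

lemma typeII (γ c : ℝ) (hγ0 : 865/886 < γ) (hγ1 : γ < 1) (hc : 0 < c) :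
    ∃ X₀ : ℝ, 2 ≤ X₀ ∧ ∀ X, X₀ ≤ X → ∀ (a : ℤ) (d : ℕ) (h t Y x : ℝ), Par γ c X d h t Y x →
      Int.gcd (d:ℤ) a = 1 → ∀ (α β : ℕ → ℂ) (B : ℝ), 0 ≤ B →
      (∀ m : ℕ, (m:ℝ) ≤ X → ‖α m‖ ≤ B) → (∀ n : ℕ, (n:ℝ) ≤ X → ‖β n‖ ≤ B) →
      (∀ m : ℕ, (m:ℝ) ≤ X ^ (1/4:ℝ) → α m = 0) → (∀ m : ℕ, (m:ℝ) ≤ X ^ (1/4:ℝ) → β m = 0) →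
      ‖∑ m ∈ Icc 1 ⌊X⌋₊, ∑ n ∈ Icc 1 ⌊X⌋₊, α m * β n * W γ c a d h t Y x (m * n)‖ ≤
        16 * (1 + Real.log X) ^ 2 * (B ^ 2 * (X ^ (1 - (1 - γ) - 1/10000) / d)) := by
  obtain ⟨X₁, hX₁, h₁⟩ := typeII_block γ c hγ0 hγ1 hc
  refine ⟨X₁, hX₁, ?_⟩
  intro X hX a d h t Y x P hda α β B hB hα hβ hα0 hβ0
  have hX1 : 1 ≤ X := by linarith
  set Q := 4 * B ^ 2 * (X ^ (1 - (1 - γ) - 1/10000) / d) with hQ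
  have hQ0 : 0 ≤ Q := by positivity
  have hblock : ∀ i j : ℕ, ‖∑ m ∈ Ico (2 ^ i) (2 * 2 ^ i), ∑ n ∈ Ico (2 ^ j) (2 * 2 ^ j),
      α m * β n * W γ c a d h t Y x (m * n)‖ ≤ Q := by
    intro i j
    by_cases hi : X ^ (1/4:ℝ) ≤ 2 * ((2 ^ i : ℕ) : ℝ)
    swap
    · have : ∑ m ∈ Ico (2 ^ i) (2 * 2 ^ i), ∑ n ∈ Ico (2 ^ j) (2 * 2 ^ j),
        α m * β n * W γ c a d h t Y x (m * n) = 0 := by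
        refine sum_eq_zero fun m hm => sum_eq_zero fun n hn => ?_
        rw [mem_Ico] at hm
        have a1 : (m:ℝ) < 2 * ((2 ^ i : ℕ) : ℝ) := by exact_mod_cast hm.2
        rw [hα0 m (by linarith)]; simp
      rw [this, norm_zero]; exact hQ0
    by_cases hj : X ^ (1/4:ℝ) ≤ 2 * ((2 ^ j : ℕ) : ℝ)
    swap
    · have : ∑ m ∈ Ico (2 ^ i) (2 * 2 ^ i), ∑ n ∈ Ico (2 ^ j) (2 * 2 ^ j),
        α m * β n * W γ c a d h t Y x (m * n) = 0 := by
        refine sum_eq_zero fun m hm => sum_eq_zero fun n hn => ?_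
        rw [mem_Ico] at hn
        have a1 : (n:ℝ) < 2 * ((2 ^ j : ℕ) : ℝ) := by exact_mod_cast hn.2
        rw [hβ0 n (by linarith)]; simp
      rw [this, norm_zero]; exact hQ0
    rcases le_total (2 ^ j) (2 ^ i) with hij | hij
    · exact h₁ X hX a d h t Y x P hda _ _ hij hj α β B hB (fun m _ => hα m) (fun m _ => hβ m)
    · have := h₁ X hX a d h t Y x P hda _ _ hij hi β α B hB (fun m _ => hβ m) (fun m _ => hα m)
      rw [sum_comm] at this
      refine le_trans (le_of_eq ?_) this
      congr 1
      refine sum_congr rfl fun m _ => sum_congr rfl fun n _ => ?_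
      rw [mul_comm n m]; ring
  have := dyadic_bound X (2 * (1 + Real.log X) * Q) hX1
    (fun m => ∑ n ∈ Icc 1 ⌊X⌋₊, α m * β n * W γ c a d h t Y x (m * n)) ?_ ?_ ⌊X⌋₊ le_rfl
  · refine this.trans (le_of_eq ?_)
    rw [hQ]; ring
  · intro m hm
    refine sum_eq_zero fun n hn => ?_
    rw [mem_Icc] at hn
    rw [W_zero_of_lt, mul_zero]
    have : (1:ℝ) ≤ n := by exact_mod_cast hn.1
    push_cast; nlinarith [P.hx]
  · intro i
    rw [sum_comm]
    refine dyadic_bound X Q hX1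
      (fun n => ∑ m ∈ Ico (2 ^ i) (2 * 2 ^ i), α m * β n * W γ c a d h t Y x (m * n)) ?_ ?_ ⌊X⌋₊ le_rfl
    · intro n hn
      refine sum_eq_zero fun m hm => ?_
      rw [mem_Ico] at hm
      rw [W_zero_of_lt, mul_zero]
      have : (1:ℝ) ≤ m := by
        have : 1 ≤ m := le_trans Nat.one_le_two_pow hm.1
        exact_mod_cast this
      push_cast; nlinarith [P.hx]
    · intro j
      rw [sum_comm]
      exact hblock i j

end BVP

namespace BVP
open Finset

lemma div_bound (ε : ℝ) (hε : 0 < ε) : ∃ C : ℝ, 1 ≤ C ∧ ∀ n : ℕ, n ≠ 0 → (#n.divisors : ℝ) ≤ C * (n:ℝ) ^ ε := by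
  set C₁ : ℝ := 1 + 1 / (ε * Real.log 2) with hC₁
  have hl2 : 0 < Real.log 2 := Real.log_pos (by norm_num)
  have hC1 : 1 ≤ C₁ := by rw [hC₁]; have : 0 < 1 / (ε * Real.log 2) := by positivity
                          linarith
  set P : ℕ := ⌈(2:ℝ) ^ (1/ε)⌉₊ with hP
  refine ⟨C₁ ^ P, one_le_pow₀ hC1, ?_⟩
  intro n hn
  rw [Nat.card_divisors hn]
  have hnp : (n:ℝ) ^ ε = ∏ p ∈ n.primeFactors, ((p:ℝ) ^ ε) ^ (n.factorization p) := by
    conv_lhs => rw [← Nat.prod_factorization_pow_eq_self hn]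
    rw [Finsupp.prod, Nat.support_factorization]
    push_cast
    rw [← Real.finsetProd_rpow]
    · refine Finset.prod_congr rfl fun p hp => ?_
      rw [← Real.rpow_natCast, ← Real.rpow_mul (by positivity), mul_comm, Real.rpow_mul (by positivity), Real.rpow_natCast]
    · intros; positivity
  rw [hnp]
  push_cast
  have hterm : ∀ p ∈ n.primeFactors, ((n.factorization p : ℝ) + 1) ≤ (if p < P then C₁ else 1) * ((p:ℝ) ^ ε) ^ (n.factorization p) := by
    intro p hp
    have hp2 : (2:ℝ) ≤ p := by exact_mod_cast (Nat.prime_of_mem_primeFactors hp).two_le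
    set k := n.factorization p
    split_ifs with h
    · have h1 : 1 + ε * Real.log 2 ≤ (p:ℝ) ^ ε := by
        calc 1 + ε * Real.log 2 ≤ Real.exp (ε * Real.log 2) := by linarith [Real.add_one_le_exp (ε * Real.log 2)]
          _ = (2:ℝ) ^ ε := by rw [Real.rpow_def_of_pos (by norm_num), mul_comm]
          _ ≤ _ := Real.rpow_le_rpow (by norm_num) hp2 hε.le
      have h2 : 1 + k * (ε * Real.log 2) ≤ ((p:ℝ) ^ ε) ^ k := by
        refine (one_add_mul_le_pow (a := ε * Real.log 2) (by linarith [mul_pos hε hl2]) k).trans ?_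
        exact pow_le_pow_left₀ (by positivity) h1 k
      have h3 : (k:ℝ) + 1 ≤ C₁ * (1 + k * (ε * Real.log 2)) := by
        have : C₁ * (1 + k * (ε * Real.log 2)) = 1 + k + k * (ε * Real.log 2) + 1 / (ε * Real.log 2) := by
          rw [hC₁]; field_simp; ring
        rw [this]
        have : 0 ≤ (k:ℝ) * (ε * Real.log 2) + 1 / (ε * Real.log 2) := by positivity
        linarith
      exact h3.trans (mul_le_mul_of_nonneg_left h2 (by linarith))
    · rw [one_mul]
      have h1 : (2:ℝ) ≤ (p:ℝ) ^ ε := by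
        have h0 : (2:ℝ) ^ (1/ε) ≤ p := (Nat.le_ceil _).trans (by exact_mod_cast not_lt.1 h)
        calc (2:ℝ) = ((2:ℝ) ^ (1/ε)) ^ ε := by rw [← Real.rpow_mul (by norm_num), one_div_mul_cancel hε.ne', Real.rpow_one]
          _ ≤ _ := Real.rpow_le_rpow (by positivity) h0 hε.le
      have h2 : (1:ℝ) + k * 1 ≤ (1 + 1)^k := one_add_mul_le_pow (by norm_num) k
      calc (k:ℝ) + 1 ≤ (2:ℝ)^k := by norm_num at h2; linarith
        _ ≤ _ := pow_le_pow_left₀ (by norm_num) h1 k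
  refine (Finset.prod_le_prod (fun p _ => by positivity) hterm).trans ?_
  rw [Finset.prod_mul_distrib]
  refine mul_le_mul_of_nonneg_right ?_ (Finset.prod_nonneg fun p _ => by positivity)
  rw [Finset.prod_ite]
  simp only [Finset.prod_const, one_pow, mul_one]
  refine pow_le_pow_right₀ hC1 ?_
  calc _ ≤ #(Finset.range P) := Finset.card_le_card (by intro p hp; simp at hp ⊢; exact hp.2)
    _ = P := Finset.card_range P

/-- Abel summation bound -/
lemma abel_bound (f a : ℕ → ℂ) (B : ℝ) (N : ℕ) (hB : ∀ M, M ≤ N → ‖∑ n ∈ Icc 1 M, a n‖ ≤ B) :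
    ‖∑ n ∈ Icc 1 N, f n * a n‖ ≤ B * (‖f N‖ + ∑ n ∈ Ico 1 N, ‖f (n+1) - f n‖) := by
  have key : ∀ N : ℕ, ∑ n ∈ Icc 1 N, f n * a n = f N * ∑ n ∈ Icc 1 N, a n - ∑ n ∈ Ico 1 N, (f (n+1) - f n) * ∑ j ∈ Icc 1 n, a j := by
    intro N
    induction N with
    | zero => simp
    | succ N ih =>
      rcases Nat.eq_zero_or_pos N with rfl | hN
      · simp
      · rw [Finset.sum_Icc_succ_top (by omega), ih, Finset.sum_Icc_succ_top (by omega), Finset.sum_Ico_succ_top (by omega)]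
        ring
  rw [key]
  refine (norm_sub_le _ _).trans ?_
  rw [mul_add]
  refine add_le_add ?_ ?_
  · rw [norm_mul, mul_comm]; exact mul_le_mul_of_nonneg_right (hB N le_rfl) (norm_nonneg _)
  · rw [Finset.mul_sum]
    refine (norm_sum_le _ _).trans (Finset.sum_le_sum fun n hn => ?_)
    rw [norm_mul, mul_comm]
    exact mul_le_mul_of_nonneg_right (hB n (by simp at hn; omega)) (norm_nonneg _)

/-- opening a Dirichlet convolution -/
lemma conv_sum (f g : ArithmeticFunction ℝ) (w : ℕ → ℂ) (N : ℕ) (hw : ∀ n, N < n → w n = 0) :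
    ∑ n ∈ Icc 1 N, (((f * g) n : ℝ) : ℂ) * w n = ∑ m ∈ Icc 1 N, ∑ k ∈ Icc 1 N, (f m : ℂ) * (g k : ℂ) * w (m * k) := by
  have hI : Icc 1 N = Ioc 0 N := by ext; simp; omega
  rw [hI]
  simp only [ArithmeticFunction.mul_apply]
  trans ∑ n ∈ Ioc 0 N, ∑ x ∈ Ioc 0 N ×ˢ Ioc 0 N with x.1 * x.2 = n, (f x.1 : ℂ) * (g x.2 : ℂ) * w (x.1 * x.2)
  · refine sum_congr rfl fun n hn ↦ ?_
    simp only [mem_Ioc] at hn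
    rw [Nat.divisorsAntidiagonal_eq_prod_filter_of_le hn.1.ne' hn.2, Complex.ofReal_sum, Finset.sum_mul]
    refine sum_congr rfl fun x hx => ?_
    rw [(Finset.mem_filter.1 hx).2, Complex.ofReal_mul]
  · simp_rw [sum_filter]
    rw [sum_comm, ← Finset.sum_product' (f := fun m k => (f m : ℂ) * (g k : ℂ) * w (m * k))]
    refine sum_congr rfl fun x hx ↦ ?_
    rw [Finset.sum_ite_eq]
    split_ifs with h
    · rfl
    · simp only [mem_Ioc, mem_product] at h hx
      rw [hw, mul_zero]
      have : 0 < x.1 * x.2 := Nat.mul_pos hx.1.1 hx.2.1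
      omega

lemma harm (N : ℕ) (X : ℝ) (hX : 1 ≤ X) (hN : (N:ℝ) ≤ X) : ∑ m ∈ Icc 1 N, (1:ℝ) / m ≤ 1 + Real.log X := by
  have h := harmonic_le_one_add_log N
  rw [harmonic_eq_sum_Icc] at h
  push_cast at h
  simp only [one_div]
  refine h.trans ?_
  rcases Nat.eq_zero_or_pos N with rfl | h0
  · simp; exact Real.log_nonneg hX
  · have := Real.log_le_log (by exact_mod_cast h0) hN
    linarith

lemma typeI_sum (γ c : ℝ) (hγ0 : 865/886 < γ) (hγ1 : γ < 1) (hc : 0 < c) :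
    ∃ X₀ : ℝ, 2 ≤ X₀ ∧ ∀ X, X₀ ≤ X → ∀ (a : ℤ) (d : ℕ) (h t Y x : ℝ), Par γ c X d h t Y x → Int.gcd (d:ℤ) a = 1 →
      ∀ (α f : ℕ → ℝ), (∀ m : ℕ, (m:ℝ) ≤ X → |α m| ≤ 1 + Real.log X) → (∀ m : ℕ, X ^ (1/4:ℝ) < m → α m = 0) →
      (∀ n, 1 ≤ n → f n ≤ f (n+1)) → 0 ≤ f 1 → f ⌊X⌋₊ ≤ 1 + Real.log X →
      ‖∑ m ∈ Icc 1 ⌊X⌋₊, ∑ k ∈ Icc 1 ⌊X⌋₊, (α m : ℂ) * (f k : ℂ) * W γ c a d h t Y x (m * k)‖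
        ≤ 4 * (1 + Real.log X)^4 * (X ^ (1 - (2 * (1 - γ) + 1/5000)) / d) := by
  obtain ⟨X₀, hX₀, h₀⟩ := typeI γ c hγ0 hγ1 hc
  refine ⟨X₀, hX₀, ?_⟩
  intro X hX a d h t Y x P hda α f hα hα0 hf hf1 hfX
  have hX1 : 1 ≤ X := by linarith
  have hl : 0 ≤ Real.log X := Real.log_nonneg hX1
  have hd0 : (0:ℝ) < d := by exact_mod_cast P.hd
  set N := ⌊X⌋₊ with hN
  have hNX : (N:ℝ) ≤ X := Nat.floor_le (by linarith)
  have hN1 : 1 ≤ N := Nat.le_floor (by simpa using hX1)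
  set Q : ℝ := X ^ (1 - (2 * (1 - γ) + 1/5000)) with hQ
  have hQ0 : 0 < Q := by positivity
  have hmono : ∀ n, 1 ≤ n → f 1 ≤ f n := by
    intro n hn
    induction n, hn using Nat.le_induction with
    | base => exact le_rfl
    | succ n hn ih => exact ih.trans (hf n hn)
  have htel : ∀ M, 1 ≤ M → ∑ n ∈ Ico 1 M, (f (n+1) - f n) = f M - f 1 := by
    intro M hM
    exact Finset.sum_Ico_sub f hM
  have hinner : ∀ m ∈ Icc 1 N, ‖∑ k ∈ Icc 1 N, (α m : ℂ) * (f k : ℂ) * W γ c a d h t Y x (m * k)‖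
      ≤ 4 * (1 + Real.log X)^3 * (Q / d) * (1 / m) := by
    intro m hm
    have hm1 : 1 ≤ m := (Finset.mem_Icc.1 hm).1
    have hm0 : (0:ℝ) < m := by exact_mod_cast hm1
    have hmX : (m:ℝ) ≤ X := le_trans (by exact_mod_cast (Finset.mem_Icc.1 hm).2) hNX
    have hr0 : 0 ≤ 4 * (1 + Real.log X)^3 * (Q / d) * (1 / m) := by positivity
    by_cases hmU : (m:ℝ) ≤ X ^ (1/4:ℝ)
    swap
    · rw [hα0 m (not_le.1 hmU)]; simpa using hr0
    by_cases hmd : Nat.Coprime m d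
    swap
    · rw [Finset.sum_eq_zero]; · simpa using hr0
      intro k hk
      unfold W
      rw [if_neg, mul_zero]
      rintro ⟨_, _, h3⟩
      exact hmd (coprime_of_dvd hda h3)
    have hI := abel_bound (fun k => (f k : ℂ)) (fun k => W γ c a d h t Y x (m * k)) (2*(1+Real.log X)*(Q/(m*d))) N
      (fun M _ => h₀ X hX a d h t Y x P m M hm1 hmU hmd)
    have e1 : ∑ k ∈ Icc 1 N, (α m : ℂ) * (f k : ℂ) * W γ c a d h t Y x (m * k) = (α m : ℂ) * ∑ k ∈ Icc 1 N, (f k : ℂ) * W γ c a d h t Y x (m * k) := by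
      rw [Finset.mul_sum]; exact Finset.sum_congr rfl fun k _ => by ring
    rw [e1, norm_mul, Complex.norm_real, Real.norm_eq_abs]
    have e2 : ‖(f N : ℂ)‖ + ∑ n ∈ Ico 1 N, ‖(f (n+1) : ℂ) - (f n : ℂ)‖ ≤ 2 * (1 + Real.log X) := by
      have : ∑ n ∈ Ico 1 N, ‖(f (n+1) : ℂ) - (f n : ℂ)‖ = ∑ n ∈ Ico 1 N, (f (n+1) - f n) := by
        refine Finset.sum_congr rfl fun n hn => ?_
        rw [← Complex.ofReal_sub, Complex.norm_real, Real.norm_eq_abs, abs_of_nonneg]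
        linarith [hf n (Finset.mem_Ico.1 hn).1]
      rw [this, htel N hN1, Complex.norm_real, Real.norm_eq_abs, abs_of_nonneg (hf1.trans (hmono N hN1))]
      linarith
    calc |α m| * ‖∑ k ∈ Icc 1 N, (f k : ℂ) * W γ c a d h t Y x (m * k)‖
        ≤ (1 + Real.log X) * ((2*(1+Real.log X)*(Q/(m*d))) * (2 * (1 + Real.log X))) := by
          refine mul_le_mul (hα m hmX) (hI.trans (mul_le_mul_of_nonneg_left e2 (by positivity))) (norm_nonneg _) (by positivity)
      _ = _ := by field_simp; ring
  refine (norm_sum_le _ _).trans ((Finset.sum_le_sum hinner).trans ?_)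
  rw [← Finset.mul_sum]
  have := harm N X hX1 hNX
  calc _ ≤ 4 * (1 + Real.log X)^3 * (Q / d) * (1 + Real.log X) := mul_le_mul_of_nonneg_left this (by positivity)
    _ = _ := by ring
end BVP

namespace BVP
open Finset ArithmeticFunction

open Classical in
noncomputable def lo (U : ℝ) (f : ArithmeticFunction ℝ) : ArithmeticFunction ℝ :=
  ⟨fun n : ℕ => if (n:ℝ) ≤ U then f n else 0, by simp⟩
open Classical in
noncomputable def hi (U : ℝ) (f : ArithmeticFunction ℝ) : ArithmeticFunction ℝ :=
  ⟨fun n : ℕ => if (n:ℝ) ≤ U then 0 else f n, by simp⟩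

lemma lo_apply (U : ℝ) (f : ArithmeticFunction ℝ) (n : ℕ) : lo U f n = if (n:ℝ) ≤ U then f n else 0 := by
  simp only [lo, ArithmeticFunction.coe_mk]
lemma hi_apply (U : ℝ) (f : ArithmeticFunction ℝ) (n : ℕ) : hi U f n = if (n:ℝ) ≤ U then 0 else f n := by
  simp only [hi, ArithmeticFunction.coe_mk]
lemma lo_add_hi (U : ℝ) (f : ArithmeticFunction ℝ) : lo U f + hi U f = f := by
  ext n; rw [ArithmeticFunction.add_apply, lo_apply, hi_apply]; split_ifs <;> simp
lemma abs_lo (U : ℝ) (f : ArithmeticFunction ℝ) (n : ℕ) : |lo U f n| ≤ |f n| := by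
  rw [lo_apply]; split_ifs <;> simp
lemma abs_hi (U : ℝ) (f : ArithmeticFunction ℝ) (n : ℕ) : |hi U f n| ≤ |f n| := by
  rw [hi_apply]; split_ifs <;> simp

noncomputable abbrev Mu : ArithmeticFunction ℝ := ((ArithmeticFunction.moebius : ArithmeticFunction ℤ) : ArithmeticFunction ℝ)
noncomputable abbrev Ze : ArithmeticFunction ℝ := ((ArithmeticFunction.zeta : ArithmeticFunction ℕ) : ArithmeticFunction ℝ)
noncomputable abbrev VM : ArithmeticFunction ℝ := ArithmeticFunction.vonMangoldt

lemma abs_Mu (n : ℕ) : |Mu n| ≤ 1 := by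
  rw [ArithmeticFunction.intCoe_apply]
  exact_mod_cast ArithmeticFunction.abs_moebius_le_one

lemma abs_Ze (n : ℕ) : |Ze n| ≤ 1 := by
  rw [ArithmeticFunction.natCoe_apply, ArithmeticFunction.zeta_apply]; split_ifs <;> simp

lemma Ze_apply (n : ℕ) (hn : n ≠ 0) : Ze n = 1 := by
  rw [ArithmeticFunction.natCoe_apply, ArithmeticFunction.zeta_apply, if_neg hn]; simp

lemma sub_app (f g : ArithmeticFunction ℝ) (n : ℕ) : (f - g) n = f n - g n := by
  rw [eq_sub_iff_add_eq, ← ArithmeticFunction.add_apply, sub_add_cancel]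

lemma vaughan (U : ℝ) : hi U VM = lo U Mu * ArithmeticFunction.log - lo U (lo U Mu * lo U VM) * Ze
    - hi U (lo U Mu * lo U VM) * Ze + hi U VM * (hi U Mu * Ze) := by
  have h1 : VM * Ze = ArithmeticFunction.log := ArithmeticFunction.vonMangoldt_mul_zeta
  have h2 : Mu * Ze = 1 := ArithmeticFunction.coe_moebius_mul_coe_zeta
  have h3 := lo_add_hi U Mu
  have h4 := lo_add_hi U VM
  have h5 := lo_add_hi U (lo U Mu * lo U VM)
  have h6 : hi U VM = hi U VM * (Mu * Ze) := by rw [h2, mul_one]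
  have h7 : lo U (lo U Mu * lo U VM) * Ze = (lo U Mu * lo U VM) * Ze - hi U (lo U Mu * lo U VM) * Ze := by
    rw [← sub_mul, eq_sub_of_add_eq h5]
  rw [h7, ← h1]
  conv_lhs => rw [h6, ← h3]
  conv_rhs => rw [← h4]
  have h8 : lo U (lo U VM + hi U VM) = lo U VM := by rw [h4]
  have h9 : hi U (lo U VM + hi U VM) = hi U VM := by rw [h4]
  have h10 : lo U (lo U Mu + hi U Mu) = lo U Mu := by rw [h3]
  have h11 : hi U (lo U Mu + hi U Mu) = hi U Mu := by rw [h3]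
  simp only [h8, h9]
  ring

lemma abs_G (U : ℝ) (n : ℕ) : |(lo U Mu * lo U VM) n| ≤ Real.log n := by
  rw [ArithmeticFunction.mul_apply]
  refine (Finset.abs_sum_le_sum_abs _ _).trans ?_
  calc _ ≤ ∑ x ∈ n.divisorsAntidiagonal, VM x.2 := by
        refine Finset.sum_le_sum fun x _ => ?_
        rw [abs_mul]
        have h1 := (abs_lo U Mu x.1).trans (abs_Mu _)
        have h2 := abs_lo U VM x.2
        rw [abs_of_nonneg (ArithmeticFunction.vonMangoldt_nonneg (n := x.2))] at h2
        calc _ ≤ 1 * VM x.2 := mul_le_mul h1 h2 (abs_nonneg _) zero_le_one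
          _ = _ := one_mul _
    _ = ∑ i ∈ n.divisors, VM i := by
        exact Nat.sum_divisorsAntidiagonal' (fun _ i => VM i)
    _ = _ := ArithmeticFunction.vonMangoldt_sum

lemma G_zero (U : ℝ) (hU : 0 ≤ U) (n : ℕ) (hn : U * U < n) : (lo U Mu * lo U VM) n = 0 := by
  rw [ArithmeticFunction.mul_apply]
  refine Finset.sum_eq_zero fun x hx => ?_
  rw [lo_apply, lo_apply]
  split_ifs with h1 h2 h2
  · exfalso
    have h3 := (Nat.mem_divisorsAntidiagonal.1 hx).1
    have : (n:ℝ) = x.1 * x.2 := by rw [← h3]; push_cast; rfl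
    have := mul_le_mul h1 h2 (by positivity) hU
    linarith
  all_goals simp

lemma abs_MZ (U : ℝ) (n : ℕ) : |(hi U Mu * Ze) n| ≤ #n.divisors := by
  rw [ArithmeticFunction.mul_apply]
  refine (Finset.abs_sum_le_sum_abs _ _).trans ?_
  calc _ ≤ ∑ x ∈ n.divisorsAntidiagonal, (1:ℝ) := by
        refine Finset.sum_le_sum fun x _ => ?_
        rw [abs_mul]
        have h1 := (abs_hi U Mu x.1).trans (abs_Mu _)
        have h2 := abs_Ze x.2
        calc _ ≤ (1:ℝ) * 1 := mul_le_mul h1 h2 (abs_nonneg _) zero_le_one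
          _ = _ := one_mul _
    _ = ∑ i ∈ n.divisors, (1:ℝ) := by
        exact Nat.sum_divisorsAntidiagonal (fun _ _ => (1:ℝ))
    _ = _ := by simp

lemma MZ_zero (U : ℝ) (n : ℕ) (hn : (n:ℝ) ≤ U) : (hi U Mu * Ze) n = 0 := by
  rw [ArithmeticFunction.mul_apply]
  refine Finset.sum_eq_zero fun x hx => ?_
  rw [hi_apply, if_pos, zero_mul]
  refine le_trans ?_ hn
  have h3 := Nat.mem_divisorsAntidiagonal.1 hx
  exact_mod_cast Nat.le_of_dvd (Nat.pos_of_ne_zero h3.2) ⟨x.2, h3.1.symm⟩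

lemma lambda_bound (γ c : ℝ) (hγ0 : 865/886 < γ) (hγ1 : γ < 1) (hc : 0 < c) :
    ∃ X₀ : ℝ, 2 ≤ X₀ ∧ ∀ X, X₀ ≤ X → ∀ (a : ℤ) (d : ℕ) (h t Y x : ℝ), Par γ c X d h t Y x → Int.gcd (d:ℤ) a = 1 →
      ‖∑ n ∈ Icc 1 ⌊X⌋₊, (VM n : ℂ) * W γ c a d h t Y x n‖ ≤ X ^ (1 - (1 - γ) - 5/100000) / d := by
  obtain ⟨X₁, hX₁, h₁⟩ := typeI_sum γ c hγ0 hγ1 hc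
  obtain ⟨X₂, hX₂, h₂⟩ := typeII γ c hγ0 hγ1 hc
  obtain ⟨Cd, hCd, hdiv⟩ := div_bound (1/200000) (by norm_num)
  obtain ⟨X₃, hX₃, h₃⟩ := ev_log Cd (1/200000) 1 (by norm_num)
  obtain ⟨X₄, hX₄, h₄⟩ := ev_log 40 (1/100000) 4 (by norm_num)
  refine ⟨max (max X₁ X₂) (max X₃ X₄), hX₁.trans ((le_max_left _ _).trans (le_max_left _ _)), ?_⟩
  intro X hX a d h t Y x P hda
  have hA1 : X₁ ≤ X := ((le_max_left _ _).trans (le_max_left _ _)).trans hX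
  have hA2 : X₂ ≤ X := ((le_max_right _ _).trans (le_max_left _ _)).trans hX
  have hA3 : X₃ ≤ X := ((le_max_left _ _).trans (le_max_right _ _)).trans hX
  have hA4 : X₄ ≤ X := ((le_max_right _ _).trans (le_max_right _ _)).trans hX
  have g3 := h₃ X hA3
  have g4 := h₄ X hA4
  have hX1 : 1 ≤ X := by linarith
  have hX1' : 1 < X := by linarith
  have hX0 : 0 < X := by linarith
  have hl : 0 ≤ Real.log X := Real.log_nonneg hX1
  have hd0 : (0:ℝ) < d := by exact_mod_cast P.hd
  have t1 := h₁ X hA1 a d h t Y x P hda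
  have t2 := h₂ X hA2 a d h t Y x P hda
  clear h₁ h₂ h₃ h₄
  set U : ℝ := X ^ (1/4:ℝ) with hU
  have hU0 : 0 < U := by positivity
  set N := ⌊X⌋₊ with hN
  have hNX : (N:ℝ) ≤ X := Nat.floor_le (by linarith)
  have hN1 : 1 ≤ N := Nat.le_floor (by simpa using hX1)
  set w := W γ c a d h t Y x with hw
  have hw0 : ∀ n, N < n → w n = 0 := by
    intro n hn
    refine W_zero_of_lt (P.hx.trans_lt ?_)
    exact (Nat.floor_lt hX0.le).1 hn
  have hUY : U * U * U ≤ Y := by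
    rw [P.hY, hU, ← Real.rpow_add hX0, ← Real.rpow_add hX0]
    exact Real.rpow_le_rpow_of_exponent_le hX1 (by linarith)
  have hU1 : 1 ≤ U := Real.one_le_rpow hX1 (by norm_num)
  have hUY' : U ≤ Y := by nlinarith [mul_nonneg hU0.le hU0.le]
  -- log bounds
  have hlogn : ∀ m : ℕ, (m:ℝ) ≤ X → Real.log m ≤ Real.log X := by
    intro m hm
    rcases Nat.eq_zero_or_pos m with rfl | h0
    · simpa using hl
    · exact Real.log_le_log (by exact_mod_cast h0) hm
  set B : ℝ := X ^ (1/100000:ℝ) with hB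
  have hBB : B = X ^ (1/200000:ℝ) * X ^ (1/200000:ℝ) := by
    rw [hB, ← Real.rpow_add hX0]; norm_num
  have hr1 : 1 ≤ X ^ (1/200000:ℝ) := Real.one_le_rpow hX1 (by norm_num)
  have hB1 : 1 + Real.log X ≤ B := by
    rw [hBB]; rw [pow_one] at g3; nlinarith
  have hBd : ∀ m : ℕ, (m:ℝ) ≤ X → (#m.divisors : ℝ) ≤ B := by
    intro m hm
    rcases Nat.eq_zero_or_pos m with rfl | h0
    · simp; positivity
    · refine (hdiv m h0.ne').trans ?_
      rw [hBB]
      refine mul_le_mul ?_ (Real.rpow_le_rpow (by positivity) hm (by norm_num)) (by positivity) (by positivity)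
      rw [pow_one] at g3; nlinarith
  have hB0 : 0 ≤ B := by positivity
  -- reduce to hi
  have e0 : ∑ n ∈ Icc 1 N, (VM n : ℂ) * w n = ∑ n ∈ Icc 1 N, ((hi U VM n : ℝ) : ℂ) * w n := by
    refine Finset.sum_congr rfl fun n _ => ?_
    rw [hi_apply]
    split_ifs with h
    · rw [hw, W_zero_of_le (h.trans hUY')]; simp
    · rfl
  have e1 : ∑ n ∈ Icc 1 N, ((hi U VM n : ℝ) : ℂ) * w n =
      ∑ n ∈ Icc 1 N, (((lo U Mu * ArithmeticFunction.log) n : ℝ) : ℂ) * w n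
      - ∑ n ∈ Icc 1 N, (((lo U (lo U Mu * lo U VM) * Ze) n : ℝ) : ℂ) * w n
      - ∑ n ∈ Icc 1 N, (((hi U (lo U Mu * lo U VM) * Ze) n : ℝ) : ℂ) * w n
      + ∑ n ∈ Icc 1 N, (((hi U VM * (hi U Mu * Ze)) n : ℝ) : ℂ) * w n := by
    rw [← Finset.sum_sub_distrib, ← Finset.sum_sub_distrib, ← Finset.sum_add_distrib]
    refine Finset.sum_congr rfl fun n _ => ?_
    conv_lhs => rw [vaughan U]
    rw [ArithmeticFunction.add_apply, sub_app, sub_app]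
    push_cast; ring
  rw [e0, e1]
  simp only [conv_sum _ _ w N hw0]
  set Q1 := X ^ (1 - (2 * (1 - γ) + 1/5000)) / (d:ℝ) with hQ1
  set Q2 := X ^ (1 - (1 - γ) - 1/10000) / (d:ℝ) with hQ2
  have b1 : ‖∑ m ∈ Icc 1 N, ∑ k ∈ Icc 1 N, ((lo U Mu m : ℝ) : ℂ) * ((ArithmeticFunction.log k : ℝ) : ℂ) * w (m * k)‖ ≤ 4 * (1 + Real.log X)^4 * Q1 := by
    refine t1 (fun m => lo U Mu m) (fun k => ArithmeticFunction.log k) ?_ ?_ ?_ ?_ ?_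
    · intro m _; exact ((abs_lo U Mu m).trans (abs_Mu m)).trans (by linarith)
    · intro m hm; simp only [lo_apply]; rw [if_neg (not_le.2 hm)]
    · intro n hn
      simp only [ArithmeticFunction.log_apply]
      exact Real.log_le_log (by exact_mod_cast hn) (by push_cast; linarith)
    · simp
    · simp only [ArithmeticFunction.log_apply]; linarith [hlogn N hNX]
  have b2 : ‖∑ m ∈ Icc 1 N, ∑ k ∈ Icc 1 N, ((lo U (lo U Mu * lo U VM) m : ℝ) : ℂ) * ((Ze k : ℝ) : ℂ) * w (m * k)‖ ≤ 4 * (1 + Real.log X)^4 * Q1 := by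
    have := t1 (fun m => lo U (lo U Mu * lo U VM) m) (fun k => 1) ?_ ?_ ?_ ?_ ?_
    · refine le_trans (le_of_eq ?_) this
      congr 1
      refine Finset.sum_congr rfl fun m _ => Finset.sum_congr rfl fun k hk => ?_
      rw [Ze_apply k (by have := Finset.mem_Icc.1 hk; omega)]
    · intro m hm; exact ((abs_lo U _ m).trans (abs_G U m)).trans (by linarith [hlogn m hm])
    · intro m hm; simp only [lo_apply]; rw [if_neg (not_le.2 hm)]
    · intros; rfl
    · norm_num
    · linarith
  have b3 : ‖∑ m ∈ Icc 1 N, ∑ k ∈ Icc 1 N, ((hi U (lo U Mu * lo U VM) m : ℝ) : ℂ) * ((Ze k : ℝ) : ℂ) * w (m * k)‖ ≤ 16 * (1 + Real.log X)^2 * (B^2 * Q2) := by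
    have := t2 (fun m => ((hi U (lo U Mu * lo U VM) m : ℝ) : ℂ)) (fun k => ((hi U Ze k : ℝ) : ℂ)) B hB0 ?_ ?_ ?_ ?_
    · refine le_trans (le_of_eq ?_) this
      congr 1
      refine Finset.sum_congr rfl fun m _ => Finset.sum_congr rfl fun k hk => ?_
      by_cases hm : (m:ℝ) ≤ U * U
      · by_cases hk' : (k:ℝ) ≤ U
        · have : w (m * k) = 0 := by
            refine W_zero_of_le (le_trans ?_ hUY)
            push_cast
            exact mul_le_mul hm hk' (by positivity) (by positivity)
          rw [this]; simp
        · simp only [hi_apply]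
          rw [if_neg hk']
      · have : hi U (lo U Mu * lo U VM) m = 0 := by
          rw [hi_apply, G_zero U hU0.le m (not_le.1 hm)]; simp
        simp only [this]; simp
    · intro m hm
      simp only [Complex.norm_real, Real.norm_eq_abs]
      exact ((abs_hi U _ m).trans (abs_G U m)).trans (by linarith [hlogn m hm])
    · intro m hm
      simp only [Complex.norm_real, Real.norm_eq_abs]
      exact ((abs_hi U _ m).trans (abs_Ze m)).trans (by linarith)
    · intro m hm; simp only [hi_apply]; rw [if_pos hm]; simp
    · intro m hm; simp only [hi_apply]; rw [if_pos hm]; simp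
  have b4 : ‖∑ m ∈ Icc 1 N, ∑ k ∈ Icc 1 N, ((hi U VM m : ℝ) : ℂ) * (((hi U Mu * Ze) k : ℝ) : ℂ) * w (m * k)‖ ≤ 16 * (1 + Real.log X)^2 * (B^2 * Q2) := by
    refine t2 (fun m => ((hi U VM m : ℝ) : ℂ)) (fun k => (((hi U Mu * Ze) k : ℝ) : ℂ)) B hB0 ?_ ?_ ?_ ?_
    · intro m hm
      simp only [Complex.norm_real, Real.norm_eq_abs]
      refine (abs_hi U _ m).trans ?_
      rw [abs_of_nonneg ArithmeticFunction.vonMangoldt_nonneg]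
      linarith [hlogn m hm, ArithmeticFunction.vonMangoldt_le_log (n := m)]
    · intro m hm
      simp only [Complex.norm_real, Real.norm_eq_abs]
      exact (abs_MZ U m).trans (hBd m hm)
    · intro m hm; simp only [hi_apply]; rw [if_pos hm]; simp
    · intro m hm; simp only [MZ_zero U m hm]; simp
  have hsum : ∀ z1 z2 z3 z4 : ℂ, ‖z1 - z2 - z3 + z4‖ ≤ ‖z1‖ + ‖z2‖ + ‖z3‖ + ‖z4‖ := by
    intro z1 z2 z3 z4
    have := norm_add_le (z1 - z2 - z3) z4
    have := norm_sub_le (z1 - z2) z3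
    have := norm_sub_le z1 z2
    linarith
  refine (hsum _ _ _ _).trans ?_
  have hQ1' : Q1 ≤ B^2 * Q2 := by
    have hB2 : B^2 = X ^ (2/100000:ℝ) := by
      rw [hB, ← Real.rpow_natCast, ← Real.rpow_mul hX0.le]; norm_num
    rw [hB2, hQ1, hQ2, ← mul_div_assoc, ← Real.rpow_add hX0]
    refine div_le_div_of_nonneg_right (Real.rpow_le_rpow_of_exponent_le hX1 ?_) hd0.le
    linarith
  have hfin : B * (B^2 * Q2) ≤ X ^ (1 - (1 - γ) - 5/100000) / d := by
    have hB2 : B^2 = X ^ (2/100000:ℝ) := by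
      rw [hB, ← Real.rpow_natCast, ← Real.rpow_mul hX0.le]; norm_num
    rw [hB2, hB, hQ2, ← mul_div_assoc, ← mul_div_assoc, ← Real.rpow_add hX0, ← Real.rpow_add hX0]
    refine div_le_div_of_nonneg_right (Real.rpow_le_rpow_of_exponent_le hX1 ?_) hd0.le
    linarith
  refine le_trans ?_ hfin
  set T := B^2 * Q2 with hT
  have hT0 : 0 ≤ T := by positivity
  set l := 1 + Real.log X with hl'
  have hl1 : 1 ≤ l := by linarith
  have hl24 : l^2 ≤ l^4 := pow_le_pow_right₀ hl1 (by norm_num)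
  have : 4 * l^4 * Q1 ≤ 4 * l^4 * T := mul_le_mul_of_nonneg_left hQ1' (by positivity)
  have : 16 * l^2 * T ≤ 16 * l^4 * T := mul_le_mul_of_nonneg_right (by linarith) hT0
  have : 40 * l^4 * T ≤ B * T := mul_le_mul_of_nonneg_right g4 hT0
  linarith
end BVP

namespace BVP
open Finset

lemma rpow_tan (x s p : ℝ) (hx : 0 < x) (hs : -x ≤ s) (hp0 : 0 ≤ p) (hp1 : p ≤ 1) :
    (x + s) ^ p ≤ x ^ p + p * s * x ^ (p - 1) := by
  have h1 : x + s = x * (1 + s / x) := by field_simp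
  have h2 : -1 ≤ s / x := by rw [le_div_iff₀ hx]; linarith
  rw [h1, Real.mul_rpow hx.le (by linarith), Real.rpow_sub_one hx.ne']
  have := rpow_one_add_le_one_add_mul_self h2 hp0 hp1
  calc x ^ p * (1 + s / x) ^ p ≤ x ^ p * (1 + p * (s / x)) := mul_le_mul_of_nonneg_left this (by positivity)
    _ = _ := by field_simp

/-- the Abel weight -/
noncomputable def wt (γ h : ℝ) (n : ℕ) : ℂ := (((n:ℝ) ^ (1 - γ) : ℝ) : ℂ) * (e (h * (((n:ℝ)+1)^γ - (n:ℝ)^γ)) - 1)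

lemma g_bound (γ : ℝ) (h0 : 0 < γ) (h1 : γ < 1) (x : ℝ) (hx : 0 < x) : 0 ≤ (x+1)^γ - x^γ ∧ (x+1)^γ - x^γ ≤ x ^ (γ - 1) := by
  constructor
  · have := Real.rpow_le_rpow hx.le (by linarith : x ≤ x + 1) h0.le
    linarith
  · have := rpow_tan x 1 γ hx (by linarith) h0.le h1.le
    have h2 : 0 ≤ x ^ (γ - 1) := by positivity
    nlinarith

lemma norm_wt (γ h : ℝ) (h0 : 0 < γ) (h1 : γ < 1) (n : ℕ) (hn : 1 ≤ n) : ‖wt γ h n‖ ≤ 2 * Real.pi * |h| := by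
  have hn0 : (0:ℝ) < n := by exact_mod_cast hn
  have hg := g_bound γ h0 h1 n hn0
  unfold wt
  rw [norm_mul, Complex.norm_real, Real.norm_eq_abs, abs_of_nonneg (by positivity)]
  have h2 := norm_e_sub_one_le (h * (((n:ℝ)+1)^γ - (n:ℝ)^γ))
  rw [abs_mul, abs_of_nonneg hg.1] at h2
  calc _ ≤ (n:ℝ)^(1-γ) * (2 * Real.pi * (|h| * (n:ℝ)^(γ-1))) := by
        refine mul_le_mul_of_nonneg_left (h2.trans ?_) (by positivity)
        gcongr; exact hg.2
    _ = 2 * Real.pi * |h| * ((n:ℝ)^(1-γ) * (n:ℝ)^(γ-1)) := by ring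
    _ = _ := by rw [← Real.rpow_add hn0]; simp

lemma norm_wt_sub (γ h : ℝ) (h0 : 0 < γ) (h1 : γ < 1) (n : ℕ) (hn : 1 ≤ n) :
    ‖wt γ h (n+1) - wt γ h n‖ ≤ 6 * Real.pi * |h| * (1 / n) := by
  have hn0 : (0:ℝ) < n := by exact_mod_cast hn
  set x : ℝ := (n:ℝ) with hx
  set g0 := (x+1)^γ - x^γ with hg0
  set g1 := (x+1+1)^γ - (x+1)^γ with hg1
  have hg1b := g_bound γ h0 h1 (x+1) (by linarith)
  have e1 : wt γ h (n+1) - wt γ h n = ((((x+1) ^ (1 - γ) - x^(1-γ) : ℝ)) : ℂ) * (e (h * g1) - 1)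
      + ((x ^ (1-γ) : ℝ) : ℂ) * (e (h * g1) - e (h * g0)) := by
    unfold wt; push_cast; rw [hg0, hg1]; ring
  have hd1 : 0 ≤ (x+1) ^ (1 - γ) - x^(1-γ) := by
    have := Real.rpow_le_rpow hn0.le (by linarith : x ≤ x + 1) (by linarith : 0 ≤ 1 - γ)
    linarith
  have hd2 : (x+1) ^ (1 - γ) - x^(1-γ) ≤ x ^ (-γ) := by
    have := rpow_tan x 1 (1-γ) hn0 (by linarith) (by linarith) (by linarith)
    have h2 : 0 ≤ x ^ (-γ) := by positivity
    rw [show 1 - γ - 1 = -γ by ring] at this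
    nlinarith
  have hE1 : ‖e (h * g1) - 1‖ ≤ 2 * Real.pi * (|h| * x ^ (γ - 1)) := by
    refine (norm_e_sub_one_le _).trans ?_
    rw [abs_mul, abs_of_nonneg hg1b.1]
    have : (x+1) ^ (γ - 1) ≤ x ^ (γ - 1) := Real.rpow_le_rpow_of_nonpos hn0 (by linarith) (by linarith)
    gcongr
    exact hg1b.2.trans this
  have hgg1 : g1 ≤ g0 := by
    have hA := rpow_tan (x+1) 1 γ (by linarith) (by linarith) h0.le h1.le
    have hB := rpow_tan (x+1) (-1) γ (by linarith) (by linarith) h0.le h1.le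
    rw [show x + 1 + -1 = x by ring] at hB
    rw [hg0, hg1]; linarith
  have hgg2 : g0 - g1 ≤ 2 * (x ^ (γ - 1) * (1 / x)) := by
    have hA := rpow_tan x 1 γ hn0 (by linarith) h0.le h1.le
    have hB := rpow_tan (x+1+1) (-1) γ (by linarith) (by linarith) h0.le h1.le
    rw [show x + 1 + 1 + -1 = x + 1 by ring] at hB
    have hC : g0 - g1 ≤ γ * (x^(γ-1) - (x+1+1)^(γ-1)) := by rw [hg0, hg1]; linarith
    have hD : x ^ (γ-1) * (x / (x+2)) ≤ (x+1+1)^(γ-1) := by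
      have e3 : (x+1+1)^(γ-1) = x^(γ-1) * (x/(x+2))^(1-γ) := by
        rw [Real.div_rpow hn0.le (by linarith), show (1 - γ) = -(γ - 1) by ring, Real.rpow_neg hn0.le, Real.rpow_neg (by linarith), show x + 1 + 1 = x + 2 by ring]
        have : x ^ (γ-1) ≠ 0 := by positivity
        have : (x+2) ^ (γ-1) ≠ 0 := by positivity
        field_simp
      rw [e3]
      refine mul_le_mul_of_nonneg_left ?_ (by positivity)
      have hr1 : x / (x+2) ≤ 1 := by rw [div_le_one (by linarith)]; linarith
      calc x/(x+2) = (x/(x+2))^(1:ℝ) := (Real.rpow_one _).symm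
        _ ≤ _ := Real.rpow_le_rpow_of_exponent_ge (by positivity) hr1 (by linarith)
    have hF : x ^ (γ-1) - x ^ (γ-1) * (x / (x+2)) ≤ 2 * (x ^ (γ - 1) * (1 / x)) := by
      have : 1 - x / (x+2) ≤ 2 * (1/x) := by
        rw [show 1 - x/(x+2) = 2/(x+2) by field_simp; ring, show 2 * (1/x) = 2/x by ring]
        exact div_le_div_of_nonneg_left (by norm_num) hn0 (by linarith)
      have h2 : 0 ≤ x ^ (γ - 1) := by positivity
      nlinarith
    have hG : 0 ≤ 2 * (x ^ (γ - 1) * (1 / x)) := by positivity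
    nlinarith
  have hE2 : ‖e (h * g1) - e (h * g0)‖ ≤ 2 * Real.pi * (|h| * (2 * (x ^ (γ - 1) * (1 / x)))) := by
    refine (norm_e_sub_le _ _).trans ?_
    rw [← mul_sub, abs_mul, abs_sub_comm, abs_of_nonneg (by linarith : 0 ≤ g0 - g1)]
    gcongr
  rw [e1]
  refine (norm_add_le _ _).trans ?_
  rw [norm_mul, norm_mul, Complex.norm_real, Complex.norm_real, Real.norm_eq_abs, Real.norm_eq_abs, abs_of_nonneg hd1, abs_of_nonneg (by positivity : 0 ≤ x ^ (1-γ))]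
  have r1 : x ^ (-γ) * x ^ (γ - 1) = 1 / x := by
    rw [← Real.rpow_add hn0, show -γ + (γ - 1) = -1 by ring, Real.rpow_neg_one, one_div]
  have r2 : x ^ (1-γ) * x ^ (γ - 1) = 1 := by
    rw [← Real.rpow_add hn0]; simp
  have k1 : ((x+1) ^ (1 - γ) - x^(1-γ)) * ‖e (h * g1) - 1‖ ≤ 2 * Real.pi * |h| * (1/x) := by
    calc _ ≤ x ^ (-γ) * (2 * Real.pi * (|h| * x ^ (γ - 1))) := mul_le_mul hd2 hE1 (norm_nonneg _) (by positivity)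
      _ = 2 * Real.pi * |h| * (x ^ (-γ) * x ^ (γ - 1)) := by ring
      _ = _ := by rw [r1]
  have k2 : x ^ (1-γ) * ‖e (h * g1) - e (h * g0)‖ ≤ 4 * Real.pi * |h| * (1/x) := by
    calc _ ≤ x ^ (1-γ) * (2 * Real.pi * (|h| * (2 * (x ^ (γ - 1) * (1 / x))))) := mul_le_mul_of_nonneg_left hE2 (by positivity)
      _ = 4 * Real.pi * |h| * (1/x) * (x ^ (1-γ) * x ^ (γ - 1)) := by ring
      _ = _ := by rw [r2, mul_one]
  linarith

/-- the set of `n` in play -/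
noncomputable def Sset (a : ℤ) (d : ℕ) (Y : ℝ) (N : ℕ) : Finset ℕ :=
  open Classical in (Icc 1 N).filter (fun n : ℕ => Y < n ∧ (d:ℤ) ∣ (n:ℤ) - a)

lemma main_h (γ c : ℝ) (hγ0 : 865/886 < γ) (hγ1 : γ < 1) (hc : 0 < c) :
    ∃ X₀ : ℝ, 2 ≤ X₀ ∧ ∀ X, X₀ ≤ X → ∀ (a : ℤ) (d : ℕ) (h t Y : ℝ), Par γ c X d h t Y X → Int.gcd (d:ℤ) a = 1 →
      ‖∑ n ∈ Sset a d Y ⌊X⌋₊, (VM n : ℂ) * (((n:ℝ) ^ (1 - γ) : ℝ) : ℂ) * e (t * (n:ℝ)^c) *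
        (e (h * ((n:ℝ)+1)^γ) - e (h * (n:ℝ)^γ))‖ ≤ 8 * Real.pi * |h| * (1 + Real.log X) * (X ^ (1 - (1 - γ) - 5/100000) / d) := by
  obtain ⟨X₀, hX₀, h₀⟩ := lambda_bound γ c hγ0 hγ1 hc
  refine ⟨X₀, hX₀, ?_⟩
  intro X hX a d h t Y P hda
  have hX1 : 1 ≤ X := by linarith
  have hl : 0 ≤ Real.log X := Real.log_nonneg hX1
  have hX0 : 0 < X := by linarith
  have hd0 : (0:ℝ) < d := by exact_mod_cast P.hd
  set N := ⌊X⌋₊ with hN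
  have hNX : (N:ℝ) ≤ X := Nat.floor_le (by linarith)
  have hN1 : 1 ≤ N := Nat.le_floor (by simpa using hX1)
  set Q := X ^ (1 - (1 - γ) - 5/100000) / (d:ℝ) with hQ
  have hQ0 : 0 ≤ Q := by positivity
  have hγ : 0 < γ := by linarith
  have e1 : ∑ n ∈ Sset a d Y N, (VM n : ℂ) * (((n:ℝ) ^ (1 - γ) : ℝ) : ℂ) * e (t * (n:ℝ)^c) *
        (e (h * ((n:ℝ)+1)^γ) - e (h * (n:ℝ)^γ)) = ∑ n ∈ Icc 1 N, wt γ h n * ((VM n : ℂ) * W γ c a d h t Y X n) := by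
    unfold Sset
    rw [Finset.sum_filter]
    refine Finset.sum_congr rfl fun n hn => ?_
    have hnX : (n:ℝ) ≤ X := le_trans (by exact_mod_cast (Finset.mem_Icc.1 hn).2) hNX
    unfold W
    by_cases hcnd : Y < n ∧ (d:ℤ) ∣ (n:ℤ) - a
    · rw [if_pos hcnd, if_pos ⟨hcnd.1, hnX, hcnd.2⟩]
      unfold wt
      rw [mul_sub h, e_sub, e_add]
      have := e_mul_conj (h * (n:ℝ)^γ)
      linear_combination (-(VM n : ℂ) * (((n:ℝ) ^ (1 - γ) : ℝ) : ℂ) * e (t * (n:ℝ)^c) * e (h * ((n:ℝ)+1)^γ)) * this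
    · rw [if_neg hcnd, if_neg (by tauto)]; simp
  rw [e1]
  have hab := abel_bound (wt γ h) (fun n => (VM n : ℂ) * W γ c a d h t Y X n) Q N ?_
  · refine hab.trans ?_
    have hs : ∑ n ∈ Ico 1 N, ‖wt γ h (n+1) - wt γ h n‖ ≤ 6 * Real.pi * |h| * (1 + Real.log X) := by
      calc _ ≤ ∑ n ∈ Ico 1 N, 6 * Real.pi * |h| * (1 / (n:ℝ)) := Finset.sum_le_sum fun n hn => norm_wt_sub γ h hγ hγ1 n (Finset.mem_Ico.1 hn).1
        _ = 6 * Real.pi * |h| * ∑ n ∈ Ico 1 N, 1 / (n:ℝ) := by rw [Finset.mul_sum]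
        _ ≤ 6 * Real.pi * |h| * ∑ n ∈ Icc 1 N, 1 / (n:ℝ) := by
            refine mul_le_mul_of_nonneg_left ?_ (by positivity)
            exact Finset.sum_le_sum_of_subset_of_nonneg Finset.Ico_subset_Icc_self (fun _ _ _ => by positivity)
        _ ≤ _ := mul_le_mul_of_nonneg_left (harm N X hX1 hNX) (by positivity)
    have hw := norm_wt γ h hγ hγ1 N hN1
    calc _ ≤ Q * (2 * Real.pi * |h| + 6 * Real.pi * |h| * (1 + Real.log X)) := mul_le_mul_of_nonneg_left (add_le_add hw hs) hQ0
      _ ≤ Q * (8 * Real.pi * |h| * (1 + Real.log X)) := by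
          refine mul_le_mul_of_nonneg_left ?_ hQ0
          have : 0 ≤ 2 * Real.pi * |h| * Real.log X := by positivity
          linarith
      _ = _ := by ring
  · intro M hM
    have hMX : (M:ℝ) ≤ X := le_trans (by exact_mod_cast hM) hNX
    have P' : Par γ c X d h t Y M := ⟨P.hd, P.hdX, P.h1, P.h2, P.ht, P.hY, hMX⟩
    have := h₀ X hX a d h t Y M P' hda
    refine le_trans (le_of_eq ?_) this
    congr 1
    rw [← hN]
    have hsub : Icc 1 M ⊆ Icc 1 N := Finset.Icc_subset_Icc le_rfl hM
    rw [← Finset.sum_subset hsub (f := fun n => (VM n : ℂ) * W γ c a d h t Y M n)]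
    · refine Finset.sum_congr rfl fun n hn => ?_
      have hnM : (n:ℝ) ≤ M := by exact_mod_cast (Finset.mem_Icc.1 hn).2
      congr 1
      unfold W
      simp [hnM, hnM.trans hMX]
    · intro n hn hn'
      rw [W_zero_of_lt, mul_zero]
      simp only [Finset.mem_Icc] at hn hn'
      exact_mod_cast (by omega : M < n)
end BVP

namespace BVP
open Finset

/-- periodic second Bernoulli function -/
noncomputable def Fb (x : ℝ) : ℝ := Int.fract x ^ 2 - Int.fract x + 1/6

lemma Fb_hasSum (x : ℝ) : HasSum (fun n : ℕ => 1 / (n:ℝ)^2 * Real.cos (2 * Real.pi * n * x)) (Real.pi^2 * Fb x) := by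
  have h := hasSum_one_div_nat_pow_mul_cos (k := 1) one_ne_zero (x := Int.fract x) ⟨Int.fract_nonneg x, (Int.fract_lt_one x).le⟩
  have e1 : (Polynomial.map (algebraMap ℚ ℝ) (Polynomial.bernoulli (2 * 1))).eval (Int.fract x) = Fb x := by
    have := bernoulliFun_two (Int.fract x)
    unfold bernoulliFun at this
    rw [show 2 * 1 = 2 by norm_num, this]; unfold Fb; norm_num
  rw [e1] at h
  convert h using 1
  · ext n
    congr 1
    have : 2 * Real.pi * n * x = 2 * Real.pi * n * Int.fract x + ((n * ⌊x⌋ : ℤ) : ℝ) * (2 * Real.pi) := by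
      push_cast
      have := Int.floor_add_fract x
      linear_combination -(2 * Real.pi * n) * this
    rw [this, Real.cos_add_int_mul_two_pi]
  · have : Nat.factorial (2 * 1) = 2 := rfl
    rw [this]; push_cast; ring

noncomputable def FK (K : ℕ) (x : ℝ) : ℝ := ∑ n ∈ Icc 1 K, 1 / (n:ℝ)^2 * Real.cos (2 * Real.pi * n * x)

lemma FK_approx (K : ℕ) (hK : 1 ≤ K) (x : ℝ) : |Real.pi^2 * Fb x - FK K x| ≤ 1 / K := by
  have h := (Fb_hasSum x).tendsto_sum_nat
  have h2 : Filter.Tendsto (fun M : ℕ => |∑ n ∈ range M, 1 / (n:ℝ)^2 * Real.cos (2 * Real.pi * n * x) - FK K x|) Filter.atTop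
      (nhds |Real.pi^2 * Fb x - FK K x|) := (h.sub_const _).abs
  refine le_of_tendsto h2 ?_
  filter_upwards [Filter.eventually_ge_atTop (K+1)] with M hM
  have e1 : ∑ n ∈ range M, 1 / (n:ℝ)^2 * Real.cos (2 * Real.pi * n * x) - FK K x = ∑ n ∈ Ioc K (M-1), 1 / (n:ℝ)^2 * Real.cos (2 * Real.pi * n * x) := by
    unfold FK
    rw [sub_eq_iff_eq_add]
    have : range M = insert 0 (Ioc K (M-1) ∪ Icc 1 K) := by ext i; simp; omega
    rw [this, Finset.sum_insert (by simp), Finset.sum_union]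
    · simp
    · rw [Finset.disjoint_left]; intro i hi hi'; simp at hi hi'; omega
  rw [e1]
  calc _ ≤ ∑ n ∈ Ioc K (M-1), ((n:ℝ)^2)⁻¹ := by
        refine (Finset.abs_sum_le_sum_abs _ _).trans (Finset.sum_le_sum fun n _ => ?_)
        rw [abs_mul, one_div, abs_of_nonneg (by positivity : (0:ℝ) ≤ ((n:ℝ)^2)⁻¹)]
        exact mul_le_of_le_one_right (by positivity) (Real.abs_cos_le_one _)
    _ ≤ (K:ℝ)⁻¹ - ((M-1:ℕ):ℝ)⁻¹ := sum_Ioc_inv_sq_le_sub (by omega) (by omega)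
    _ ≤ 1 / K := by
        rw [one_div]
        have : (0:ℝ) ≤ ((M-1:ℕ):ℝ)⁻¹ := by positivity
        linarith

open Classical in
noncomputable def ind (Δ x : ℝ) : ℝ := if 1 - Δ ≤ Int.fract x then 1 else 0

lemma ind_nonneg (Δ x : ℝ) : 0 ≤ ind Δ x := by unfold ind; split_ifs <;> norm_num

lemma saw_approx (Δ x : ℝ) (h0 : 0 < Δ) (h1 : Δ < 1) : |saw x - (Fb (x + Δ) - Fb x) / (2 * Δ)| ≤ Δ / 2 + ind Δ x := by
  set f := Int.fract x with hf
  have hf0 : 0 ≤ f := Int.fract_nonneg x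
  have hf1 : f < 1 := Int.fract_lt_one x
  unfold ind
  split_ifs with h
  · have e1 : Int.fract (x + Δ) = f + Δ - 1 := by
      rw [Int.fract_eq_iff]
      refine ⟨by linarith, by linarith, ⌊x⌋ + 1, ?_⟩
      push_cast
      have := Int.floor_add_fract x
      linarith
    have e2 : (Fb (x + Δ) - Fb x) / (2 * Δ) = (Δ - 1) * (2 * f + Δ - 2) / (2 * Δ) := by
      unfold Fb; rw [e1, ← hf]; ring
    have e3 : |(Δ - 1) * (2 * f + Δ - 2) / (2 * Δ)| ≤ 1/2 := by
      rw [abs_div, abs_of_pos (by linarith : 0 < 2 * Δ), div_le_iff₀ (by linarith), abs_mul]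
      have a1 : |Δ - 1| ≤ 1 := by rw [abs_le]; constructor <;> linarith
      have a2 : |2 * f + Δ - 2| ≤ Δ := by rw [abs_le]; constructor <;> linarith
      calc _ ≤ 1 * Δ := mul_le_mul a1 a2 (abs_nonneg _) zero_le_one
        _ = _ := by ring
    have e4 : |saw x| ≤ 1/2 := by
      unfold saw; rw [abs_le]; constructor <;> linarith
    rw [e2]
    refine (abs_sub _ _).trans ?_
    linarith
  · have e1 : Int.fract (x + Δ) = f + Δ := by
      rw [Int.fract_eq_iff]
      refine ⟨by linarith, by linarith, ⌊x⌋, ?_⟩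
      have := Int.floor_add_fract x
      linarith
    have e2 : (Fb (x + Δ) - Fb x) / (2 * Δ) = f + Δ / 2 - 1/2 := by
      unfold Fb; rw [e1, ← hf]; field_simp; ring
    rw [e2]; unfold saw; rw [← hf, show f - 1/2 - (f + Δ/2 - 1/2) = -(Δ/2) by ring, abs_neg, abs_of_pos (by linarith)]
    linarith

noncomputable def bc (Δ : ℝ) (h : ℝ) : ℂ := (e (h * Δ) - 1) / ((4 * Δ * Real.pi^2 * h^2 : ℝ) : ℂ)

lemma norm_bc (Δ h : ℝ) (h0 : 0 < Δ) (h1 : h ≠ 0) : ‖bc Δ h‖ ≤ 1 / (18 * Δ * h^2) := by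
  unfold bc
  have hp : 0 < 4 * Δ * Real.pi^2 * h^2 := by positivity
  rw [norm_div, Complex.norm_real, Real.norm_eq_abs, abs_of_pos hp]
  have h2 : ‖e (h * Δ) - 1‖ ≤ 2 := by
    refine (norm_sub_le _ _).trans ?_
    rw [norm_e]; norm_num
  have h3 : 9 ≤ Real.pi^2 := by nlinarith [Real.pi_gt_three]
  have h4 : 0 < h^2 := by positivity
  rw [div_le_div_iff₀ hp (by positivity)]
  have h5 : 0 < Δ * h^2 := by positivity
  nlinarith [mul_le_mul_of_nonneg_left h3 h5.le, mul_le_mul_of_nonneg_right h2 h5.le]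

noncomputable def PK (Δ : ℝ) (K : ℕ) (x : ℝ) : ℂ := ∑ n ∈ Icc 1 K, (bc Δ n * e (n * x) + bc Δ (-n) * e (-n * x))

lemma PK_eq (Δ : ℝ) (K : ℕ) (x : ℝ) (h0 : 0 < Δ) : PK Δ K x = (((FK K (x + Δ) - FK K x) / (2 * Δ * Real.pi^2) : ℝ) : ℂ) := by
  unfold PK FK
  rw [← Finset.sum_sub_distrib, Finset.sum_div, Complex.ofReal_sum]
  refine Finset.sum_congr rfl fun n hn => ?_
  have hn0 : (n:ℂ) ≠ 0 := by
    have := Finset.mem_Icc.1 hn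
    exact_mod_cast (by omega : n ≠ 0)
  have hcos : ∀ y : ℝ, ((Real.cos (2 * Real.pi * n * y) : ℝ) : ℂ) = (e (n * y) + e (-n * y)) / 2 := by
    intro y
    have h1 := e_re (n * y)
    rw [neg_mul, e_neg, Complex.add_conj, h1]
    push_cast
    rw [show 2 * (Real.pi:ℂ) * n * y = 2 * Real.pi * (n * y) by ring]; ring
  have hΔ : (Δ:ℂ) ≠ 0 := by exact_mod_cast h0.ne'
  have hpi : (Real.pi:ℂ) ≠ 0 := by exact_mod_cast Real.pi_ne_zero
  unfold bc
  simp only [Complex.ofReal_div, Complex.ofReal_sub, Complex.ofReal_mul]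
  rw [hcos, hcos, mul_add, mul_add, e_add, e_add]
  push_cast
  field_simp
  ring

lemma saw_fourier (Δ x : ℝ) (K : ℕ) (h0 : 0 < Δ) (h1 : Δ < 1) (hK : 1 ≤ K) :
    ‖(saw x : ℂ) - PK Δ K x‖ ≤ Δ / 2 + ind Δ x + 1 / (Δ * K) := by
  rw [PK_eq Δ K x h0, ← Complex.ofReal_sub, Complex.norm_real, Real.norm_eq_abs]
  have hA := saw_approx Δ x h0 h1
  have hB := FK_approx K hK x
  have hC := FK_approx K hK (x + Δ)
  have hK0 : (0:ℝ) < K := by exact_mod_cast hK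
  have hpi : 9 ≤ Real.pi^2 := by nlinarith [Real.pi_gt_three]
  have e1 : saw x - (FK K (x + Δ) - FK K x) / (2 * Δ * Real.pi^2) = (saw x - (Fb (x + Δ) - Fb x) / (2 * Δ))
      + ((Real.pi^2 * Fb (x+Δ) - FK K (x + Δ)) - (Real.pi^2 * Fb x - FK K x)) / (2 * Δ * Real.pi^2) := by
    field_simp; ring
  rw [e1]
  refine (abs_add_le _ _).trans (add_le_add hA ?_)
  rw [abs_div, abs_of_pos (by positivity : 0 < 2 * Δ * Real.pi^2)]
  have h3 := (abs_sub (Real.pi^2 * Fb (x+Δ) - FK K (x + Δ)) (Real.pi^2 * Fb x - FK K x)).trans (add_le_add hC hB)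
  calc _ ≤ (1 / K + 1 / K) / (2 * Δ * Real.pi^2) := div_le_div_of_nonneg_right h3 (by positivity)
    _ = 1 / (Δ * K) * (1 / Real.pi^2) := by field_simp; ring
    _ ≤ 1 / (Δ * K) * 1 := by
        refine mul_le_mul_of_nonneg_left ?_ (by positivity)
        rw [div_le_one (by positivity)]; linarith
    _ = _ := mul_one _

lemma ind_le (Δ x : ℝ) (J : ℕ) (hJ : 1 ≤ J) (hJΔ : 8 * J * Δ ≤ 1) :
    ind Δ x ≤ 4 / (J:ℝ)^2 * ‖∑ j ∈ range J, e (j * x)‖^2 := by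
  unfold ind
  split_ifs with h
  · have hJ0 : (0:ℝ) < J := by exact_mod_cast hJ
    set u := Int.fract x - 1 with hu
    have hu0 : u ≤ 0 := by linarith [Int.fract_lt_one x]
    have hre : (J:ℝ) / 2 ≤ (∑ j ∈ range J, e (j * x)).re := by
      rw [Complex.re_sum]
      calc (J:ℝ)/2 = ∑ j ∈ range J, (1/2:ℝ) := by simp; ring
        _ ≤ _ := by
          refine Finset.sum_le_sum fun j hj => ?_
          have hjJ : (j:ℝ) ≤ J := by exact_mod_cast (Finset.mem_range.1 hj).le
          have e1 : (j:ℝ) * x = j * u + ((j * (⌊x⌋ + 1) : ℤ) : ℝ) := by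
            push_cast
            have := Int.floor_add_fract x
            rw [hu]; linear_combination -(j:ℝ) * this
          rw [e1, e_add, e_int, mul_one, e_re]
          refine le_trans ?_ (Real.one_sub_sq_div_two_le_cos)
          have h5 : |2 * Real.pi * (j * u)| ≤ 1 := by
            rw [abs_mul (2 * Real.pi), abs_mul (j:ℝ), abs_of_pos (by positivity : 0 < 2 * Real.pi), abs_of_nonneg (by positivity : (0:ℝ) ≤ j), abs_of_nonpos hu0]
            have h6 : (j:ℝ) * -u ≤ J * Δ := mul_le_mul hjJ (by linarith) (by linarith) hJ0.le
            have := Real.pi_lt_four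
            have := Real.pi_pos
            have : 2 * Real.pi * (j * -u) ≤ 2 * Real.pi * (1/8) := by
              refine mul_le_mul_of_nonneg_left ?_ (by positivity)
              linarith
            linarith
          have := (sq_le_one_iff_abs_le_one _).2 h5
          linarith
    have h2 : (J:ℝ)/2 ≤ ‖∑ j ∈ range J, e (j * x)‖ := hre.trans (Complex.re_le_norm _)
    have h3 : ((J:ℝ)/2)^2 ≤ ‖∑ j ∈ range J, e (j * x)‖^2 := pow_le_pow_left₀ (by positivity) h2 2
    calc (1:ℝ) = 4 / (J:ℝ)^2 * ((J:ℝ)/2)^2 := by field_simp; norm_num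
      _ ≤ _ := mul_le_mul_of_nonneg_left h3 (by positivity)
  · positivity

lemma ind_sum (Δ : ℝ) (J : ℕ) (hJ : 1 ≤ J) (hJΔ : 8 * J * Δ ≤ 1) (S : Finset ℕ) (x : ℕ → ℝ) (E : ℝ)
    (hE : ∀ h : ℝ, 1 ≤ |h| → |h| ≤ J → ‖∑ n ∈ S, e (h * x n)‖ ≤ E) (hE0 : 0 ≤ E) :
    ∑ n ∈ S, ind Δ (x n) ≤ 4 * #S / J + 4 * E := by
  have hJ0 : (0:ℝ) < J := by exact_mod_cast hJ
  have h1 : ((∑ n ∈ S, ‖∑ j ∈ range J, e (j * x n)‖^2 : ℝ) : ℂ) = ∑ j ∈ range J, ∑ k ∈ range J, ∑ n ∈ S, e (((j:ℝ) - k) * x n) := by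
    push_cast
    have : ∀ n, ((‖∑ j ∈ range J, e (j * x n)‖ : ℝ) : ℂ)^2 = ∑ j ∈ range J, ∑ k ∈ range J, e (((j:ℝ) - k) * x n) := by
      intro n
      rw [← Complex.mul_conj', map_sum, Finset.sum_mul_sum]
      refine Finset.sum_congr rfl fun j _ => Finset.sum_congr rfl fun k _ => ?_
      rw [sub_mul, e_sub]
    simp_rw [this]
    rw [Finset.sum_comm]
    refine Finset.sum_congr rfl fun j _ => ?_
    rw [Finset.sum_comm]
  have h2 : ∑ n ∈ S, ‖∑ j ∈ range J, e (j * x n)‖^2 ≤ J * #S + J^2 * E := by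
    have h3 : ∑ n ∈ S, ‖∑ j ∈ range J, e (j * x n)‖^2 = ‖((∑ n ∈ S, ‖∑ j ∈ range J, e (j * x n)‖^2 : ℝ) : ℂ)‖ := by
      rw [Complex.norm_real, Real.norm_eq_abs, abs_of_nonneg (Finset.sum_nonneg fun _ _ => by positivity)]
    rw [h3, h1]
    calc _ ≤ ∑ j ∈ range J, ∑ k ∈ range J, ((if j = k then (#S:ℝ) else 0) + E) := by
          refine (norm_sum_le _ _).trans (Finset.sum_le_sum fun j hj => (norm_sum_le _ _).trans (Finset.sum_le_sum fun k hk => ?_))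
          split_ifs with hjk
          · subst hjk; simp [e_zero]; exact hE0
          · rw [zero_add]
            have hj' : (j:ℝ) ≤ J := by exact_mod_cast (Finset.mem_range.1 hj).le
            have hk' : (k:ℝ) ≤ J := by exact_mod_cast (Finset.mem_range.1 hk).le
            have hj0 : (0:ℝ) ≤ j := by positivity
            have hk0 : (0:ℝ) ≤ k := by positivity
            refine hE _ ?_ ?_
            · have : (1:ℤ) ≤ |(j:ℤ) - k| := Int.one_le_abs (by omega)
              exact_mod_cast this
            · rw [abs_le]; constructor <;> linarith
      _ = _ := by
          simp only [Finset.sum_add_distrib, Finset.sum_ite_eq, Finset.sum_const, Finset.card_range, nsmul_eq_mul]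
          rw [Finset.sum_congr rfl (fun j hj => if_pos hj)]
          simp only [Finset.sum_const, Finset.card_range, nsmul_eq_mul]
          ring
  calc _ ≤ ∑ n ∈ S, 4 / (J:ℝ)^2 * ‖∑ j ∈ range J, e (j * x n)‖^2 := Finset.sum_le_sum fun n _ => ind_le Δ (x n) J hJ hJΔ
    _ = 4 / (J:ℝ)^2 * ∑ n ∈ S, ‖∑ j ∈ range J, e (j * x n)‖^2 := by rw [Finset.mul_sum]
    _ ≤ 4 / (J:ℝ)^2 * (J * #S + J^2 * E) := mul_le_mul_of_nonneg_left h2 (by positivity)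
    _ = _ := by field_simp
end BVP

namespace BVP
open Finset

lemma mem_Sset {a : ℤ} {d : ℕ} {Y : ℝ} {N n : ℕ} : n ∈ Sset a d Y N ↔ (1 ≤ n ∧ n ≤ N) ∧ Y < n ∧ (d:ℤ) ∣ (n:ℤ) - a := by
  unfold Sset; rw [Finset.mem_filter, Finset.mem_Icc]

lemma card_res (d : ℕ) (hd : 0 < d) (a : ℤ) (Z : ℝ) (hZ : (d:ℝ) ≤ Z) (S : Finset ℕ)
    (hS : ∀ n ∈ S, (n:ℝ) ≤ Z ∧ (d:ℤ) ∣ (n:ℤ) - a) : (#S:ℝ) ≤ 2 * (Z / d) := by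
  refine card_cong d hd S ?_ 0 Z hZ ?_
  · intro m hm m' hm'
    rw [Nat.modEq_iff_dvd]
    have := dvd_sub (hS m hm).2 (hS m' hm').2
    simpa using this
  · intro m hm
    exact ⟨by positivity, by simpa using (hS m hm).1⟩

lemma dX (γ X : ℝ) (hγ1 : γ < 1) (hX : 1 ≤ X) (d : ℕ) (hdX : (d:ℝ) ≤ X ^ (21/110 - 443/55 * (1 - γ))) : (d:ℝ) ≤ X ^ (1/5:ℝ) :=
  hdX.trans (Real.rpow_le_rpow_of_exponent_le hX (by linarith))

/-- number of n with fractional part near one -/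
lemma indA (γ : ℝ) (hγ0 : 865/886 < γ) (hγ1 : γ < 1) :
    ∃ X₀ : ℝ, 2 ≤ X₀ ∧ ∀ X, X₀ ≤ X → ∀ (a : ℤ) (d : ℕ), 0 < d → (d:ℝ) ≤ X ^ (21/110 - 443/55 * (1 - γ)) →
      ∑ n ∈ Sset a d (X ^ (γ - 2/100000)) ⌊X⌋₊, ind (X ^ (-(1 - γ) - 2/100000)) (-((n:ℝ)^γ))
        ≤ 136 * (1 + Real.log X) * (X ^ (1 - (1 - γ) - 2/100000) / d) := by
  obtain ⟨X₁, hX₁, h₁⟩ := typeI γ 1 hγ0 hγ1 one_pos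
  obtain ⟨X₂, hX₂, h₂⟩ := ev_const 8 ((1 - γ) + 2/100000) (by linarith)
  refine ⟨max X₁ X₂, hX₁.trans (le_max_left _ _), ?_⟩
  intro X hX a d hd hdX
  have hA1 : X₁ ≤ X := (le_max_left _ _).trans hX
  have g2 := h₂ X ((le_max_right _ _).trans hX)
  have hX1 : 1 ≤ X := by linarith
  have hl : 0 ≤ Real.log X := Real.log_nonneg hX1
  have hX0 : 0 < X := by linarith
  have hd0 : (0:ℝ) < d := by exact_mod_cast hd
  set N := ⌊X⌋₊ with hN
  have hNX : (N:ℝ) ≤ X := Nat.floor_le (by linarith)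
  set Δ := X ^ (-(1 - γ) - 2/100000) with hΔ
  set Z := X ^ ((1 - γ) + 2/100000) with hZ
  have hΔ0 : 0 < Δ := by positivity
  have hZΔ : Z * Δ = 1 := by rw [hZ, hΔ, ← Real.rpow_add hX0]; ring_nf; simp
  set J := ⌊Z / 8⌋₊ with hJ
  have hJ1 : 1 ≤ J := Nat.le_floor (by push_cast; linarith)
  have hJZ : (J:ℝ) ≤ Z / 8 := Nat.floor_le (by positivity)
  have hJ0 : (0:ℝ) < J := by exact_mod_cast hJ1
  have hJZ' : Z / 16 ≤ J := by
    have h1 := Nat.lt_floor_add_one (Z/8)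
    have h2 : (1:ℝ) ≤ J := by exact_mod_cast hJ1
    linarith
  have hJΔ : 8 * J * Δ ≤ 1 := by
    rw [← hZΔ]; exact mul_le_mul_of_nonneg_right (by linarith) hΔ0.le
  have hJinv : 1 / (J:ℝ) ≤ 16 * Δ := by
    rw [div_le_iff₀ hJ0]
    nlinarith
  set S := Sset a d (X ^ (γ - 2/100000)) N with hS
  have hSc : (#S:ℝ) ≤ 2 * (X / d) := by
    refine card_res d hd a X ?_ S ?_
    · refine (dX γ X hγ1 hX1 d hdX).trans ?_
      calc X ^ (1/5:ℝ) ≤ X ^ (1:ℝ) := Real.rpow_le_rpow_of_exponent_le hX1 (by norm_num)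
        _ = X := Real.rpow_one X
    · intro n hn
      rw [hS, mem_Sset] at hn
      exact ⟨le_trans (by exact_mod_cast hn.1.2) hNX, hn.2.2⟩
  set E := 2 * (1 + Real.log X) * (X ^ (1 - (2 * (1 - γ) + 1/5000)) / d) with hE
  have key := ind_sum Δ J hJ1 hJΔ S (fun n => -((n:ℝ)^γ)) E ?_ (by positivity)
  · refine key.trans ?_
    have hXΔ : X * Δ = X ^ (1 - (1 - γ) - 2/100000) := by
      rw [hΔ]; nth_rw 1 [← Real.rpow_one X]; rw [← Real.rpow_add hX0]; ring_nf
    have k1 : 4 * (#S:ℝ) / J ≤ 128 * (X ^ (1 - (1 - γ) - 2/100000) / d) := by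
      calc 4 * (#S:ℝ) / J = 4 * #S * (1 / J) := by ring
        _ ≤ 4 * (2 * (X / d)) * (16 * Δ) := by gcongr
        _ = 128 * (X * Δ / d) := by ring
        _ = _ := by rw [hXΔ]
    have k2 : E ≤ 2 * (1 + Real.log X) * (X ^ (1 - (1 - γ) - 2/100000) / d) := by
      rw [hE]
      refine mul_le_mul_of_nonneg_left (div_le_div_of_nonneg_right ?_ hd0.le) (by positivity)
      exact Real.rpow_le_rpow_of_exponent_le hX1 (by linarith)
    have k3 : 0 ≤ (X ^ (1 - (1 - γ) - 2/100000) / d) * Real.log X := by positivity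
    linarith
  · intro h hh1 hh2
    have P : Par γ 1 X d (-h) 0 (X ^ (γ - 2/100000)) X := by
      refine ⟨hd, hdX, by rwa [abs_neg], ?_, ?_, rfl, le_rfl⟩
      · rw [abs_neg]
        refine hh2.trans (hJZ.trans ?_)
        have : Z ≤ X ^ (2 * (1 - γ) + 4/100000) := Real.rpow_le_rpow_of_exponent_le hX1 (by linarith)
        have : 0 < Z := by positivity
        linarith
      · rw [abs_zero]; positivity
    have := h₁ X hA1 a d (-h) 0 (X ^ (γ - 2/100000)) X P 1 N le_rfl (by simpa using Real.one_le_rpow hX1 (by norm_num)) (Nat.coprime_one_left d)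
    have e1 : ∑ n ∈ S, e (h * -((n:ℝ)^γ)) = ∑ k ∈ Icc 1 N, W γ 1 a d (-h) 0 (X ^ (γ - 2/100000)) X (1 * k) := by
      rw [hS]; unfold Sset
      rw [Finset.sum_filter]
      refine Finset.sum_congr rfl fun n hn => ?_
      have hnX : (n:ℝ) ≤ X := le_trans (by exact_mod_cast (Finset.mem_Icc.1 hn).2) hNX
      unfold W
      simp only [one_mul, hnX, true_and, zero_mul, add_zero, neg_mul, mul_neg]
    rw [e1]
    refine this.trans (le_of_eq ?_)
    rw [hE, Nat.cast_one, one_mul]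

lemma indB (γ Δ Y : ℝ) (a : ℤ) (d N : ℕ) :
    ∑ n ∈ Sset a d Y N, ind Δ (-(((n:ℝ)+1)^γ)) ≤ ∑ n ∈ Sset (a+1) d Y N, ind Δ (-((n:ℝ)^γ)) + 1 := by
  have e1 : ∑ n ∈ Sset a d Y N, ind Δ (-(((n:ℝ)+1)^γ)) = ∑ n ∈ (Sset a d Y N).map (addRightEmbedding 1), ind Δ (-((n:ℝ)^γ)) := by
    rw [Finset.sum_map]; simp
  have hsub : (Sset a d Y N).map (addRightEmbedding 1) ⊆ insert (N+1) (Sset (a+1) d Y N) := by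
    intro k hk
    obtain ⟨n, hn, rfl⟩ := Finset.mem_map.1 hk
    rw [mem_Sset] at hn
    simp only [addRightEmbedding_apply, Finset.mem_insert]
    by_cases h : n = N
    · left; rw [h]
    · right; rw [mem_Sset]
      refine ⟨⟨by omega, by omega⟩, by push_cast; linarith, ?_⟩
      push_cast; simpa using hn.2.2
  rw [e1]
  refine (Finset.sum_le_sum_of_subset_of_nonneg hsub (fun _ _ _ => ind_nonneg _ _)).trans ?_
  have h1 : ind Δ (-(((N+1:ℕ):ℝ)^γ)) ≤ 1 := by unfold ind; split_ifs <;> norm_num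
  by_cases h : N+1 ∈ Sset (a+1) d Y N
  · rw [mem_Sset] at h; omega
  · rw [Finset.sum_insert h]; linarith

lemma saw_diff (x y : ℝ) : |saw x - saw y| ≤ 1 := by
  unfold saw
  rw [abs_le]
  constructor <;> linarith [Int.fract_nonneg x, Int.fract_lt_one x, Int.fract_nonneg y, Int.fract_lt_one y]
end BVP

namespace BVP
open Finset

lemma norm_coef (γ t c X : ℝ) (hγ1 : γ < 1) (n : ℕ) (hn1 : 1 ≤ n) (hnX : (n:ℝ) ≤ X) :
    ‖(VM n : ℂ) * (((n:ℝ) ^ (1 - γ) : ℝ) : ℂ) * e (t * (n:ℝ)^c)‖ ≤ X ^ (1 - γ) * (1 + Real.log X) := by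
  have hn0 : (0:ℝ) < n := by exact_mod_cast hn1
  have hX1 : 1 ≤ X := le_trans (by exact_mod_cast hn1) hnX
  rw [norm_mul, norm_mul, norm_e, mul_one, Complex.norm_real, Complex.norm_real, Real.norm_eq_abs, Real.norm_eq_abs,
    abs_of_nonneg ArithmeticFunction.vonMangoldt_nonneg, abs_of_nonneg (by positivity : (0:ℝ) ≤ (n:ℝ)^(1-γ)), mul_comm]
  refine mul_le_mul (Real.rpow_le_rpow hn0.le hnX (by linarith)) ?_ ArithmeticFunction.vonMangoldt_nonneg (by positivity)
  have h1 : VM n ≤ Real.log n := ArithmeticFunction.vonMangoldt_le_log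
  have := Real.log_le_log hn0 hnX
  linarith

/-- main term -/
lemma main_part (γ c : ℝ) (hγ0 : 865/886 < γ) (hγ1 : γ < 1) (hc : 0 < c) :
    ∃ X₀ : ℝ, 2 ≤ X₀ ∧ ∀ X, X₀ ≤ X → ∀ (a : ℤ) (d : ℕ) (t : ℝ), 0 < d → (d:ℝ) ≤ X ^ (21/110 - 443/55 * (1 - γ)) →
      |t| ≤ X ^ (1/4 - c) → Int.gcd (d:ℤ) a = 1 →
      ‖∑ n ∈ Sset a d (X ^ (γ - 2/100000)) ⌊X⌋₊, (VM n : ℂ) * (((n:ℝ) ^ (1 - γ) : ℝ) : ℂ) * e (t * (n:ℝ)^c) *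
        (PK (X ^ (-(1 - γ) - 2/100000)) ⌊X ^ (2 * (1 - γ) + 4/100000)⌋₊ (-(((n:ℝ)+1)^γ))
          - PK (X ^ (-(1 - γ) - 2/100000)) ⌊X ^ (2 * (1 - γ) + 4/100000)⌋₊ (-((n:ℝ)^γ)))‖
        ≤ 4 * (1 + Real.log X)^2 * (X ^ (1 - 2/100000 : ℝ) / d) := by
  obtain ⟨X₀, hX₀, h₀⟩ := main_h γ c hγ0 hγ1 hc
  refine ⟨X₀, hX₀, ?_⟩
  intro X hX a d t hd hdX ht hda
  have hX1 : 1 ≤ X := by linarith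
  have hl : 0 ≤ Real.log X := Real.log_nonneg hX1
  have hX0 : 0 < X := by linarith
  have hd0 : (0:ℝ) < d := by exact_mod_cast hd
  set N := ⌊X⌋₊ with hN
  set Δ := X ^ (-(1 - γ) - 2/100000) with hΔ
  have hΔ0 : 0 < Δ := by positivity
  set H := X ^ (2 * (1 - γ) + 4/100000) with hH
  set K := ⌊H⌋₊ with hK
  have hKH : (K:ℝ) ≤ H := Nat.floor_le (by positivity)
  have hHX : H ≤ X := by
    calc H ≤ X ^ (1:ℝ) := Real.rpow_le_rpow_of_exponent_le hX1 (by linarith)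
      _ = X := Real.rpow_one X
  set Y := X ^ (γ - 2/100000) with hY
  set S := Sset a d Y N with hS
  set cf : ℕ → ℂ := fun n => (VM n : ℂ) * (((n:ℝ) ^ (1 - γ) : ℝ) : ℂ) * e (t * (n:ℝ)^c) with hcf
  set Q := X ^ (1 - (1 - γ) - 5/100000) / (d:ℝ) with hQ
  have hQ0 : 0 ≤ Q := by positivity
  have hh : ∀ h : ℝ, 1 ≤ |h| → |h| ≤ K → ‖∑ n ∈ S, cf n * (e (h * ((n:ℝ)+1)^γ) - e (h * (n:ℝ)^γ))‖ ≤ 8 * Real.pi * |h| * (1 + Real.log X) * Q := by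
    intro h h1 h2
    exact h₀ X hX a d h t Y ⟨hd, hdX, h1, h2.trans hKH, ht, rfl, le_rfl⟩ hda
  have e1 : ∑ n ∈ S, cf n * (PK Δ K (-(((n:ℝ)+1)^γ)) - PK Δ K (-((n:ℝ)^γ)))
      = ∑ k ∈ Icc 1 K, (bc Δ k * ∑ n ∈ S, cf n * (e ((-k:ℝ) * ((n:ℝ)+1)^γ) - e ((-k:ℝ) * (n:ℝ)^γ))
        + bc Δ (-k) * ∑ n ∈ S, cf n * (e ((k:ℝ) * ((n:ℝ)+1)^γ) - e ((k:ℝ) * (n:ℝ)^γ))) := by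
    unfold PK
    simp_rw [← Finset.sum_sub_distrib, Finset.mul_sum]
    rw [Finset.sum_comm]
    refine Finset.sum_congr rfl fun k _ => ?_
    rw [← Finset.sum_add_distrib]
    refine Finset.sum_congr rfl fun n _ => ?_
    simp only [mul_neg, neg_mul, neg_neg]
    ring
  rw [e1]
  have hterm : ∀ k ∈ Icc 1 K, ‖bc Δ k * ∑ n ∈ S, cf n * (e ((-k:ℝ) * ((n:ℝ)+1)^γ) - e ((-k:ℝ) * (n:ℝ)^γ))
        + bc Δ (-k) * ∑ n ∈ S, cf n * (e ((k:ℝ) * ((n:ℝ)+1)^γ) - e ((k:ℝ) * (n:ℝ)^γ))‖ ≤ 4 * (1 + Real.log X) * (Q / Δ) * (1 / k) := by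
    intro k hk
    have hk' := Finset.mem_Icc.1 hk
    have hk0 : (0:ℝ) < k := by exact_mod_cast hk'.1
    have hk1 : (1:ℝ) ≤ k := by exact_mod_cast hk'.1
    have hkK : (k:ℝ) ≤ K := by exact_mod_cast hk'.2
    have a1 := hh (-k) (by rw [abs_neg, abs_of_pos hk0]; exact hk1) (by rw [abs_neg, abs_of_pos hk0]; exact hkK)
    have a2 := hh k (by rw [abs_of_pos hk0]; exact hk1) (by rw [abs_of_pos hk0]; exact hkK)
    rw [abs_neg, abs_of_pos hk0] at a1
    rw [abs_of_pos hk0] at a2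
    have b1 := norm_bc Δ k hΔ0 hk0.ne'
    have b2 := norm_bc Δ (-k) hΔ0 (neg_ne_zero.2 hk0.ne')
    rw [neg_sq] at b2
    refine (norm_add_le _ _).trans ?_
    rw [norm_mul, norm_mul]
    have m1 := mul_le_mul b1 a1 (norm_nonneg _) (by positivity)
    have m2 := mul_le_mul b2 a2 (norm_nonneg _) (by positivity)
    refine (add_le_add m1 m2).trans ?_
    have : 1 / (18 * Δ * (k:ℝ)^2) * (8 * Real.pi * k * (1 + Real.log X) * Q) = (4 * Real.pi / 9) * ((1 + Real.log X) * (Q / Δ) * (1 / k)) := by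
      field_simp; ring
    rw [this]
    have hpos : 0 ≤ (1 + Real.log X) * (Q / Δ) * (1 / k) := by positivity
    have := mul_le_mul_of_nonneg_right (by linarith [Real.pi_lt_four] : 4 * Real.pi / 9 ≤ 2) hpos
    linarith
  refine (norm_sum_le _ _).trans ((Finset.sum_le_sum hterm).trans ?_)
  rw [← Finset.mul_sum]
  have hQΔ : Q / Δ ≤ X ^ (1 - 2/100000 : ℝ) / d := by
    rw [hQ, hΔ, div_div, mul_comm, ← div_div, ← Real.rpow_sub hX0]
    refine div_le_div_of_nonneg_right (Real.rpow_le_rpow_of_exponent_le hX1 (by linarith)) hd0.le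
  calc _ ≤ 4 * (1 + Real.log X) * (X ^ (1 - 2/100000 : ℝ) / d) * (1 + Real.log X) := by
        refine mul_le_mul ?_ (harm K X hX1 (hKH.trans hHX)) (Finset.sum_nonneg fun _ _ => by positivity) (by positivity)
        exact mul_le_mul_of_nonneg_left hQΔ (by positivity)
    _ = _ := by ring

/-- lambda sum with sawtooth -/
lemma lam_part (γ c : ℝ) (hγ0 : 865/886 < γ) (hγ1 : γ < 1) (hc : 0 < c) :
    ∃ X₀ : ℝ, 2 ≤ X₀ ∧ ∀ X, X₀ ≤ X → ∀ (a : ℤ) (d : ℕ) (t : ℝ), 0 < d → (d:ℝ) ≤ X ^ (21/110 - 443/55 * (1 - γ)) →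
      |t| ≤ X ^ (1/4 - c) → Int.gcd (d:ℤ) a = 1 →
      ‖∑ n ∈ Sset a d (X ^ (γ - 2/100000)) ⌊X⌋₊, (VM n : ℂ) * (((n:ℝ) ^ (1 - γ) : ℝ) : ℂ) * e (t * (n:ℝ)^c) *
        ((saw (-(((n:ℝ)+1)^γ)) : ℂ) - (saw (-((n:ℝ)^γ)) : ℂ))‖
        ≤ 300 * (1 + Real.log X)^2 * (X ^ (1 - 2/100000 : ℝ) / d) := by
  obtain ⟨X₁, hX₁, h₁⟩ := main_part γ c hγ0 hγ1 hc
  obtain ⟨X₂, hX₂, h₂⟩ := indA γ hγ0 hγ1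
  refine ⟨max X₁ X₂, hX₁.trans (le_max_left _ _), ?_⟩
  intro X hX a d t hd hdX ht hda
  have hA1 : X₁ ≤ X := (le_max_left _ _).trans hX
  have hA2 : X₂ ≤ X := (le_max_right _ _).trans hX
  have hX1 : 1 ≤ X := by linarith
  have hX1' : 1 < X := by linarith
  have hl : 0 ≤ Real.log X := Real.log_nonneg hX1
  have hX0 : 0 < X := by linarith
  have hd0 : (0:ℝ) < d := by exact_mod_cast hd
  have m := h₁ X hA1 a d t hd hdX ht hda
  have i0 := h₂ X hA2 a d hd hdX
  have i1 := (indB γ (X ^ (-(1 - γ) - 2/100000)) (X ^ (γ - 2/100000)) a d ⌊X⌋₊).trans (add_le_add_left (h₂ X hA2 (a+1) d hd hdX) 1)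
  clear h₁ h₂
  set N := ⌊X⌋₊ with hN
  have hNX : (N:ℝ) ≤ X := Nat.floor_le (by linarith)
  set Δ := X ^ (-(1 - γ) - 2/100000) with hΔ
  have hΔ0 : 0 < Δ := by positivity
  have hΔ1 : Δ < 1 := Real.rpow_lt_one_of_one_lt_of_neg hX1' (by linarith)
  set H := X ^ (2 * (1 - γ) + 4/100000) with hH
  set K := ⌊H⌋₊ with hK
  have hH1 : 1 ≤ H := Real.one_le_rpow hX1 (by linarith)
  have hK1 : 1 ≤ K := Nat.le_floor (by simpa using hH1)
  have hKH : H / 2 ≤ K := by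
    have h1 := Nat.lt_floor_add_one H
    have h2 : (1:ℝ) ≤ K := by exact_mod_cast hK1
    linarith
  have hK0 : (0:ℝ) < K := by exact_mod_cast hK1
  have hΔK : 1 / (Δ * K) ≤ 2 * Δ := by
    have hHΔ : H * Δ * Δ = 1 := by
      rw [hH, hΔ, ← Real.rpow_add hX0, ← Real.rpow_add hX0]; ring_nf; simp
    rw [div_le_iff₀ (by positivity)]
    nlinarith [mul_pos hΔ0 hΔ0]
  set Y := X ^ (γ - 2/100000) with hY
  set S := Sset a d Y N with hS
  set cf : ℕ → ℂ := fun n => (VM n : ℂ) * (((n:ℝ) ^ (1 - γ) : ℝ) : ℂ) * e (t * (n:ℝ)^c) with hcf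
  have hSc : (#S:ℝ) ≤ 2 * (X / d) := by
    refine card_res d hd a X ?_ S ?_
    · refine (dX γ X hγ1 hX1 d hdX).trans ?_
      calc X ^ (1/5:ℝ) ≤ X ^ (1:ℝ) := Real.rpow_le_rpow_of_exponent_le hX1 (by norm_num)
        _ = X := Real.rpow_one X
    · intro n hn
      rw [hS, mem_Sset] at hn
      exact ⟨le_trans (by exact_mod_cast hn.1.2) hNX, hn.2.2⟩
  set L := 1 + Real.log X with hL
  have hL1 : 1 ≤ L := by linarith
  set G := X ^ (1 - γ) with hG
  have hG0 : 0 < G := by positivity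
  set R := X ^ (1 - (1 - γ) - 2/100000) / (d:ℝ) with hR
  have hR0 : 0 ≤ R := by positivity
  have hXΔ : X * Δ = X ^ (1 - (1 - γ) - 2/100000) := by
    rw [hΔ]; nth_rw 1 [← Real.rpow_one X]; rw [← Real.rpow_add hX0]; ring_nf
  have hR1 : 1 ≤ R := by
    rw [hR, le_div_iff₀ hd0, one_mul]
    refine (dX γ X hγ1 hX1 d hdX).trans (Real.rpow_le_rpow_of_exponent_le hX1 (by linarith))
  have hGR : G * R = X ^ (1 - 2/100000 : ℝ) / d := by
    rw [hG, hR, ← mul_div_assoc, ← Real.rpow_add hX0]; ring_nf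
  have e1 : ∑ n ∈ S, cf n * ((saw (-(((n:ℝ)+1)^γ)) : ℂ) - (saw (-((n:ℝ)^γ)) : ℂ))
      = ∑ n ∈ S, cf n * (PK Δ K (-(((n:ℝ)+1)^γ)) - PK Δ K (-((n:ℝ)^γ)))
        + ∑ n ∈ S, cf n * (((saw (-(((n:ℝ)+1)^γ)) : ℂ) - PK Δ K (-(((n:ℝ)+1)^γ))) - ((saw (-((n:ℝ)^γ)) : ℂ) - PK Δ K (-((n:ℝ)^γ)))) := by
    rw [← Finset.sum_add_distrib]
    exact Finset.sum_congr rfl fun n _ => by ring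
  rw [e1]
  have hE : ‖∑ n ∈ S, cf n * (((saw (-(((n:ℝ)+1)^γ)) : ℂ) - PK Δ K (-(((n:ℝ)+1)^γ))) - ((saw (-((n:ℝ)^γ)) : ℂ) - PK Δ K (-((n:ℝ)^γ))))‖
      ≤ G * L * (290 * L * R) := by
    calc _ ≤ ∑ n ∈ S, G * L * (5 * Δ + ind Δ (-(((n:ℝ)+1)^γ)) + ind Δ (-((n:ℝ)^γ))) := by
          refine (norm_sum_le _ _).trans (Finset.sum_le_sum fun n hn => ?_)
          rw [hS, mem_Sset] at hn
          rw [norm_mul]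
          refine mul_le_mul (norm_coef γ t c X hγ1 n hn.1.1 (le_trans (by exact_mod_cast hn.1.2) hNX)) ?_ (norm_nonneg _) (by positivity)
          refine (norm_sub_le _ _).trans ?_
          have q1 := saw_fourier Δ (-(((n:ℝ)+1)^γ)) K hΔ0 hΔ1 hK1
          have q2 := saw_fourier Δ (-((n:ℝ)^γ)) K hΔ0 hΔ1 hK1
          linarith
      _ = G * L * (#S * (5 * Δ) + ∑ n ∈ S, ind Δ (-(((n:ℝ)+1)^γ)) + ∑ n ∈ S, ind Δ (-((n:ℝ)^γ))) := by
          rw [← Finset.mul_sum, Finset.sum_add_distrib, Finset.sum_add_distrib, Finset.sum_const, nsmul_eq_mul]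
      _ ≤ G * L * (290 * L * R) := by
          refine mul_le_mul_of_nonneg_left ?_ (by positivity)
          have k1 : #S * (5 * Δ) ≤ 10 * R := by
            calc #S * (5 * Δ) ≤ 2 * (X / d) * (5 * Δ) := mul_le_mul_of_nonneg_right hSc (by positivity)
              _ = 10 * (X * Δ / d) := by ring
              _ = _ := by rw [hXΔ]
          have k2 : R ≤ L * R := le_mul_of_one_le_left hR0 hL1
          linarith
  refine (norm_add_le _ _).trans ((add_le_add m hE).trans ?_)
  rw [← hGR]
  have : 0 ≤ L^2 * (G * R) := by positivity
  linarith
end BVP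

namespace BVP
open Finset

lemma nonprime_sum (X : ℝ) (hX : 1 ≤ X) (S : Finset ℕ) (hS : ∀ n ∈ S, n ≤ ⌊X⌋₊ ∧ ¬ n.Prime) :
    ∑ n ∈ S, VM n ≤ 2 * Real.sqrt X * Real.log X := by
  have h1 := (le_abs_self _).trans (Chebyshev.abs_psi_sub_theta_le_sqrt_mul_log hX)
  refine le_trans ?_ h1
  rw [Chebyshev.psi_eq_sum_Icc, Chebyshev.theta_eq_sum_Icc,
    ← Finset.sum_filter_add_sum_filter_not (Icc 0 ⌊X⌋₊) (fun n => n.Prime) (fun n => ArithmeticFunction.vonMangoldt n)]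
  have e1 : ∑ p ∈ Icc 0 ⌊X⌋₊ with p.Prime, ArithmeticFunction.vonMangoldt p = ∑ p ∈ Icc 0 ⌊X⌋₊ with p.Prime, Real.log p :=
    Finset.sum_congr rfl fun p hp => ArithmeticFunction.vonMangoldt_apply_prime (Finset.mem_filter.1 hp).2
  rw [e1, add_sub_cancel_left]
  refine Finset.sum_le_sum_of_subset_of_nonneg ?_ (fun _ _ _ => ArithmeticFunction.vonMangoldt_nonneg)
  intro n hn
  rw [Finset.mem_filter, Finset.mem_Icc]
  exact ⟨⟨Nat.zero_le _, (hS n hn).1⟩, (hS n hn).2⟩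

open scoped Classical in
lemma perd (γ c : ℝ) (hγ0 : 865/886 < γ) (hγ1 : γ < 1) (hc : 0 < c) :
    ∃ X₀ : ℝ, 2 ≤ X₀ ∧ ∀ X, X₀ ≤ X → ∀ (a : ℤ) (d : ℕ) (t : ℝ), 0 < d → (d:ℝ) ≤ X ^ (21/110 - 443/55 * (1 - γ)) →
      |t| ≤ X ^ (1/4 - c) → Int.gcd (d:ℤ) a = 1 →
      ‖∑ p ∈ (Finset.Icc 1 ⌊X⌋₊).filter
                (fun p : ℕ => p.Prime ∧ (d : ℤ) ∣ ((p : ℤ) - a)),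
              (((p : ℝ) ^ (1 - γ) * (saw (-(((p : ℝ) + 1) ^ γ)) - saw (-((p : ℝ) ^ γ)))
                  * Real.log p : ℝ) : ℂ) * e (t * (p : ℝ) ^ c)‖ ≤ X ^ (1 - 1/100000 : ℝ) / d := by
  obtain ⟨X₁, hX₁, h₁⟩ := lam_part γ c hγ0 hγ1 hc
  obtain ⟨X₂, hX₂, h₂⟩ := ev_log 304 (1/100000) 2 (by norm_num)
  refine ⟨max X₁ X₂, hX₁.trans (le_max_left _ _), ?_⟩
  intro X hX a d t hd hdX ht hda
  have hA1 : X₁ ≤ X := (le_max_left _ _).trans hX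
  have g2 := h₂ X ((le_max_right _ _).trans hX)
  have m := h₁ X hA1 a d t hd hdX ht hda
  clear h₁ h₂
  have hX1 : 1 ≤ X := by linarith
  have hl : 0 ≤ Real.log X := Real.log_nonneg hX1
  have hX0 : 0 < X := by linarith
  have hd0 : (0:ℝ) < d := by exact_mod_cast hd
  set N := ⌊X⌋₊ with hN
  have hNX : (N:ℝ) ≤ X := Nat.floor_le (by linarith)
  set Y := X ^ (γ - 2/100000) with hY
  set S := Sset a d Y N with hS
  set F : ℕ → ℂ := fun n => (VM n : ℂ) * (((n:ℝ) ^ (1 - γ) : ℝ) : ℂ) * e (t * (n:ℝ)^c) *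
        ((saw (-(((n:ℝ)+1)^γ)) : ℂ) - (saw (-((n:ℝ)^γ)) : ℂ)) with hF
  set A := (Finset.Icc 1 N).filter (fun p : ℕ => p.Prime ∧ (d : ℤ) ∣ ((p : ℤ) - a)) with hA
  set G := X ^ (1 - γ) with hG
  set L := 1 + Real.log X with hL
  have hL1 : 1 ≤ L := by linarith
  set R := X ^ (1 - 2/100000 : ℝ) / (d:ℝ) with hR
  have hR0 : 0 ≤ R := by positivity
  have e1 : ∑ p ∈ A, (((p : ℝ) ^ (1 - γ) * (saw (-(((p : ℝ) + 1) ^ γ)) - saw (-((p : ℝ) ^ γ)))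
                  * Real.log p : ℝ) : ℂ) * e (t * (p : ℝ) ^ c) = ∑ p ∈ A, F p := by
    refine Finset.sum_congr rfl fun p hp => ?_
    have hpp := (Finset.mem_filter.1 hp).2.1
    have : VM p = Real.log p := ArithmeticFunction.vonMangoldt_apply_prime hpp
    simp only [hF, this]
    push_cast; ring
  have e2 : ∑ p ∈ A, F p = ∑ p ∈ A.filter (fun p : ℕ => (p:ℝ) ≤ Y), F p + ∑ p ∈ A.filter (fun p : ℕ => ¬ (p:ℝ) ≤ Y), F p :=
    (Finset.sum_filter_add_sum_filter_not _ _ _).symm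
  have e3 : ∑ n ∈ S, F n = ∑ n ∈ S with n.Prime, F n + ∑ n ∈ S with ¬ n.Prime, F n :=
    (Finset.sum_filter_add_sum_filter_not _ _ _).symm
  have e4 : A.filter (fun p : ℕ => ¬ (p:ℝ) ≤ Y) = S.filter (fun n => n.Prime) := by
    ext n
    simp only [hA, hS, Finset.mem_filter, mem_Sset, Finset.mem_Icc, not_le]
    tauto
  have e5 : ∑ p ∈ A, F p = ∑ p ∈ A.filter (fun p : ℕ => (p:ℝ) ≤ Y), F p + ∑ n ∈ S, F n - ∑ n ∈ S with ¬ n.Prime, F n := by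
    rw [e2, e4, e3]; ring
  have hsaw : ∀ n : ℕ, ‖(saw (-(((n:ℝ)+1)^γ)) : ℂ) - (saw (-((n:ℝ)^γ)) : ℂ)‖ ≤ 1 := by
    intro n
    rw [← Complex.ofReal_sub, Complex.norm_real]
    exact saw_diff _ _
  have b1 : ‖∑ p ∈ A.filter (fun p : ℕ => (p:ℝ) ≤ Y), F p‖ ≤ 2 * L * R := by
    have hc1 : (#(A.filter (fun p : ℕ => (p:ℝ) ≤ Y)) : ℝ) ≤ 2 * (Y / d) := by
      refine card_res d hd a Y ?_ _ ?_
      · exact (dX γ X hγ1 hX1 d hdX).trans (Real.rpow_le_rpow_of_exponent_le hX1 (by linarith))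
      · intro n hn
        rw [Finset.mem_filter, hA, Finset.mem_filter] at hn
        exact ⟨hn.2, hn.1.2.2⟩
    calc _ ≤ ∑ p ∈ A.filter (fun p : ℕ => (p:ℝ) ≤ Y), G * L := by
          refine (norm_sum_le _ _).trans (Finset.sum_le_sum fun n hn => ?_)
          rw [Finset.mem_filter, hA, Finset.mem_filter, Finset.mem_Icc] at hn
          rw [hF]; simp only
          rw [norm_mul]
          calc _ ≤ G * L * 1 := mul_le_mul (norm_coef γ t c X hγ1 n hn.1.1.1 (le_trans (by exact_mod_cast hn.1.1.2) hNX)) (hsaw n) (norm_nonneg _) (by positivity)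
            _ = _ := mul_one _
      _ = #(A.filter (fun p : ℕ => (p:ℝ) ≤ Y)) * (G * L) := by rw [Finset.sum_const, nsmul_eq_mul]
      _ ≤ 2 * (Y / d) * (G * L) := mul_le_mul_of_nonneg_right hc1 (by positivity)
      _ = 2 * L * (Y * G / d) := by ring
      _ = 2 * L * R := by rw [hY, hG, ← Real.rpow_add hX0, hR]; ring_nf
  have b2 : ‖∑ n ∈ S with ¬ n.Prime, F n‖ ≤ 2 * L * R := by
    have hnp := nonprime_sum X hX1 (S.filter (fun n => ¬ n.Prime)) (by
      intro n hn
      rw [Finset.mem_filter, hS, mem_Sset] at hn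
      exact ⟨hn.1.1.2, hn.2⟩)
    calc _ ≤ ∑ n ∈ S with ¬ n.Prime, G * VM n := by
          refine (norm_sum_le _ _).trans (Finset.sum_le_sum fun n hn => ?_)
          rw [Finset.mem_filter, hS, mem_Sset] at hn
          rw [hF]; simp only
          have hnX : (n:ℝ) ≤ X := le_trans (by exact_mod_cast hn.1.1.2) hNX
          have hL0 : 0 ≤ VM n := ArithmeticFunction.vonMangoldt_nonneg
          rw [norm_mul, norm_mul, norm_mul, norm_e, mul_one, Complex.norm_real, Complex.norm_real, Real.norm_eq_abs, Real.norm_eq_abs,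
            abs_of_nonneg hL0, abs_of_nonneg (by positivity : (0:ℝ) ≤ (n:ℝ)^(1-γ)), mul_comm (VM n)]
          calc _ ≤ G * VM n * 1 := by
                refine mul_le_mul (mul_le_mul_of_nonneg_right ?_ hL0) (hsaw n) (norm_nonneg _) (by positivity)
                exact Real.rpow_le_rpow (by positivity) hnX (by linarith)
            _ = _ := mul_one _
      _ = G * ∑ n ∈ S with ¬ n.Prime, VM n := by rw [Finset.mul_sum]
      _ ≤ G * (2 * Real.sqrt X * Real.log X) := mul_le_mul_of_nonneg_left hnp (by positivity)
      _ ≤ G * (2 * Real.sqrt X * L) := by gcongr; linarith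
      _ = 2 * L * (G * X ^ (1/2:ℝ)) := by rw [Real.sqrt_eq_rpow]; ring
      _ ≤ 2 * L * R := by
          refine mul_le_mul_of_nonneg_left ?_ (by positivity)
          rw [hR, le_div_iff₀ hd0]
          calc G * X ^ (1/2:ℝ) * d ≤ G * X ^ (1/2:ℝ) * X ^ (1/5:ℝ) := mul_le_mul_of_nonneg_left (dX γ X hγ1 hX1 d hdX) (by positivity)
            _ = X ^ ((1 - γ) + 1/2 + 1/5 : ℝ) := by rw [hG, ← Real.rpow_add hX0, ← Real.rpow_add hX0]
            _ ≤ _ := Real.rpow_le_rpow_of_exponent_le hX1 (by linarith)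
  rw [e1, e5]
  refine (norm_sub_le _ _).trans ?_
  refine (add_le_add (norm_add_le _ _) le_rfl).trans ?_
  have hLL : L * R ≤ L^2 * R := by
    refine mul_le_mul_of_nonneg_right ?_ hR0
    nlinarith
  have hfin : X ^ (1/100000:ℝ) * R = X ^ (1 - 1/100000 : ℝ) / d := by
    rw [hR, ← mul_div_assoc, ← Real.rpow_add hX0]; norm_num
  rw [← hfin]
  have := mul_le_mul_of_nonneg_right g2 hR0
  linarith
end BVP

open scoped Classical in
/-- For `865/886 < γ < 1`, `a ≠ 0`, `1 < c < 3`, `c ≠ 2`, `A > 0`, sufficiently small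
`ε > 0`, `θ = (443/55)γ - 173/22 - ε`, `D = X^θ`, sufficiently large `X` and
`|t| < X^{1/4-c}`,
`∑_{d ≤ D, (d,a)=1} |∑_{p ≤ X, p ≡ a (d)} p^{1-γ}(ψ(-(p+1)^γ) - ψ(-p^γ)) e(tp^c) log p|
  ≪ X/(log X)^A`. -/
theorem BV_psi_term (γ : ℝ) (hγ₁ : 865 / 886 < γ) (hγ₂ : γ < 1)
    (a : ℤ) (ha : a ≠ 0) (c : ℝ) (hc₁ : 1 < c) (hc₂ : c < 3) (hc₃ : c ≠ 2)
    (A : ℝ) (hA : 0 < A) :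
    ∃ ε₀ : ℝ, 0 < ε₀ ∧ ∀ ε : ℝ, 0 < ε → ε < ε₀ →
      ∃ C : ℝ, 0 < C ∧ ∃ X₀ : ℝ, ∀ X : ℝ, X₀ ≤ X → ∀ t : ℝ, |t| < X ^ ((1 : ℝ) / 4 - c) →
        ∑ d ∈ (Finset.Icc 1 ⌊X ^ ((443 / 55) * γ - 173 / 22 - ε)⌋₊).filter
            (fun d : ℕ => Int.gcd (d : ℤ) a = 1),
          ‖∑ p ∈ (Finset.Icc 1 ⌊X⌋₊).filter
                (fun p : ℕ => p.Prime ∧ (d : ℤ) ∣ ((p : ℤ) - a)),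
              (((p : ℝ) ^ (1 - γ) * (saw (-(((p : ℝ) + 1) ^ γ)) - saw (-((p : ℝ) ^ γ)))
                  * Real.log p : ℝ) : ℂ) * e (t * (p : ℝ) ^ c)‖
        ≤ C * X / (Real.log X) ^ A := by
  refine ⟨1, one_pos, ?_⟩
  intro ε hε _
  obtain ⟨X₁, hX₁, h₁⟩ := BVP.perd γ c hγ₁ hγ₂ (by linarith)
  obtain ⟨X₂, hX₂, h₂⟩ := BVP.ev_log 1 (1/100000) (⌈A⌉₊ + 1) (by norm_num)
  refine ⟨1, one_pos, max X₁ X₂, ?_⟩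
  intro X hX t ht
  have hA1 : X₁ ≤ X := (le_max_left _ _).trans hX
  have g2 := h₂ X ((le_max_right _ _).trans hX)
  have hX1 : 1 ≤ X := by linarith
  have hX0 : 0 < X := by linarith
  have hl : 0 < Real.log X := Real.log_pos (by linarith)
  set D := X ^ ((443 / 55) * γ - 173 / 22 - ε) with hD
  have hDle : D ≤ X ^ (21/110 - 443/55 * (1 - γ)) := Real.rpow_le_rpow_of_exponent_le hX1 (by linarith)
  have hDX : D ≤ X := by
    calc D ≤ X ^ (1:ℝ) := Real.rpow_le_rpow_of_exponent_le hX1 (by linarith)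
      _ = X := Real.rpow_one X
  have hfl : (⌊D⌋₊ : ℝ) ≤ D := Nat.floor_le (by positivity)
  have hterm : ∀ d ∈ (Finset.Icc 1 ⌊D⌋₊).filter (fun d : ℕ => Int.gcd (d : ℤ) a = 1),
      ‖∑ p ∈ (Finset.Icc 1 ⌊X⌋₊).filter
                (fun p : ℕ => p.Prime ∧ (d : ℤ) ∣ ((p : ℤ) - a)),
              (((p : ℝ) ^ (1 - γ) * (saw (-(((p : ℝ) + 1) ^ γ)) - saw (-((p : ℝ) ^ γ)))
                  * Real.log p : ℝ) : ℂ) * e (t * (p : ℝ) ^ c)‖ ≤ X ^ (1 - 1/100000 : ℝ) * (1 / d) := by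
    intro d hd
    rw [Finset.mem_filter, Finset.mem_Icc] at hd
    have hdD : (d:ℝ) ≤ D := le_trans (by exact_mod_cast hd.1.2) hfl
    rw [mul_one_div]
    exact h₁ X hA1 a d t hd.1.1 (hdD.trans hDle) ht.le hd.2
  refine (Finset.sum_le_sum hterm).trans ?_
  rw [← Finset.mul_sum]
  have hs : ∑ d ∈ (Finset.Icc 1 ⌊D⌋₊).filter (fun d : ℕ => Int.gcd (d : ℤ) a = 1), (1:ℝ) / d ≤ 1 + Real.log X := by
    refine le_trans ?_ (BVP.harm ⌊D⌋₊ X hX1 (hfl.trans hDX))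
    exact Finset.sum_le_sum_of_subset_of_nonneg (Finset.filter_subset _ _) (fun _ _ _ => by positivity)
  rw [one_mul, le_div_iff₀ (by positivity)]
  have hpow : (Real.log X) ^ A ≤ (1 + Real.log X) ^ ⌈A⌉₊ := by
    calc (Real.log X) ^ A ≤ (1 + Real.log X) ^ A := Real.rpow_le_rpow hl.le (by linarith) hA.le
      _ ≤ (1 + Real.log X) ^ ((⌈A⌉₊ : ℕ) : ℝ) := Real.rpow_le_rpow_of_exponent_le (by linarith) (Nat.le_ceil A)
      _ = _ := Real.rpow_natCast _ _
  calc _ ≤ X ^ (1 - 1/100000 : ℝ) * (1 + Real.log X) * (1 + Real.log X) ^ ⌈A⌉₊ := by gcongr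
    _ = X ^ (1 - 1/100000 : ℝ) * (1 * (1 + Real.log X) ^ (⌈A⌉₊ + 1)) := by rw [pow_succ]; ring
    _ ≤ X ^ (1 - 1/100000 : ℝ) * X ^ (1/100000 : ℝ) := mul_le_mul_of_nonneg_left g2 (by positivity)
    _ = X := by rw [← Real.rpow_add hX0]; norm_num
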